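/- Let α ∈ ℝ and R̄ : V → ℝ, and suppose there exists ū ∈ U^H with combinatorial α-curvature R_α(ū) = R̄ such that one of the following holds: (1) α > 0 and R̄_i ≤ 0 for all i; (2) α < 0 and R̄_i ∈ [0, 2π) for all i; (3) α = 0, R̄_i < 2π for all i, and Σ_{i=1}^N R̄_i > 2πχ. Then for every initial value u(0) ∈ ℝ^{N₀} × (−∞,0)^{N₁}, the solution of the extended modified combinatorial α-Ricci flow du_i/dt = R̄_i − R̃_{α,i}(u) exists for all time t ∈ [0,∞) and converges exponentially fast to ū: there are constants C, β > 0 with ‖u(t) − ū‖ ≤ C e^{−βt} for all t ≥ 0. -/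

import Mathlib

open Real

/-- A combinatorial triangulation of a connected closed surface on the vertex set
`Fin N`: a nonempty set of triangular faces covering all vertices, such that every
edge (2-element subset of a face) lies in exactly two faces and the underlying
graph is connected. -/
structure TriSurface (N : ℕ) where
  /-- The set of faces, each a 3-element subset of the vertex set. -/
  F : Finset (Finset (Fin N))
  F_nonempty : F.Nonempty
  card_face : ∀ σ ∈ F, σ.card = 3
  vertex_cover : ∀ v : Fin N, ∃ σ ∈ F, v ∈ σ
  edge_two_faces : ∀ e : Finset (Fin N), e.card = 2 → (∃ σ ∈ F, e ⊆ σ) →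
    (F.filter fun σ => e ⊆ σ).card = 2
  connected : (SimpleGraph.fromRel fun i j => ∃ σ ∈ F, i ∈ σ ∧ j ∈ σ).Connected

namespace TriSurface

variable {N : ℕ}

/-- The edge set: all 2-element subsets of faces. -/
def edges (S : TriSurface N) : Finset (Finset (Fin N)) :=
  S.F.biUnion fun σ => Finset.powersetCard 2 σ

/-- The Euler characteristic `χ = N - |E| + |F|`. -/
def chi (S : TriSurface N) : ℤ :=
  (N : ℤ) - (S.edges.card : ℤ) + (S.F.card : ℤ)

/-- Weights on a triangulated surface: scheme coefficients `ε : V → {0,1}` and symmetric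
discrete conformal structure coefficients `η : E → ℝ`, subject to the structure conditions
`ε_s ε_t + η_st > 0` on every edge and `ε_q η_st + η_qs η_qt ≥ 0` in every face. -/
structure Weights (S : TriSurface N) where
  eps : Fin N → ℝ
  eta : Fin N → Fin N → ℝ
  eps01 : ∀ i, eps i = 0 ∨ eps i = 1
  eta_symm : ∀ i j, eta i j = eta j i
  structCond1 : ∀ i j : Fin N, ({i, j} : Finset (Fin N)) ∈ S.edges →
    eps i * eps j + eta i j > 0
  structCond2 : ∀ i j k : Fin N, ({i, j, k} : Finset (Fin N)) ∈ S.F →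
    i ≠ j → i ≠ k → j ≠ k → eps i * eta j k + eta i j * eta i k ≥ 0

variable {S : TriSurface N}

/-! ### Euclidean background -/

/-- Euclidean edge length `l_ij = sqrt(ε_i e^{2u_i} + ε_j e^{2u_j} + 2 η_ij e^{u_i+u_j})`. -/
noncomputable def lE (W : Weights S) (u : Fin N → ℝ) (i j : Fin N) : ℝ :=
  Real.sqrt (W.eps i * exp (2 * u i) + W.eps j * exp (2 * u j) +
    2 * W.eta i j * exp (u i + u j))

/-- The admissible space `U^E`: discrete conformal factors for which every face satisfies
the strict triangle inequalities. -/
def admissibleE (W : Weights S) (u : Fin N → ℝ) : Prop :=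
  ∀ i j k : Fin N, ({i, j, k} : Finset (Fin N)) ∈ S.F →
    lE W u i j + lE W u i k > lE W u j k

/-- The inner angle `θ_i^{jk}` at `i` in the face `{i,j,k}`, by the law of cosines. -/
noncomputable def thetaE (W : Weights S) (u : Fin N → ℝ) (i j k : Fin N) : ℝ :=
  arccos ((lE W u i j ^ 2 + lE W u i k ^ 2 - lE W u j k ^ 2) /
    (2 * lE W u i j * lE W u i k))

open Classical in
/-- The extended inner angle `θ̃_i^{jk}`: equal to `θ_i^{jk}` when the three strict triangle
inequalities hold in the face, to `π` when the edge opposite to `i` dominates, and to `0`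
otherwise. -/
noncomputable def thetaExE (W : Weights S) (u : Fin N → ℝ) (i j k : Fin N) : ℝ :=
  if lE W u i j + lE W u i k > lE W u j k ∧ lE W u i j + lE W u j k > lE W u i k ∧
      lE W u i k + lE W u j k > lE W u i j then thetaE W u i j k
  else if lE W u j k ≥ lE W u i j + lE W u i k then π else 0

open Classical in
/-- The angle at `i` in a face `σ` containing `i` (the half-sum over the two orderings of
the remaining two vertices; the angle is symmetric in the last two arguments). -/
noncomputable def faceAngleE (W : Weights S) (u : Fin N → ℝ) (i : Fin N)
    (σ : Finset (Fin N)) : ℝ :=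
  (1 / 2) * ∑ j ∈ σ.erase i, ∑ k ∈ (σ.erase i).erase j, thetaE W u i j k

open Classical in
/-- The extended angle at `i` in a face `σ` containing `i`. -/
noncomputable def faceAngleExE (W : Weights S) (u : Fin N → ℝ) (i : Fin N)
    (σ : Finset (Fin N)) : ℝ :=
  (1 / 2) * ∑ j ∈ σ.erase i, ∑ k ∈ (σ.erase i).erase j, thetaExE W u i j k

open Classical in
/-- The classical combinatorial curvature `K_i = 2π − Σ θ_i^{jk}`. -/
noncomputable def KE (W : Weights S) (u : Fin N → ℝ) (i : Fin N) : ℝ :=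
  2 * π - ∑ σ ∈ S.F.filter (fun σ => i ∈ σ), faceAngleE W u i σ

open Classical in
/-- The extended combinatorial curvature `K̃_i = 2π − Σ θ̃_i^{jk}`. -/
noncomputable def KExE (W : Weights S) (u : Fin N → ℝ) (i : Fin N) : ℝ :=
  2 * π - ∑ σ ∈ S.F.filter (fun σ => i ∈ σ), faceAngleExE W u i σ

/-- The combinatorial `α`-curvature `R_{α,i} = K_i e^{−α u_i}` (Euclidean background). -/
noncomputable def RE (W : Weights S) (α : ℝ) (u : Fin N → ℝ) (i : Fin N) : ℝ :=
  KE W u i * exp (-(α * u i))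

/-- The extended combinatorial `α`-curvature `R̃_{α,i} = K̃_i e^{−α u_i}` (Euclidean). -/
noncomputable def RExE (W : Weights S) (α : ℝ) (u : Fin N → ℝ) (i : Fin N) : ℝ :=
  KExE W u i * exp (-(α * u i))

/-- The Jacobian `∂K_i/∂u_j` of the curvature map in the Euclidean background. -/
noncomputable def DKE (W : Weights S) (u : Fin N → ℝ) (i j : Fin N) : ℝ :=
  fderiv ℝ (fun v => KE W v i) u (Pi.single j 1)

/-- The discrete `α`-Laplacian `(Δ_α g)_i = −e^{−α u_i} Σ_j (∂K_i/∂u_j) g_j` (Euclidean). -/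
noncomputable def LapE (W : Weights S) (α : ℝ) (u : Fin N → ℝ) (g : Fin N → ℝ)
    (i : Fin N) : ℝ :=
  -exp (-(α * u i)) * ∑ j, DKE W u i j * g j

/-! ### Hyperbolic background -/

/-- The inverse hyperbolic cosine. -/
noncomputable def arcosh (x : ℝ) : ℝ := Real.log (x + Real.sqrt (x ^ 2 - 1))

/-- Hyperbolic edge length
`l_ij = arcosh(sqrt((1+ε_i e^{2f_i})(1+ε_j e^{2f_j})) + η_ij e^{f_i+f_j})`. -/
noncomputable def lH (W : Weights S) (f : Fin N → ℝ) (i j : Fin N) : ℝ :=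
  arcosh (Real.sqrt ((1 + W.eps i * exp (2 * f i)) * (1 + W.eps j * exp (2 * f j))) +
    W.eta i j * exp (f i + f j))

open Classical in
/-- The coordinate change `f ↦ u` at a vertex with scheme coefficient `e`. -/
noncomputable def ucoord (e x : ℝ) : ℝ :=
  if e = 0 then x
  else (1 / 2) * Real.log ((Real.sqrt (1 + exp (2 * x)) - 1) / (Real.sqrt (1 + exp (2 * x)) + 1))

/-- The discrete conformal structure `u` associated to the conformal factor `f`
(hyperbolic background). -/
noncomputable def uOf (W : Weights S) (f : Fin N → ℝ) (i : Fin N) : ℝ :=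
  ucoord (W.eps i) (f i)

/-- The admissible space `U^H` (described in the `f`-coordinates): every face satisfies
the strict triangle inequalities. -/
def admissibleH (W : Weights S) (f : Fin N → ℝ) : Prop :=
  ∀ i j k : Fin N, ({i, j, k} : Finset (Fin N)) ∈ S.F →
    lH W f i j + lH W f i k > lH W f j k

/-- The inner angle `θ_i^{jk}` at `i` in the hyperbolic face `{i,j,k}`, by the hyperbolic
law of cosines. -/
noncomputable def thetaH (W : Weights S) (f : Fin N → ℝ) (i j k : Fin N) : ℝ :=
  arccos ((Real.cosh (lH W f i j) * Real.cosh (lH W f i k) - Real.cosh (lH W f j k)) /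
    (Real.sinh (lH W f i j) * Real.sinh (lH W f i k)))

open Classical in
/-- The extended hyperbolic inner angle `θ̃_i^{jk}`. -/
noncomputable def thetaExH (W : Weights S) (f : Fin N → ℝ) (i j k : Fin N) : ℝ :=
  if lH W f i j + lH W f i k > lH W f j k ∧ lH W f i j + lH W f j k > lH W f i k ∧
      lH W f i k + lH W f j k > lH W f i j then thetaH W f i j k
  else if lH W f j k ≥ lH W f i j + lH W f i k then π else 0

open Classical in
/-- The angle at `i` in a hyperbolic face `σ` containing `i`. -/
noncomputable def faceAngleH (W : Weights S) (f : Fin N → ℝ) (i : Fin N)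
    (σ : Finset (Fin N)) : ℝ :=
  (1 / 2) * ∑ j ∈ σ.erase i, ∑ k ∈ (σ.erase i).erase j, thetaH W f i j k

open Classical in
/-- The extended angle at `i` in a hyperbolic face `σ` containing `i`. -/
noncomputable def faceAngleExH (W : Weights S) (f : Fin N → ℝ) (i : Fin N)
    (σ : Finset (Fin N)) : ℝ :=
  (1 / 2) * ∑ j ∈ σ.erase i, ∑ k ∈ (σ.erase i).erase j, thetaExH W f i j k

open Classical in
/-- The classical combinatorial curvature (hyperbolic background). -/
noncomputable def KH (W : Weights S) (f : Fin N → ℝ) (i : Fin N) : ℝ :=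
  2 * π - ∑ σ ∈ S.F.filter (fun σ => i ∈ σ), faceAngleH W f i σ

open Classical in
/-- The extended combinatorial curvature (hyperbolic background). -/
noncomputable def KExH (W : Weights S) (f : Fin N → ℝ) (i : Fin N) : ℝ :=
  2 * π - ∑ σ ∈ S.F.filter (fun σ => i ∈ σ), faceAngleExH W f i σ

/-- The combinatorial `α`-curvature `R_{α,i} = K_i e^{−α u_i}` (hyperbolic background),
expressed as a function of the conformal factor `f`. -/
noncomputable def RH (W : Weights S) (α : ℝ) (f : Fin N → ℝ) (i : Fin N) : ℝ :=
  KH W f i * exp (-(α * uOf W f i))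

/-- The extended combinatorial `α`-curvature `R̃_{α,i} = K̃_i e^{−α u_i}` (hyperbolic). -/
noncomputable def RExH (W : Weights S) (α : ℝ) (f : Fin N → ℝ) (i : Fin N) : ℝ :=
  KExH W f i * exp (-(α * uOf W f i))

/-- The Jacobian `∂K_i/∂u_j` in the hyperbolic background, computed by the chain rule from
the `f`-coordinates: `(∂K_i/∂f_j) / (du_j/df_j)`. -/
noncomputable def DKH (W : Weights S) (f : Fin N → ℝ) (i j : Fin N) : ℝ :=
  fderiv ℝ (fun g => KH W g i) f (Pi.single j 1) / deriv (ucoord (W.eps j)) (f j)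

/-- The discrete `α`-Laplacian `(Δ_α g)_i = −e^{−α u_i} Σ_j (∂K_i/∂u_j) g_j` (hyperbolic). -/
noncomputable def LapH (W : Weights S) (α : ℝ) (f : Fin N → ℝ) (g : Fin N → ℝ)
    (i : Fin N) : ℝ :=
  -exp (-(α * uOf W f i)) * ∑ j, DKH W f i j * g j

/-- The Euclidean norm on `Fin N → ℝ`. -/
noncomputable def enorm (v : Fin N → ℝ) : ℝ := Real.sqrt (∑ i, v i ^ 2)

end TriSurface

open TriSurface

/-- A global solution of the extended modified combinatorial `α`-Ricci flow
`du_i/dt = R̄_i − R̃_{α,i}(u)` in the hyperbolic background, represented by the path `f(t)`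
of conformal factors (so that `u(t) = uOf (f(t))` ranges in `ℝ^{N₀} × (−∞,0)^{N₁}`). -/
def IsExtModRicciSolH {N : ℕ} {S : TriSurface N} (W : TriSurface.Weights S) (α : ℝ)
    (Rbar : Fin N → ℝ) (f : ℝ → Fin N → ℝ) : Prop :=
  ∀ t ∈ Set.Ici (0 : ℝ), ∀ i, HasDerivWithinAt (fun s => uOf W (f s) i)
    (Rbar i - RExH W α (f t) i) (Set.Ici (0 : ℝ)) t

/-- Exponential convergence of `u(t) = uOf (f(t))` to `ū = uOf f̄`. -/
def ExpConvergesToH {N : ℕ} {S : TriSurface N} (W : TriSurface.Weights S)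
    (f : ℝ → Fin N → ℝ) (fbar : Fin N → ℝ) : Prop :=
  ∃ C > (0 : ℝ), ∃ β > (0 : ℝ), ∀ t ≥ (0 : ℝ),
    TriSurface.enorm (fun i => uOf W (f t) i - uOf W fbar i) ≤ C * Real.exp (-β * t)

theorem ternary_form_pos {a₁ a₂ a₃ m₁ m₂ m₃ c : ℝ} (hc : 1 < c) (h₃ : 0 < a₃)
    (hdet : 0 < (a₃ * a₁ - m₂ ^ 2) * (a₃ * a₂ - m₁ ^ 2) - (a₃ * m₃ + m₁ * m₂) ^ 2)
    (htr : 0 < c * (a₃ * a₁ - m₂ ^ 2) - 2 * (a₃ * m₃ + m₁ * m₂) + c * (a₃ * a₂ - m₁ ^ 2))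
    {x y z : ℝ} (hw : ¬ (x = 0 ∧ y = 0 ∧ z = 0)) :
    0 < a₁ * x ^ 2 + a₂ * y ^ 2 + a₃ * z ^ 2 - 2 * m₃ * x * y - 2 * m₂ * x * z
      - 2 * m₁ * y * z := by
  have key : a₃ * (a₁ * x ^ 2 + a₂ * y ^ 2 + a₃ * z ^ 2 - 2 * m₃ * x * y - 2 * m₂ * x * z
      - 2 * m₁ * y * z) = (a₃ * z - m₂ * x - m₁ * y) ^ 2 + ((a₃ * a₁ - m₂ ^ 2) * x ^ 2
        - 2 * (a₃ * m₃ + m₁ * m₂) * x * y + (a₃ * a₂ - m₁ ^ 2) * y ^ 2) := by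
    ring
  generalize a₃ * a₁ - m₂ ^ 2 = P at *
  generalize a₃ * a₂ - m₁ ^ 2 = Q at *
  generalize a₃ * m₃ + m₁ * m₂ = R at *
  have hPQ : 0 < P * Q := by nlinarith [sq_nonneg R]
  have hP : 0 < P := by
    by_contra hP
    have hP0 : P < 0 := lt_of_le_of_ne (not_lt.1 hP) (fun h => by simp [h] at hPQ)
    have hQ0 : Q < 0 := by
      by_contra h
      nlinarith
    have h1 : -(P + Q) < -2 * R := by nlinarith
    have h2 : (-(P + Q)) ^ 2 < (-2 * R) ^ 2 := pow_lt_pow_left₀ h1 (by linarith) (by norm_num)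
    nlinarith [sq_nonneg (P - Q)]
  have key2 : P * (P * x ^ 2 - 2 * R * x * y + Q * y ^ 2)
      = (P * x - R * y) ^ 2 + (P * Q - R ^ 2) * y ^ 2 := by
    ring
  refine pos_of_mul_pos_right (a := a₃) ?_ h₃.le
  rw [key]
  by_cases hy : y = 0
  · by_cases hx : x = 0
    · have hz : z ≠ 0 := fun hz => hw ⟨hx, hy, hz⟩
      subst hx hy
      have : 0 < (a₃ * z) ^ 2 := by positivity
      simpa using this
    · subst hy
      have : 0 < P * x ^ 2 := by positivity
      nlinarith [sq_nonneg (a₃ * z - m₂ * x)]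
  · have h1 : 0 < P * (P * x ^ 2 - 2 * R * x * y + Q * y ^ 2) := by
      rw [key2]
      have : 0 < (P * Q - R ^ 2) * y ^ 2 := by positivity
      nlinarith [sq_nonneg (P * x - R * y)]
    have h2 := pos_of_mul_pos_right h1 hP.le
    nlinarith [sq_nonneg (a₃ * z - m₂ * x - m₁ * y)]

/-- The quadratic form of a hyperbolic triangle with `c i = cosh (l i)`. -/
def triForm (c₁ c₂ c₃ m₁ m₂ m₃ x y z : ℝ) : ℝ :=
  m₁ * (c₁ * (y ^ 2 + z ^ 2) - 2 * y * z) + m₂ * (c₂ * (x ^ 2 + z ^ 2) - 2 * x * z)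
    + m₃ * (c₃ * (x ^ 2 + y ^ 2) - 2 * x * y)

/-- The determinant of `triForm`. -/
def triDet (c₁ c₂ c₃ m₁ m₂ m₃ : ℝ) : ℝ :=
  (c₃ ^ 2 - 1) * (m₁ * c₁ + m₂ * c₂) * m₃ ^ 2
    + (c₃ * (m₁ ^ 2 * (c₁ ^ 2 - 1) + m₂ ^ 2 * (c₂ ^ 2 - 1))
      + 2 * m₁ * m₂ * (c₁ * c₂ * c₃ - 1)) * m₃
    + m₁ * m₂ * (m₁ * c₂ * (c₁ ^ 2 - 1) + m₂ * c₁ * (c₂ ^ 2 - 1))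

theorem triForm_swap (c₁ c₂ c₃ m₁ m₂ m₃ x y z : ℝ) :
    triForm c₂ c₁ c₃ m₂ m₁ m₃ y x z = triForm c₁ c₂ c₃ m₁ m₂ m₃ x y z := by
  unfold triForm; ring

theorem triForm_rotate (c₁ c₂ c₃ m₁ m₂ m₃ x y z : ℝ) :
    triForm c₂ c₃ c₁ m₂ m₃ m₁ y z x = triForm c₁ c₂ c₃ m₁ m₂ m₃ x y z := by
  unfold triForm; ring

theorem triDet_swap (c₁ c₂ c₃ m₁ m₂ m₃ : ℝ) :
    triDet c₂ c₁ c₃ m₂ m₁ m₃ = triDet c₁ c₂ c₃ m₁ m₂ m₃ := by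
  unfold triDet; ring

/-- The discriminant `1 + 2 c₁ c₂ c₃ - c₁² - c₂² - c₃²`. -/
def triDisc (c₁ c₂ c₃ : ℝ) : ℝ := 1 + 2 * c₁ * c₂ * c₃ - c₁ ^ 2 - c₂ ^ 2 - c₃ ^ 2

theorem triDisc_mul_triDet (c₁ c₂ c₃ m₁ m₂ m₃ : ℝ) :
    triDisc c₁ c₂ c₃ * triDet c₁ c₂ c₃ m₁ m₂ m₃ =
      (m₂ * (c₂ ^ 2 - 1) + m₃ * (c₂ * c₃ - c₁)) * (m₁ * (c₁ * c₃ - c₂) + m₃ * (c₃ ^ 2 - 1)) *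
          (m₁ * (c₁ ^ 2 - 1) + m₂ * (c₁ * c₂ - c₃)) +
        (m₁ * (c₁ ^ 2 - 1) + m₃ * (c₁ * c₃ - c₂)) * (m₂ * (c₂ ^ 2 - 1) + m₁ * (c₁ * c₂ - c₃)) *
          (m₂ * (c₂ * c₃ - c₁) + m₃ * (c₃ ^ 2 - 1)) := by
  unfold triDisc triDet; ring

/-- If the determinant, as a function of a negative `m₃`, has a larger non-positivity point to the
left of `m₃`, the form is positive. -/
theorem triForm_pos_of_triDet_nonpos {c₁ c₂ c₃ m₁ m₂ m₃ x₀ : ℝ} (h₁ : 1 < c₁) (h₂ : 1 < c₂)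
    (h₃ : 1 < c₃) (hm₁ : 0 < m₁) (hm₂ : 0 < m₂) (hdet : 0 < triDet c₁ c₂ c₃ m₁ m₂ m₃)
    (hx₀ : x₀ < m₃) (hdet₀ : triDet c₁ c₂ c₃ m₁ m₂ x₀ ≤ 0) {x y z : ℝ}
    (hw : ¬ (x = 0 ∧ y = 0 ∧ z = 0)) : 0 < triForm c₁ c₂ c₃ m₁ m₂ m₃ x y z := by
  have hb : 0 < m₁ * c₁ + m₂ * c₂ := by positivity
  have hJ : 0 < c₃ * (m₁ ^ 2 * (c₁ ^ 2 - 1) + m₂ ^ 2 * (c₂ ^ 2 - 1))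
      + 2 * m₁ * m₂ * (c₁ * c₂ * c₃ - 1) + 2 * ((c₃ ^ 2 - 1) * (m₁ * c₁ + m₂ * c₂)) * m₃ := by
    unfold triDet at hdet hdet₀
    have hA : 0 < (c₃ ^ 2 - 1) * (m₁ * c₁ + m₂ * c₂) := mul_pos (by nlinarith) hb
    generalize (c₃ ^ 2 - 1) * (m₁ * c₁ + m₂ * c₂) = A at *
    generalize c₃ * (m₁ ^ 2 * (c₁ ^ 2 - 1) + m₂ ^ 2 * (c₂ ^ 2 - 1))
      + 2 * m₁ * m₂ * (c₁ * c₂ * c₃ - 1) = L at *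
    by_contra hneg
    have h1 : A * (x₀ + m₃) + L < 0 := by nlinarith
    nlinarith [mul_pos_of_neg_of_neg (sub_neg.2 hx₀) h1]
  have := ternary_form_pos (a₁ := m₂ * c₂ + m₃ * c₃) (a₂ := m₁ * c₁ + m₃ * c₃)
    (a₃ := m₁ * c₁ + m₂ * c₂) (m₁ := m₁) (m₂ := m₂) (m₃ := m₃) h₃ hb
    (by
      have := mul_pos hb hdet
      unfold triDet at this
      linarith)
    (by linarith) hw
  unfold triForm
  linarith

theorem triForm_pos_of_nonneg {c₁ c₂ c₃ m₁ m₂ m₃ : ℝ} (h₁ : 1 < c₁) (h₂ : 1 < c₂)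
    (h₃ : 1 < c₃) (hm₁ : 0 < m₁) (hm₂ : 0 < m₂) (hm₃ : 0 ≤ m₃) {x y z : ℝ}
    (hw : ¬ (x = 0 ∧ y = 0 ∧ z = 0)) : 0 < triForm c₁ c₂ c₃ m₁ m₂ m₃ x y z := by
  have key : ∀ {c s t : ℝ}, 1 < c → 0 ≤ c * (s ^ 2 + t ^ 2) - 2 * s * t ∧
      (¬ (s = 0 ∧ t = 0) → 0 < c * (s ^ 2 + t ^ 2) - 2 * s * t) := by
    intro c s t hc
    refine ⟨by nlinarith [sq_nonneg (s - t), sq_nonneg s, sq_nonneg t], fun h => ?_⟩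
    have : 0 < s ^ 2 + t ^ 2 := by
      by_contra hh
      exact h ⟨by nlinarith [sq_nonneg s, sq_nonneg t], by nlinarith [sq_nonneg s, sq_nonneg t]⟩
    nlinarith [sq_nonneg (s - t)]
  have e3 := mul_nonneg hm₃ (key h₃ (s := x) (t := y)).1
  have e1 := mul_nonneg hm₁.le (key h₁ (s := y) (t := z)).1
  have e2 := mul_nonneg hm₂.le (key h₂ (s := x) (t := z)).1
  unfold triForm
  by_cases h : y = 0 ∧ z = 0
  · have := mul_pos hm₂ ((key h₂ (s := x) (t := z)).2 fun hh => hw ⟨hh.1, h.1, h.2⟩)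
    linarith
  · have := mul_pos hm₁ ((key h₁ (s := y) (t := z)).2 h)
    linarith

theorem triForm_pos_of_neg_aux {c₁ c₂ c₃ m₁ m₂ m₃ : ℝ} (h₁ : 1 < c₁) (h₂ : 1 < c₂)
    (h₃ : 1 < c₃) (hD : 0 < triDisc c₁ c₂ c₃) (hm₁ : 0 < m₁) (hm₂ : 0 < m₂)
    (hdet : 0 < triDet c₁ c₂ c₃ m₁ m₂ m₃)
    (h12 : 0 < m₂ * (c₂ ^ 2 - 1) + m₃ * (c₂ * c₃ - c₁))
    (hX : 0 < c₂ * c₃ - c₁)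
    (hXm : m₂ * (c₂ ^ 2 - 1) * (c₁ * c₃ - c₂) ≤ m₁ * (c₁ ^ 2 - 1) * (c₂ * c₃ - c₁)) {x y z : ℝ}
    (hw : ¬ (x = 0 ∧ y = 0 ∧ z = 0)) : 0 < triForm c₁ c₂ c₃ m₁ m₂ m₃ x y z := by
  have hs1 : 0 < c₁ ^ 2 - 1 := by nlinarith
  have hs2 : 0 < c₂ ^ 2 - 1 := by nlinarith
  have hs3 : 0 < c₃ ^ 2 - 1 := by nlinarith
  set x₀ := -(m₂ * (c₂ ^ 2 - 1)) / (c₂ * c₃ - c₁) with hx₀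
  have hx₀' : m₂ * (c₂ ^ 2 - 1) + x₀ * (c₂ * c₃ - c₁) = 0 := by
    rw [hx₀]; field_simp; ring
  have hlt : x₀ < m₃ := by
    rw [hx₀, div_lt_iff₀ hX]; linarith
  have h13 : m₂ * (c₂ * c₃ - c₁) + x₀ * (c₃ ^ 2 - 1) < 0 := by
    have : (c₂ * c₃ - c₁) * (m₂ * (c₂ * c₃ - c₁) + x₀ * (c₃ ^ 2 - 1))
        = - (m₂ * triDisc c₁ c₂ c₃) := by
      unfold triDisc
      linear_combination (c₃ ^ 2 - 1) * hx₀'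
    have h : 0 < m₂ * triDisc c₁ c₂ c₃ := by positivity
    by_contra hc
    nlinarith [mul_nonneg hX.le (not_lt.1 hc)]
  by_cases h32 : 0 ≤ m₂ * (c₂ ^ 2 - 1) + m₁ * (c₁ * c₂ - c₃)
  · have h21 : 0 ≤ m₁ * (c₁ ^ 2 - 1) + x₀ * (c₁ * c₃ - c₂) := by
      rw [hx₀, div_mul_eq_mul_div, ← sub_nonneg, sub_zero]
      have : m₁ * (c₁ ^ 2 - 1) + -(m₂ * (c₂ ^ 2 - 1)) * (c₁ * c₃ - c₂) / (c₂ * c₃ - c₁)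
        = (m₁ * (c₁ ^ 2 - 1) * (c₂ * c₃ - c₁) - m₂ * (c₂ ^ 2 - 1) * (c₁ * c₃ - c₂))
          / (c₂ * c₃ - c₁) := by field_simp; ring
      rw [this]
      exact div_nonneg (by linarith) hX.le
    refine triForm_pos_of_triDet_nonpos h₁ h₂ h₃ hm₁ hm₂ hdet hlt ?_ hw
    have := triDisc_mul_triDet c₁ c₂ c₃ m₁ m₂ x₀
    rw [hx₀'] at this
    by_contra hc
    nlinarith [mul_pos hD (not_le.1 hc), mul_nonneg (mul_nonneg h21 h32) (neg_pos.2 h13).le]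
  · push Not at h32
    have hX3 : 0 < c₃ - c₁ * c₂ := by
      by_contra hc
      nlinarith [mul_pos hm₂ hs2, mul_nonneg hm₁.le (sub_nonneg.2 (sub_nonpos.1 (not_lt.1 hc)))]
    set n := m₂ * (c₂ ^ 2 - 1) / (c₃ - c₁ * c₂) with hn
    have hn' : m₂ * (c₂ ^ 2 - 1) + n * (c₁ * c₂ - c₃) = 0 := by
      have : n * (c₃ - c₁ * c₂) = m₂ * (c₂ ^ 2 - 1) := div_mul_cancel₀ _ hX3.ne'
      linarith
    have hn0 : 0 < n := by positivity
    have hnm : n ≤ m₁ := by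
      rw [hn, div_le_iff₀ hX3]; linarith
    have h31 : 0 < n * (c₁ ^ 2 - 1) + m₂ * (c₁ * c₂ - c₃) := by
      have : (c₃ - c₁ * c₂) * (n * (c₁ ^ 2 - 1) + m₂ * (c₁ * c₂ - c₃))
          = m₂ * triDisc c₁ c₂ c₃ := by
        unfold triDisc
        linear_combination (1 - c₁ ^ 2) * hn'
      exact pos_of_mul_pos_right (this ▸ mul_pos hm₂ hD) hX3.le
    have h23 : 0 < n * (c₁ * c₃ - c₂) + m₃ * (c₃ ^ 2 - 1) := by
      have e : (c₃ - c₁ * c₂) * (c₂ * c₃ - c₁) * (n * (c₁ * c₃ - c₂) + x₀ * (c₃ ^ 2 - 1))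
          = m₂ * (c₂ ^ 2 - 1) * c₃ * triDisc c₁ c₂ c₃ := by
        unfold triDisc
        linear_combination (-(c₂ * c₃ - c₁) * (c₁ * c₃ - c₂)) * hn' + (c₃ - c₁ * c₂) * (c₃ ^ 2 - 1) * hx₀'
      have : 0 < n * (c₁ * c₃ - c₂) + x₀ * (c₃ ^ 2 - 1) :=
        pos_of_mul_pos_right (e ▸ by positivity) (mul_pos hX3 hX).le
      nlinarith
    have hd : 0 < triDet c₁ c₂ c₃ n m₂ m₃ := by
      have := triDisc_mul_triDet c₁ c₂ c₃ n m₂ m₃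
      rw [hn', mul_zero, zero_mul, add_zero] at this
      exact pos_of_mul_pos_right (this ▸ by positivity) hD.le
    have hd0 : triDet c₁ c₂ c₃ n m₂ x₀ ≤ 0 := by
      have := triDisc_mul_triDet c₁ c₂ c₃ n m₂ x₀
      rw [hn', hx₀'] at this
      simp only [mul_zero, zero_mul, add_zero] at this
      rcases mul_eq_zero.1 this with h | h
      · exact absurd h hD.ne'
      · exact h.le
    have hp := triForm_pos_of_triDet_nonpos h₁ h₂ h₃ hn0 hm₂ hd hlt hd0 hw
    have : triForm c₁ c₂ c₃ m₁ m₂ m₃ x y z = triForm c₁ c₂ c₃ n m₂ m₃ x y z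
        + (m₁ - n) * (c₁ * (y ^ 2 + z ^ 2) - 2 * y * z) := by unfold triForm; ring
    rw [this]
    have : 0 ≤ (m₁ - n) * (c₁ * (y ^ 2 + z ^ 2) - 2 * y * z) :=
      mul_nonneg (by linarith) (by nlinarith [sq_nonneg (y - z), sq_nonneg y, sq_nonneg z])
    linarith

theorem triForm_pos_of_neg {c₁ c₂ c₃ m₁ m₂ m₃ : ℝ} (h₁ : 1 < c₁) (h₂ : 1 < c₂)
    (h₃ : 1 < c₃) (hD : 0 < triDisc c₁ c₂ c₃) (hm₁ : 0 < m₁) (hm₂ : 0 < m₂)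
    (hdet : 0 < triDet c₁ c₂ c₃ m₁ m₂ m₃)
    (h12 : 0 < m₂ * (c₂ ^ 2 - 1) + m₃ * (c₂ * c₃ - c₁))
    (h21 : 0 < m₁ * (c₁ ^ 2 - 1) + m₃ * (c₁ * c₃ - c₂)) {x y z : ℝ}
    (hw : ¬ (x = 0 ∧ y = 0 ∧ z = 0)) : 0 < triForm c₁ c₂ c₃ m₁ m₂ m₃ x y z := by
  have hs1 : 0 < c₁ ^ 2 - 1 := by nlinarith
  have hs2 : 0 < c₂ ^ 2 - 1 := by nlinarith
  have hs3 : 0 < c₃ ^ 2 - 1 := by nlinarith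
  have e1 : (c₂ * c₃ - c₁) + c₃ * (c₁ * c₃ - c₂) = c₁ * (c₃ ^ 2 - 1) := by ring
  have e2 : (c₁ * c₃ - c₂) + c₃ * (c₂ * c₃ - c₁) = c₂ * (c₃ ^ 2 - 1) := by ring
  have p1 : 0 < c₁ * (c₃ ^ 2 - 1) := by positivity
  have p2 : 0 < c₂ * (c₃ ^ 2 - 1) := by positivity
  have q1 := mul_pos hm₁ hs1
  have q2 := mul_pos hm₂ hs2
  rcases le_total (m₂ * (c₂ ^ 2 - 1) * (c₁ * c₃ - c₂)) (m₁ * (c₁ ^ 2 - 1) * (c₂ * c₃ - c₁)) with h | h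
  · refine triForm_pos_of_neg_aux h₁ h₂ h₃ hD hm₁ hm₂ hdet h12 ?_ h hw
    by_contra hc
    have : c₁ * c₃ - c₂ ≤ 0 := by
      by_contra hc2
      nlinarith [mul_pos q2 (not_le.1 hc2), mul_nonneg q1.le (sub_nonneg.2 (not_lt.1 hc))]
    nlinarith
  · rw [← triForm_swap]
    refine triForm_pos_of_neg_aux h₂ h₁ h₃ ?_ hm₂ hm₁ ?_ h21 ?_ ?_ (fun hh => hw ⟨hh.2.1, hh.1, hh.2.2⟩)
    · convert hD using 1; unfold triDisc; ring
    · rwa [triDet_swap]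
    · by_contra hc
      have : c₂ * c₃ - c₁ ≤ 0 := by
        by_contra hc2
        nlinarith [mul_pos q1 (not_le.1 hc2), mul_nonneg q2.le (sub_nonneg.2 (not_lt.1 hc))]
      nlinarith
    · linarith

/-- Sign lemma: under the structure conditions at most one of the cofactor sums is nonpositive. -/
theorem cofactor_pos_of_neg {e₁ e₂ e₃ a b g T₁ T₂ T₃ : ℝ} (he₁ : e₁ = 0 ∨ e₁ = 1)
    (he₂ : e₂ = 0 ∨ e₂ = 1) (he₃ : e₃ = 0 ∨ e₃ = 1)
    (hT₁ : 0 < T₁) (hT₂ : 0 < T₂) (hT₃ : 0 < T₃)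
    (ha : 0 < e₂ * e₃ + a) (hg : 0 < e₁ * e₂ + g)
    (h₁ : 0 ≤ e₁ * a + b * g) (h₂ : 0 ≤ e₂ * b + a * g) (h₃ : 0 ≤ e₃ * g + a * b)
    (hD : 0 < T₁ * ((e₂ * e₃ - a ^ 2) * T₁ + (e₃ * g + a * b) * T₂ + (e₂ * b + a * g) * T₃)
      + T₂ * ((e₁ * e₃ - b ^ 2) * T₂ + (e₃ * g + a * b) * T₁ + (e₁ * a + b * g) * T₃)
      + T₃ * ((e₁ * e₂ - g ^ 2) * T₃ + (e₂ * b + a * g) * T₁ + (e₁ * a + b * g) * T₂)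
      + (-(e₁ * e₂ * e₃) + 2 * a * b * g + e₁ * a ^ 2 + e₂ * b ^ 2 + e₃ * g ^ 2))
    (hk : (e₁ * e₂ - g ^ 2) * T₃ + (e₂ * b + a * g) * T₁ + (e₁ * a + b * g) * T₂ < 0) :
    0 < (e₂ * e₃ - a ^ 2) * T₁ + (e₃ * g + a * b) * T₂ + (e₂ * b + a * g) * T₃ := by
  by_contra hk1
  push Not at hk1
  have hn1 := mul_nonneg h₁ hT₂.le
  have hn2 := mul_nonneg h₂ hT₁.le
  have hn3 := mul_nonneg h₃ hT₂.le
  have hn4 := mul_nonneg h₂ hT₃.le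
  have e1n : 0 ≤ e₁ := by rcases he₁ with h | h <;> simp [h]
  have e2n : 0 ≤ e₂ := by rcases he₂ with h | h <;> simp [h]
  have e3n : 0 ≤ e₃ := by rcases he₃ with h | h <;> simp [h]
  have A3 : 0 < g ^ 2 - e₁ * e₂ := by
    by_contra h
    nlinarith [mul_nonneg (sub_nonneg.2 (sub_nonpos.1 (not_lt.1 h))) hT₃.le]
  have A1 : 0 ≤ a ^ 2 - e₂ * e₃ := by
    by_contra h
    nlinarith [mul_pos (sub_pos.2 (sub_neg.1 (not_le.1 h))) hT₁]
  have gpos : 0 < g := by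
    rcases he₁ with rfl | rfl <;> rcases he₂ with rfl | rfl <;> nlinarith
  have apos : 0 < a := by
    rcases he₂ with rfl | rfl <;> rcases he₃ with rfl | rfl <;> nlinarith
  set dH := -(e₁ * e₂ * e₃) + 2 * a * b * g + e₁ * a ^ 2 + e₂ * b ^ 2 + e₃ * g ^ 2 with hdH
  have u1 : (e₂ * b + a * g) * T₁ < (g ^ 2 - e₁ * e₂) * T₃ := by linarith
  have u2 : (e₂ * b + a * g) * T₃ ≤ (a ^ 2 - e₂ * e₃) * T₁ := by linarith
  have u3 : (e₂ * b + a * g) ^ 2 * (T₁ * T₃) ≤ (g ^ 2 - e₁ * e₂) * (a ^ 2 - e₂ * e₃) * (T₁ * T₃) := by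
    have := mul_le_mul u1.le u2 hn4 (mul_pos A3 hT₃).le
    linarith
  have u4 : (e₂ * b + a * g) ^ 2 ≤ (g ^ 2 - e₁ * e₂) * (a ^ 2 - e₂ * e₃) :=
    le_of_mul_le_mul_right u3 (mul_pos hT₁ hT₃)
  rcases he₂ with rfl | rfl
  · have hag : 0 < a * g := mul_pos apos gpos
    have h5 : 0 < (0 * b + a * g) * T₃ := by rw [zero_mul, zero_add]; positivity
    have := mul_lt_mul u1 u2 h5 (mul_pos A3 hT₃).le
    nlinarith
  · have hdet : 0 < dH := by
      have hs : 0 < g ^ 2 - e₁ * 1 + 2 * g * T₁ * T₂ + 1 * T₁ ^ 2 + e₁ * T₂ ^ 2 := by positivity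
      have key : ((e₁ * 1 - g ^ 2) * T₃ + (1 * b + a * g) * T₁ + (e₁ * a + b * g) * T₂) ^ 2
          + (g ^ 2 - e₁ * 1) * (T₁ * ((1 * e₃ - a ^ 2) * T₁ + (e₃ * g + a * b) * T₂ + (1 * b + a * g) * T₃)
      + T₂ * ((e₁ * e₃ - b ^ 2) * T₂ + (e₃ * g + a * b) * T₁ + (e₁ * a + b * g) * T₃)
      + T₃ * ((e₁ * 1 - g ^ 2) * T₃ + (1 * b + a * g) * T₁ + (e₁ * a + b * g) * T₂)
      + dH) = dH * (g ^ 2 - e₁ * 1 + 2 * g * T₁ * T₂ + 1 * T₁ ^ 2 + e₁ * T₂ ^ 2) := by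
        rw [hdH]; ring
      refine pos_of_mul_pos_left (b := g ^ 2 - e₁ * 1 + 2 * g * T₁ * T₂ + 1 * T₁ ^ 2 + e₁ * T₂ ^ 2) ?_ hs.le
      rw [← key]
      have := mul_pos A3 hD
      positivity
    rw [hdH] at hdet
    nlinarith

theorem edge_product_pos {e₁ e₂ e₃ a b g T₁ T₂ T₃ : ℝ} (he₁ : e₁ = 0 ∨ e₁ = 1)
    (he₂ : e₂ = 0 ∨ e₂ = 1) (he₃ : e₃ = 0 ∨ e₃ = 1)
    (hT₁ : 0 < T₁) (hT₂ : 0 < T₂) (hT₃ : 0 < T₃)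
    (ha : 0 < e₂ * e₃ + a) (hb : 0 < e₁ * e₃ + b) (hg : 0 < e₁ * e₂ + g)
    (h₁ : 0 ≤ e₁ * a + b * g) (h₂ : 0 ≤ e₂ * b + a * g) (h₃ : 0 ≤ e₃ * g + a * b) :
    0 < (e₁ * T₂ + g * T₁) * (e₂ * T₃ + a * T₂) * (e₃ * T₁ + b * T₃)
      + (e₂ * T₁ + g * T₂) * (e₃ * T₂ + a * T₃) * (e₁ * T₃ + b * T₁) := by
  have key : (e₁ * T₂ + g * T₁) * (e₂ * T₃ + a * T₂) * (e₃ * T₁ + b * T₃)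
      + (e₂ * T₁ + g * T₂) * (e₃ * T₂ + a * T₃) * (e₁ * T₃ + b * T₁)
      = 2 * (T₁ * T₂ * T₃) * (e₁ * e₂ * e₃ + a * b * g)
        + e₁ * (T₂ * T₃ ^ 2 * (e₂ * b + a * g) + T₂ ^ 2 * T₃ * (e₃ * g + a * b))
        + e₂ * (T₁ * T₃ ^ 2 * (e₁ * a + b * g) + T₁ ^ 2 * T₃ * (e₃ * g + a * b))
        + e₃ * (T₁ * T₂ ^ 2 * (e₁ * a + b * g) + T₁ ^ 2 * T₂ * (e₂ * b + a * g)) := by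
    ring
  rw [key]
  rcases he₁ with rfl | rfl <;> rcases he₂ with rfl | rfl <;> rcases he₃ with rfl | rfl <;>
    simp only [zero_mul, mul_zero, one_mul, mul_one, zero_add, add_zero] at *
  · positivity
  · positivity
  · positivity
  · have : 0 < T₁ * T₂ * T₃ * (b * g * (1 + a)) := by positivity
    nlinarith [mul_nonneg hT₁.le (mul_nonneg h₁ (sq_nonneg (T₂ - T₃))),
      mul_nonneg h₂ hT₂.le, mul_nonneg (mul_nonneg hT₂.le h₂) (sq_nonneg T₁),
      mul_nonneg (mul_nonneg hT₃.le h₃) (sq_nonneg T₁)]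
  · positivity
  · have : 0 < T₁ * T₂ * T₃ * (a * g * (1 + b)) := by positivity
    nlinarith [mul_nonneg hT₂.le (mul_nonneg h₂ (sq_nonneg (T₁ - T₃))),
      mul_nonneg (mul_nonneg hT₁.le h₁) (sq_nonneg T₂),
      mul_nonneg (mul_nonneg hT₃.le h₃) (sq_nonneg T₂)]
  · have : 0 < T₁ * T₂ * T₃ * (a * b * (1 + g)) := by positivity
    nlinarith [mul_nonneg hT₃.le (mul_nonneg h₃ (sq_nonneg (T₁ - T₂))),
      mul_nonneg (mul_nonneg hT₁.le h₁) (sq_nonneg T₃),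
      mul_nonneg (mul_nonneg hT₂.le h₂) (sq_nonneg T₃)]
  · have : 0 < T₁ * T₂ * T₃ * ((1 + a) * (1 + b) * (1 + g)) := by positivity
    nlinarith [mul_nonneg hT₃.le (mul_nonneg h₃ (sq_nonneg (T₁ - T₂))),
      mul_nonneg hT₂.le (mul_nonneg h₂ (sq_nonneg (T₁ - T₃))),
      mul_nonneg hT₁.le (mul_nonneg h₁ (sq_nonneg (T₂ - T₃)))]

/-- The cofactor sum `adj G * C` (first entry) for the Gram matrix with off-diagonal entries `c`. -/
def gramCof (c₁ c₂ c₃ C₁ C₂ C₃ : ℝ) : ℝ :=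
  (1 - c₁ ^ 2) * C₁ + (c₁ * c₂ - c₃) * C₂ + (c₁ * c₃ - c₂) * C₃

theorem gramCof_eq {e₂ e₃ a b g S₁ S₂ S₃ C₁ C₂ C₃ : ℝ} (hC₂ : C₂ ^ 2 = 1 + e₂ * S₂ ^ 2)
    (hC₃ : C₃ ^ 2 = 1 + e₃ * S₃ ^ 2) :
    gramCof (C₂ * C₃ + a * (S₂ * S₃)) (C₁ * C₃ + b * (S₁ * S₃)) (C₁ * C₂ + g * (S₁ * S₂)) C₁ C₂ C₃ =
      S₂ * S₃ * (S₂ * S₃ * (e₂ * e₃ - a ^ 2) * C₁ + S₁ * S₃ * (e₃ * g + a * b) * C₂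
        + S₁ * S₂ * (e₂ * b + a * g) * C₃) := by
  unfold gramCof
  have h1 : e₂ * S₂ ^ 2 = C₂ ^ 2 - 1 := by linarith
  have h2 : e₃ * S₃ ^ 2 = C₃ ^ 2 - 1 := by linarith
  linear_combination (-S₃^2 * e₃ * C₁ - b * S₁ * S₃ * C₃) * h1
    + (-(C₂ ^ 2 - 1) * C₁ - g * S₁ * S₂ * C₂) * h2

theorem one_lt_edge {e₂ e₃ a S₂ S₃ C₂ C₃ : ℝ} (he₂ : e₂ = 0 ∨ e₂ = 1) (he₃ : e₃ = 0 ∨ e₃ = 1)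
    (hS₂ : 0 < S₂) (hS₃ : 0 < S₃) (hC₂p : 0 < C₂) (hC₃p : 0 < C₃)
    (hC₂ : C₂ ^ 2 = 1 + e₂ * S₂ ^ 2) (hC₃ : C₃ ^ 2 = 1 + e₃ * S₃ ^ 2) (ha : 0 < e₂ * e₃ + a) :
    1 < C₂ * C₃ + a * (S₂ * S₃) := by
  have h1 : (1 + e₂ * e₃ * (S₂ * S₃)) ^ 2 ≤ (C₂ * C₃) ^ 2 := by
    rw [mul_pow, hC₂, hC₃]
    rcases he₂ with rfl | rfl <;> rcases he₃ with rfl | rfl <;>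
      nlinarith [sq_nonneg (S₂ - S₃), sq_nonneg S₂, sq_nonneg S₃]
  have h2 := abs_le_of_sq_le_sq h1 (by positivity)
  have h3 := mul_pos ha (mul_pos hS₂ hS₃)
  nlinarith [(le_abs_self _).trans h2]

theorem triDet_pos_of_struct {c₁ c₂ c₃ C₁ C₂ C₃ : ℝ} (h₁ : 1 < c₁) (h₂ : 1 < c₂) (h₃ : 1 < c₃)
    (hD : 0 < triDisc c₁ c₂ c₃)
    (hp : 0 < (C₁ * c₃ - C₂) * (C₂ * c₁ - C₃) * (C₃ * c₂ - C₁)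
      + (C₂ * c₃ - C₁) * (C₃ * c₁ - C₂) * (C₁ * c₂ - C₃)) :
    0 < triDet c₁ c₂ c₃ (gramCof c₁ c₂ c₃ C₁ C₂ C₃ / (c₁ ^ 2 - 1))
      (gramCof c₂ c₃ c₁ C₂ C₃ C₁ / (c₂ ^ 2 - 1)) (gramCof c₃ c₁ c₂ C₃ C₁ C₂ / (c₃ ^ 2 - 1)) := by
  have hs1 : 0 < c₁ ^ 2 - 1 := by nlinarith
  have hs2 : 0 < c₂ ^ 2 - 1 := by nlinarith
  have hs3 : 0 < c₃ ^ 2 - 1 := by nlinarith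
  have key := triDisc_mul_triDet c₁ c₂ c₃ (gramCof c₁ c₂ c₃ C₁ C₂ C₃ / (c₁ ^ 2 - 1))
      (gramCof c₂ c₃ c₁ C₂ C₃ C₁ / (c₂ ^ 2 - 1)) (gramCof c₃ c₁ c₂ C₃ C₁ C₂ / (c₃ ^ 2 - 1))
  have e12 : gramCof c₂ c₃ c₁ C₂ C₃ C₁ / (c₂ ^ 2 - 1) * (c₂ ^ 2 - 1)
      + gramCof c₃ c₁ c₂ C₃ C₁ C₂ / (c₃ ^ 2 - 1) * (c₂ * c₃ - c₁)
      = triDisc c₁ c₂ c₃ * (C₁ * c₃ - C₂) / (c₃ ^ 2 - 1) := by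
    unfold gramCof triDisc; field_simp; ring
  have e21 : gramCof c₁ c₂ c₃ C₁ C₂ C₃ / (c₁ ^ 2 - 1) * (c₁ ^ 2 - 1)
      + gramCof c₃ c₁ c₂ C₃ C₁ C₂ / (c₃ ^ 2 - 1) * (c₁ * c₃ - c₂)
      = triDisc c₁ c₂ c₃ * (C₂ * c₃ - C₁) / (c₃ ^ 2 - 1) := by
    unfold gramCof triDisc; field_simp; ring
  have e23 : gramCof c₁ c₂ c₃ C₁ C₂ C₃ / (c₁ ^ 2 - 1) * (c₁ * c₃ - c₂)
      + gramCof c₃ c₁ c₂ C₃ C₁ C₂ / (c₃ ^ 2 - 1) * (c₃ ^ 2 - 1)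
      = triDisc c₁ c₂ c₃ * (C₂ * c₁ - C₃) / (c₁ ^ 2 - 1) := by
    unfold gramCof triDisc; field_simp; ring
  have e32 : gramCof c₂ c₃ c₁ C₂ C₃ C₁ / (c₂ ^ 2 - 1) * (c₂ ^ 2 - 1)
      + gramCof c₁ c₂ c₃ C₁ C₂ C₃ / (c₁ ^ 2 - 1) * (c₁ * c₂ - c₃)
      = triDisc c₁ c₂ c₃ * (C₃ * c₁ - C₂) / (c₁ ^ 2 - 1) := by
    unfold gramCof triDisc; field_simp; ring
  have e31 : gramCof c₁ c₂ c₃ C₁ C₂ C₃ / (c₁ ^ 2 - 1) * (c₁ ^ 2 - 1)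
      + gramCof c₂ c₃ c₁ C₂ C₃ C₁ / (c₂ ^ 2 - 1) * (c₁ * c₂ - c₃)
      = triDisc c₁ c₂ c₃ * (C₃ * c₂ - C₁) / (c₂ ^ 2 - 1) := by
    unfold gramCof triDisc; field_simp; ring
  have e13 : gramCof c₂ c₃ c₁ C₂ C₃ C₁ / (c₂ ^ 2 - 1) * (c₂ * c₃ - c₁)
      + gramCof c₃ c₁ c₂ C₃ C₁ C₂ / (c₃ ^ 2 - 1) * (c₃ ^ 2 - 1)
      = triDisc c₁ c₂ c₃ * (C₁ * c₂ - C₃) / (c₂ ^ 2 - 1) := by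
    unfold gramCof triDisc; field_simp; ring
  rw [e12, e21, e23, e32, e31, e13] at key
  refine pos_of_mul_pos_right (a := triDisc c₁ c₂ c₃) ?_ hD.le
  rw [key]
  have : triDisc c₁ c₂ c₃ * (C₁ * c₃ - C₂) / (c₃ ^ 2 - 1) *
        (triDisc c₁ c₂ c₃ * (C₂ * c₁ - C₃) / (c₁ ^ 2 - 1)) *
        (triDisc c₁ c₂ c₃ * (C₃ * c₂ - C₁) / (c₂ ^ 2 - 1)) +
      triDisc c₁ c₂ c₃ * (C₂ * c₃ - C₁) / (c₃ ^ 2 - 1) *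
        (triDisc c₁ c₂ c₃ * (C₃ * c₁ - C₂) / (c₁ ^ 2 - 1)) *
        (triDisc c₁ c₂ c₃ * (C₁ * c₂ - C₃) / (c₂ ^ 2 - 1)) =
      triDisc c₁ c₂ c₃ ^ 3 / ((c₁ ^ 2 - 1) * (c₂ ^ 2 - 1) * (c₃ ^ 2 - 1)) *
      ((C₁ * c₃ - C₂) * (C₂ * c₁ - C₃) * (C₃ * c₂ - C₁)
      + (C₂ * c₃ - C₁) * (C₃ * c₁ - C₂) * (C₁ * c₂ - C₃)) := by
    field_simp
  rw [this]
  positivity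

/-- Positivity when the third cofactor sum is negative. -/
theorem triForm_cof_pos_of_neg {c₁ c₂ c₃ C₁ C₂ C₃ : ℝ} (h₁ : 1 < c₁) (h₂ : 1 < c₂) (h₃ : 1 < c₃)
    (hD : 0 < triDisc c₁ c₂ c₃)
    (hp : 0 < (C₁ * c₃ - C₂) * (C₂ * c₁ - C₃) * (C₃ * c₂ - C₁)
      + (C₂ * c₃ - C₁) * (C₃ * c₁ - C₂) * (C₁ * c₂ - C₃))
    (hk₁ : 0 < gramCof c₁ c₂ c₃ C₁ C₂ C₃) (hk₂ : 0 < gramCof c₂ c₃ c₁ C₂ C₃ C₁)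
    (hp12 : 0 < C₁ * c₃ - C₂) (hp21 : 0 < C₂ * c₃ - C₁)
    {x y z : ℝ} (hw : ¬ (x = 0 ∧ y = 0 ∧ z = 0)) :
    0 < triForm c₁ c₂ c₃ (gramCof c₁ c₂ c₃ C₁ C₂ C₃ / (c₁ ^ 2 - 1))
      (gramCof c₂ c₃ c₁ C₂ C₃ C₁ / (c₂ ^ 2 - 1)) (gramCof c₃ c₁ c₂ C₃ C₁ C₂ / (c₃ ^ 2 - 1))
      x y z := by
  have hs1 : 0 < c₁ ^ 2 - 1 := by nlinarith
  have hs2 : 0 < c₂ ^ 2 - 1 := by nlinarith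
  have hs3 : 0 < c₃ ^ 2 - 1 := by nlinarith
  refine triForm_pos_of_neg h₁ h₂ h₃ hD (div_pos hk₁ hs1) (div_pos hk₂ hs2)
    (triDet_pos_of_struct h₁ h₂ h₃ hD hp) ?_ ?_ hw
  · have : gramCof c₂ c₃ c₁ C₂ C₃ C₁ / (c₂ ^ 2 - 1) * (c₂ ^ 2 - 1)
      + gramCof c₃ c₁ c₂ C₃ C₁ C₂ / (c₃ ^ 2 - 1) * (c₂ * c₃ - c₁)
      = triDisc c₁ c₂ c₃ * (C₁ * c₃ - C₂) / (c₃ ^ 2 - 1) := by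
      unfold gramCof triDisc; field_simp; ring
    rw [this]; positivity
  · have : gramCof c₁ c₂ c₃ C₁ C₂ C₃ / (c₁ ^ 2 - 1) * (c₁ ^ 2 - 1)
      + gramCof c₃ c₁ c₂ C₃ C₁ C₂ / (c₃ ^ 2 - 1) * (c₁ * c₃ - c₂)
      = triDisc c₁ c₂ c₃ * (C₂ * c₃ - C₁) / (c₃ ^ 2 - 1) := by
      unfold gramCof triDisc; field_simp; ring
    rw [this]; positivity

theorem triForm_cof_pos_of_nonneg {c₁ c₂ c₃ m₁ m₂ m₃ : ℝ} (h₁ : 1 < c₁) (h₂ : 1 < c₂)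
    (h₃ : 1 < c₃) (hm₁ : 0 ≤ m₁) (hm₂ : 0 ≤ m₂) (hm₃ : 0 ≤ m₃)
    (hdet : 0 < triDet c₁ c₂ c₃ m₁ m₂ m₃) {x y z : ℝ}
    (hw : ¬ (x = 0 ∧ y = 0 ∧ z = 0)) : 0 < triForm c₁ c₂ c₃ m₁ m₂ m₃ x y z := by
  rcases hm₁.eq_or_lt with rfl | h1
  · rcases hm₂.eq_or_lt with rfl | h2
    · simp [triDet] at hdet
    rcases hm₃.eq_or_lt with rfl | h3
    · simp [triDet] at hdet
    rw [← triForm_rotate]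
    exact triForm_pos_of_nonneg h₂ h₃ h₁ h2 h3 le_rfl (fun h => hw ⟨h.2.2, h.1, h.2.1⟩)
  · rcases hm₂.eq_or_lt with rfl | h2
    · rcases hm₃.eq_or_lt with rfl | h3
      · simp [triDet] at hdet
      rw [← triForm_rotate, ← triForm_rotate]
      exact triForm_pos_of_nonneg h₃ h₁ h₂ h3 h1 le_rfl (fun h => hw ⟨h.2.1, h.2.2, h.1⟩)
    · exact triForm_pos_of_nonneg h₁ h₂ h₃ h1 h2 hm₃ hw

/-- The scaled cofactor sums. -/
theorem gramCof_scaled {e₂ e₃ a b g S₁ S₂ S₃ T₁ T₂ T₃ : ℝ} (hC₂ : (T₂ * S₂) ^ 2 = 1 + e₂ * S₂ ^ 2)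
    (hC₃ : (T₃ * S₃) ^ 2 = 1 + e₃ * S₃ ^ 2) :
    gramCof (T₂ * S₂ * (T₃ * S₃) + a * (S₂ * S₃)) (T₁ * S₁ * (T₃ * S₃) + b * (S₁ * S₃))
        (T₁ * S₁ * (T₂ * S₂) + g * (S₁ * S₂)) (T₁ * S₁) (T₂ * S₂) (T₃ * S₃) =
      S₁ * S₂ ^ 2 * S₃ ^ 2 * ((e₂ * e₃ - a ^ 2) * T₁ + (e₃ * g + a * b) * T₂
        + (e₂ * b + a * g) * T₃) := by
  rw [gramCof_eq hC₂ hC₃]; ring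

theorem eta_pos_of_cofactor_neg {e e' η u v w : ℝ} (he : e = 0 ∨ e = 1) (he' : e' = 0 ∨ e' = 1)
    (hη : 0 < e * e' + η) (hu : 0 ≤ u) (hv : 0 ≤ v) (hw : 0 < w)
    (hk : (e * e' - η ^ 2) * w + u + v < 0) : 0 < η := by
  by_contra hn
  have : e * e' - η ^ 2 < 0 := by
    by_contra h
    nlinarith [mul_nonneg (not_lt.1 h) hw.le]
  rcases he with rfl | rfl <;> rcases he' with rfl | rfl <;> nlinarith

set_option maxHeartbeats 800000 in
theorem triForm_struct_pos {e₁ e₂ e₃ a b g S₁ S₂ S₃ C₁ C₂ C₃ c₁ c₂ c₃ : ℝ} (he₁ : e₁ = 0 ∨ e₁ = 1)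
    (he₂ : e₂ = 0 ∨ e₂ = 1) (he₃ : e₃ = 0 ∨ e₃ = 1)
    (hS₁ : 0 < S₁) (hS₂ : 0 < S₂) (hS₃ : 0 < S₃)
    (hC₁p : 0 < C₁) (hC₂p : 0 < C₂) (hC₃p : 0 < C₃)
    (hC₁ : C₁ ^ 2 = 1 + e₁ * S₁ ^ 2) (hC₂ : C₂ ^ 2 = 1 + e₂ * S₂ ^ 2)
    (hC₃ : C₃ ^ 2 = 1 + e₃ * S₃ ^ 2)
    (ha : 0 < e₂ * e₃ + a) (hb : 0 < e₁ * e₃ + b) (hg : 0 < e₁ * e₂ + g)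
    (h₁ : 0 ≤ e₁ * a + b * g) (h₂ : 0 ≤ e₂ * b + a * g) (h₃ : 0 ≤ e₃ * g + a * b)
    (hc₁ : c₁ = C₂ * C₃ + a * (S₂ * S₃)) (hc₂ : c₂ = C₁ * C₃ + b * (S₁ * S₃))
    (hc₃ : c₃ = C₁ * C₂ + g * (S₁ * S₂)) (hD : 0 < triDisc c₁ c₂ c₃)
    {x y z : ℝ} (hw : ¬ (x = 0 ∧ y = 0 ∧ z = 0)) :
    0 < triForm c₁ c₂ c₃ (gramCof c₁ c₂ c₃ C₁ C₂ C₃ / (c₁ ^ 2 - 1))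
      (gramCof c₂ c₃ c₁ C₂ C₃ C₁ / (c₂ ^ 2 - 1)) (gramCof c₃ c₁ c₂ C₃ C₁ C₂ / (c₃ ^ 2 - 1))
      x y z := by
  have hc1 : 1 < c₁ := hc₁ ▸ one_lt_edge he₂ he₃ hS₂ hS₃ hC₂p hC₃p hC₂ hC₃ ha
  have hc2 : 1 < c₂ := hc₂ ▸ one_lt_edge he₁ he₃ hS₁ hS₃ hC₁p hC₃p hC₁ hC₃ hb
  have hc3 : 1 < c₃ := hc₃ ▸ one_lt_edge he₁ he₂ hS₁ hS₂ hC₁p hC₂p hC₁ hC₂ hg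
  have hs1 : 0 < c₁ ^ 2 - 1 := by nlinarith
  have hs2 : 0 < c₂ ^ 2 - 1 := by nlinarith
  have hs3 : 0 < c₃ ^ 2 - 1 := by nlinarith
  obtain ⟨T₁, rfl⟩ : ∃ T, C₁ = T * S₁ := ⟨C₁ / S₁, by field_simp⟩
  obtain ⟨T₂, rfl⟩ : ∃ T, C₂ = T * S₂ := ⟨C₂ / S₂, by field_simp⟩
  obtain ⟨T₃, rfl⟩ : ∃ T, C₃ = T * S₃ := ⟨C₃ / S₃, by field_simp⟩
  have hT₁ : 0 < T₁ := pos_of_mul_pos_left hC₁p hS₁.le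
  have hT₂ : 0 < T₂ := pos_of_mul_pos_left hC₂p hS₂.le
  have hT₃ : 0 < T₃ := pos_of_mul_pos_left hC₃p hS₃.le
  have k1 := gramCof_scaled (S₁ := S₁) (T₁ := T₁) (a := a) (b := b) (g := g) hC₂ hC₃
  have k2 := gramCof_scaled (S₁ := S₂) (T₁ := T₂) (a := b) (b := g) (g := a) hC₃ hC₁
  have k3 := gramCof_scaled (S₁ := S₃) (T₁ := T₃) (a := g) (b := a) (g := b) hC₁ hC₂
  rw [show T₃ * S₃ * (T₁ * S₁) + b * (S₃ * S₁) = c₂ by rw [hc₂]; ring,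
    show T₂ * S₂ * (T₁ * S₁) + g * (S₂ * S₁) = c₃ by rw [hc₃]; ring, ← hc₁] at k2
  rw [← hc₃, show T₃ * S₃ * (T₁ * S₁) + b * (S₃ * S₁) = c₂ by rw [hc₂]; ring,
    show T₃ * S₃ * (T₂ * S₂) + a * (S₃ * S₂) = c₁ by rw [hc₁]; ring] at k3
  rw [← hc₁, ← hc₂, ← hc₃] at k1
  have hDeq : triDisc c₁ c₂ c₃ = (S₁ * S₂ * S₃) ^ 2 *
    (T₁ * ((e₂ * e₃ - a ^ 2) * T₁ + (e₃ * g + a * b) * T₂ + (e₂ * b + a * g) * T₃)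
      + T₂ * ((e₁ * e₃ - b ^ 2) * T₂ + (e₃ * g + a * b) * T₁ + (e₁ * a + b * g) * T₃)
      + T₃ * ((e₁ * e₂ - g ^ 2) * T₃ + (e₂ * b + a * g) * T₁ + (e₁ * a + b * g) * T₂)
      + (-(e₁ * e₂ * e₃) + 2 * a * b * g + e₁ * a ^ 2 + e₂ * b ^ 2 + e₃ * g ^ 2)) := by
    have E1 : e₁ * S₁ ^ 2 = (T₁ * S₁) ^ 2 - 1 := by linarith
    have E2 : e₂ * S₂ ^ 2 = (T₂ * S₂) ^ 2 - 1 := by linarith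
    have E3 : e₃ * S₃ ^ 2 = (T₃ * S₃) ^ 2 - 1 := by linarith
    have : triDisc c₁ c₂ c₃ = T₁ * S₁ * gramCof c₁ c₂ c₃ (T₁ * S₁) (T₂ * S₂) (T₃ * S₃) +
      T₂ * S₂ * gramCof c₂ c₃ c₁ (T₂ * S₂) (T₃ * S₃) (T₁ * S₁) +
      T₃ * S₃ * gramCof c₃ c₁ c₂ (T₃ * S₃) (T₁ * S₁) (T₂ * S₂) +
      (-((e₁ * S₁ ^ 2) * (e₂ * S₂ ^ 2) * (e₃ * S₃ ^ 2)) + 2 * (a * b * g) * (S₁ * S₂ * S₃) ^ 2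
        + (e₁ * S₁ ^ 2) * (a * S₂ * S₃) ^ 2 + (e₂ * S₂ ^ 2) * (b * S₁ * S₃) ^ 2
        + (e₃ * S₃ ^ 2) * (g * S₁ * S₂) ^ 2) := by
      rw [E1, E2, E3, hc₁, hc₂, hc₃]; unfold triDisc gramCof; ring
    rw [this, k1, k2, k3]; ring
  have hDh : 0 < T₁ * ((e₂ * e₃ - a ^ 2) * T₁ + (e₃ * g + a * b) * T₂ + (e₂ * b + a * g) * T₃)
      + T₂ * ((e₁ * e₃ - b ^ 2) * T₂ + (e₃ * g + a * b) * T₁ + (e₁ * a + b * g) * T₃)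
      + T₃ * ((e₁ * e₂ - g ^ 2) * T₃ + (e₂ * b + a * g) * T₁ + (e₁ * a + b * g) * T₂)
      + (-(e₁ * e₂ * e₃) + 2 * a * b * g + e₁ * a ^ 2 + e₂ * b ^ 2 + e₃ * g ^ 2) :=
    pos_of_mul_pos_right (hDeq ▸ hD) (by positivity)
  have p12 : T₁ * S₁ * c₃ - T₂ * S₂ = S₁ ^ 2 * S₂ * (e₁ * T₂ + g * T₁) := by
    rw [hc₃]; linear_combination (T₂ * S₂) * hC₁
  have p21 : T₂ * S₂ * c₃ - T₁ * S₁ = S₂ ^ 2 * S₁ * (e₂ * T₁ + g * T₂) := by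
    rw [hc₃]; linear_combination (T₁ * S₁) * hC₂
  have p23 : T₂ * S₂ * c₁ - T₃ * S₃ = S₂ ^ 2 * S₃ * (e₂ * T₃ + a * T₂) := by
    rw [hc₁]; linear_combination (T₃ * S₃) * hC₂
  have p32 : T₃ * S₃ * c₁ - T₂ * S₂ = S₃ ^ 2 * S₂ * (e₃ * T₂ + a * T₃) := by
    rw [hc₁]; linear_combination (T₂ * S₂) * hC₃
  have p31 : T₃ * S₃ * c₂ - T₁ * S₁ = S₃ ^ 2 * S₁ * (e₃ * T₁ + b * T₃) := by
    rw [hc₂]; linear_combination (T₁ * S₁) * hC₃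
  have p13 : T₁ * S₁ * c₂ - T₃ * S₃ = S₁ ^ 2 * S₃ * (e₁ * T₃ + b * T₁) := by
    rw [hc₂]; linear_combination (T₃ * S₃) * hC₁
  have hp : 0 < (T₁ * S₁ * c₃ - T₂ * S₂) * (T₂ * S₂ * c₁ - T₃ * S₃) * (T₃ * S₃ * c₂ - T₁ * S₁)
      + (T₂ * S₂ * c₃ - T₁ * S₁) * (T₃ * S₃ * c₁ - T₂ * S₂) * (T₁ * S₁ * c₂ - T₃ * S₃) := by
    rw [p12, p21, p23, p32, p31, p13]
    have := mul_pos (show 0 < (S₁ * S₂ * S₃) ^ 3 by positivity)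
      (edge_product_pos he₁ he₂ he₃ hT₁ hT₂ hT₃ ha hb hg h₁ h₂ h₃)
    linarith only [this]
  have e1n : 0 ≤ e₁ := by rcases he₁ with h | h <;> simp [h]
  have e2n : 0 ≤ e₂ := by rcases he₂ with h | h <;> simp [h]
  have e3n : 0 ≤ e₃ := by rcases he₃ with h | h <;> simp [h]
  by_cases n3 : (e₁ * e₂ - g ^ 2) * T₃ + (e₂ * b + a * g) * T₁ + (e₁ * a + b * g) * T₂ < 0
  · have hg0 := eta_pos_of_cofactor_neg he₁ he₂ hg (mul_nonneg h₂ hT₁.le) (mul_nonneg h₁ hT₂.le) hT₃ n3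
    refine triForm_cof_pos_of_neg hc1 hc2 hc3 hD hp ?_ ?_ ?_ ?_ hw
    · rw [k1]
      exact mul_pos (by positivity) (cofactor_pos_of_neg he₁ he₂ he₃ hT₁ hT₂ hT₃ ha hg h₁ h₂ h₃ hDh n3)
    · rw [k2]
      have := cofactor_pos_of_neg (g := g) (a := b) (b := a) he₂ he₁ he₃ hT₂ hT₁ hT₃ hb
        (by linarith only [ha, hb, hg]) (by linarith only [h₁, h₂, h₃]) (by linarith only [h₁, h₂, h₃]) (by linarith only [h₁, h₂, h₃]) (by linarith only [hDh]) (by linarith only [n3])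
      exact mul_pos (by positivity) (by linarith only [this])
    · rw [p12]; positivity
    · rw [p21]; positivity
  by_cases n1 : (e₂ * e₃ - a ^ 2) * T₁ + (e₃ * g + a * b) * T₂ + (e₂ * b + a * g) * T₃ < 0
  · have ha0 := eta_pos_of_cofactor_neg he₂ he₃ ha (mul_nonneg h₃ hT₂.le) (mul_nonneg h₂ hT₃.le) hT₁ n1
    rw [← triForm_rotate]
    refine triForm_cof_pos_of_neg hc2 hc3 hc1 ?_ ?_ ?_ ?_ ?_ ?_ (fun h => hw ⟨h.2.2, h.1, h.2.1⟩)
    · convert hD using 1; unfold triDisc; ring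
    · linarith only [hp]
    · rw [k2]
      have := cofactor_pos_of_neg (e₁ := e₂) (e₂ := e₃) (e₃ := e₁) (g := a) (a := b) (b := g)
        he₂ he₃ he₁ hT₂ hT₃ hT₁ (by linarith only [ha, hb, hg])
        (by linarith only [ha, hb, hg]) (by linarith only [h₁, h₂, h₃]) (by linarith only [h₁, h₂, h₃]) (by linarith only [h₁, h₂, h₃]) (by linarith only [hDh]) (by linarith only [n1])
      exact mul_pos (by positivity) (by linarith only [this])
    · rw [k3]
      have := cofactor_pos_of_neg (e₁ := e₃) (e₂ := e₂) (e₃ := e₁) (g := a) (a := g) (b := b)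
        he₃ he₂ he₁ hT₃ hT₂ hT₁ (by linarith only [ha, hb, hg])
        (by linarith only [ha, hb, hg]) (by linarith only [h₁, h₂, h₃]) (by linarith only [h₁, h₂, h₃]) (by linarith only [h₁, h₂, h₃]) (by linarith only [hDh]) (by linarith only [n1])
      exact mul_pos (by positivity) (by linarith only [this])
    · rw [p23]; positivity
    · rw [p32]; positivity
  by_cases n2 : (e₃ * e₁ - b ^ 2) * T₂ + (e₁ * a + b * g) * T₃ + (e₃ * g + a * b) * T₁ < 0
  · have hb0 := eta_pos_of_cofactor_neg he₃ he₁ (by linarith only [hb]) (mul_nonneg h₁ hT₃.le) (mul_nonneg h₃ hT₁.le) hT₂ n2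
    rw [← triForm_rotate, ← triForm_rotate]
    refine triForm_cof_pos_of_neg hc3 hc1 hc2 ?_ ?_ ?_ ?_ ?_ ?_ (fun h => hw ⟨h.2.1, h.2.2, h.1⟩)
    · convert hD using 1; unfold triDisc; ring
    · linarith only [hp]
    · rw [k3]
      have := cofactor_pos_of_neg (e₁ := e₃) (e₂ := e₁) (e₃ := e₂) (g := b) (a := g) (b := a)
        he₃ he₁ he₂ hT₃ hT₁ hT₂ (by linarith only [ha, hb, hg])
        (by linarith only [ha, hb, hg]) (by linarith only [h₁, h₂, h₃]) (by linarith only [h₁, h₂, h₃]) (by linarith only [h₁, h₂, h₃]) (by linarith only [hDh]) (by linarith only [n2])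
      exact mul_pos (by positivity) (by linarith only [this])
    · rw [k1]
      have := cofactor_pos_of_neg (e₁ := e₁) (e₂ := e₃) (e₃ := e₂) (g := b) (a := a) (b := g)
        he₁ he₃ he₂ hT₁ hT₃ hT₂ (by linarith only [ha, hb, hg])
        (by linarith only [ha, hb, hg]) (by linarith only [h₁, h₂, h₃]) (by linarith only [h₁, h₂, h₃]) (by linarith only [h₁, h₂, h₃]) (by linarith only [hDh]) (by linarith only [n2])
      exact mul_pos (by positivity) (by linarith only [this])
    · rw [p31]; positivity
    · rw [p13]; positivity
  · refine triForm_cof_pos_of_nonneg hc1 hc2 hc3 ?_ ?_ ?_ (triDet_pos_of_struct hc1 hc2 hc3 hD hp) hw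
    · rw [k1]; exact div_nonneg (mul_nonneg (by positivity) (not_lt.1 n1)) hs1.le
    · rw [k2]; exact div_nonneg (mul_nonneg (by positivity) (by linarith only [not_lt.1 n2])) hs2.le
    · rw [k3]; exact div_nonneg (mul_nonneg (by positivity) (by linarith only [not_lt.1 n3])) hs3.le

/-! ### Vertex functions -/

/-- The function `exp f` in terms of the coordinate `u`. -/
noncomputable def vS (e u : ℝ) : ℝ := (1 + e) * exp u / (1 - e * exp u ^ 2)

/-- The function `sqrt (1 + ε exp (2 f))` in terms of the coordinate `u`. -/
noncomputable def vC (e u : ℝ) : ℝ := (1 + e * exp u ^ 2) / (1 - e * exp u ^ 2)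

theorem vden_pos {e u : ℝ} (he : e = 0 ∨ e = 1) (hu : e = 1 → u < 0) : 0 < 1 - e * exp u ^ 2 := by
  rcases he with rfl | rfl
  · norm_num
  · have h1 := Real.exp_lt_one_iff.2 (hu rfl)
    nlinarith [exp_pos u]

theorem vS_pos {e u : ℝ} (he : e = 0 ∨ e = 1) (hu : e = 1 → u < 0) : 0 < vS e u := by
  have := vden_pos he hu
  have e1n : 0 ≤ e := by rcases he with h | h <;> simp [h]
  unfold vS; positivity

theorem vC_pos {e u : ℝ} (he : e = 0 ∨ e = 1) (hu : e = 1 → u < 0) : 0 < vC e u := by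
  have := vden_pos he hu
  have e1n : 0 ≤ e := by rcases he with h | h <;> simp [h]
  unfold vC; positivity

theorem vC_sq {e u : ℝ} (he : e = 0 ∨ e = 1) (hu : e = 1 → u < 0) :
    vC e u ^ 2 = 1 + e * vS e u ^ 2 := by
  have := (vden_pos he hu).ne'
  unfold vC vS
  field_simp
  rcases he with rfl | rfl <;> ring

theorem hasDerivAt_vS {e u : ℝ} (he : e = 0 ∨ e = 1) (hu : e = 1 → u < 0) :
    HasDerivAt (vS e) (vS e u * vC e u) u := by
  have h0 := (vden_pos he hu).ne'
  have h := ((Real.hasDerivAt_exp u).const_mul (1 + e)).div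
    ((((Real.hasDerivAt_exp u).pow 2).const_mul e).const_sub 1) h0
  refine h.congr_deriv ?_
  simp only [vS, vC, Pi.pow_apply, Nat.cast_ofNat]
  field_simp
  rcases he with rfl | rfl <;> push_cast <;> ring

theorem hasDerivAt_vC {e u : ℝ} (he : e = 0 ∨ e = 1) (hu : e = 1 → u < 0) :
    HasDerivAt (vC e) (e * vS e u ^ 2) u := by
  have h0 := (vden_pos he hu).ne'
  have h := ((((Real.hasDerivAt_exp u).pow 2).const_mul e).const_add 1).div
    ((((Real.hasDerivAt_exp u).pow 2).const_mul e).const_sub 1) h0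
  refine h.congr_deriv ?_
  simp only [vS, Pi.pow_apply, Nat.cast_ofNat]
  field_simp
  rcases he with rfl | rfl <;> push_cast <;> ring

/-! ### Angles as functions of the hyperbolic cosines of the lengths -/

/-- The angle between sides with `cosh` equal to `a`, `b`, opposite to a side with `cosh` equal
to `c`. -/
noncomputable def angC (a b c : ℝ) : ℝ := arccos ((a * b - c) / (√(a ^ 2 - 1) * √(b ^ 2 - 1)))

theorem angC_comm (a b c : ℝ) : angC a b c = angC b a c := by
  unfold angC; rw [mul_comm a b, mul_comm (√(a ^ 2 - 1))]

theorem triDisc_eq_sq_sub {a b c : ℝ} (ha : 1 < a) (hb : 1 < b) :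
    triDisc a b c = (√(a ^ 2 - 1) * √(b ^ 2 - 1)) ^ 2 - (a * b - c) ^ 2 := by
  rw [mul_pow, sq_sqrt (by nlinarith), sq_sqrt (by nlinarith)]
  unfold triDisc; ring

theorem angC_eq_zero_or_pi {a b c : ℝ} (ha : 1 < a) (hb : 1 < b) (hD : triDisc a b c ≤ 0) :
    angC a b c = 0 ∨ angC a b c = π := by
  have hp : 0 < √(a ^ 2 - 1) * √(b ^ 2 - 1) :=
    mul_pos (sqrt_pos.2 (by nlinarith)) (sqrt_pos.2 (by nlinarith))
  rw [triDisc_eq_sq_sub ha hb] at hD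
  unfold angC
  have : √(a ^ 2 - 1) * √(b ^ 2 - 1) ≤ |a * b - c| := by
    rw [← abs_of_pos hp]; exact sq_le_sq.1 (by linarith)
  rcases le_abs.1 this with h | h
  · left
    exact arccos_eq_zero.2 ((one_le_div hp).2 h)
  · right
    exact arccos_eq_pi.2 (by rw [div_le_iff₀ hp]; linarith)

theorem hasDerivAt_angC {a b c : ℝ → ℝ} {a' b' c' s : ℝ} (ha : 1 < a s) (hb : 1 < b s)
    (hD : 0 < triDisc (a s) (b s) (c s)) (hda : HasDerivAt a a' s) (hdb : HasDerivAt b b' s)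
    (hdc : HasDerivAt c c' s) :
    HasDerivAt (fun t => angC (a t) (b t) (c t))
      (-(1 / √(triDisc (a s) (b s) (c s))) * (-c' + (a s * c s - b s) / (a s ^ 2 - 1) * a'
        + (b s * c s - a s) / (b s ^ 2 - 1) * b')) s := by
  have ha2 : 0 < a s ^ 2 - 1 := by nlinarith
  have hb2 : 0 < b s ^ 2 - 1 := by nlinarith
  have hsa := sqrt_pos.2 ha2
  have hsb := sqrt_pos.2 hb2
  have hp : 0 < √(a s ^ 2 - 1) * √(b s ^ 2 - 1) := mul_pos hsa hsb
  have hDe := triDisc_eq_sq_sub (c := c s) ha hb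
  set E := (a s * b s - c s) / (√(a s ^ 2 - 1) * √(b s ^ 2 - 1)) with hE
  have hE2 : E ^ 2 < 1 := by
    rw [hE, div_pow, div_lt_one (by positivity)]; linarith
  have hsq : √(1 - E ^ 2) = √(triDisc (a s) (b s) (c s)) / (√(a s ^ 2 - 1) * √(b s ^ 2 - 1)) := by
    rw [eq_div_iff hp.ne', ← sqrt_sq hp.le, ← sqrt_mul (by linarith), hDe]
    congr 1
    rw [hE]; field_simp
  have h1 := ((hda.mul hdb).sub hdc).div ((((hda.pow 2).sub_const 1).sqrt ha2.ne').mul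
    (((hdb.pow 2).sub_const 1).sqrt hb2.ne')) hp.ne'
  have h2 := (Real.hasDerivAt_arccos (x := E) (by nlinarith) (by nlinarith)).comp s h1
  refine h2.congr_deriv ?_
  rw [hsq]
  have q1 : √(a s ^ 2 - 1) ^ 2 = a s ^ 2 - 1 := sq_sqrt ha2.le
  have q2 : √(b s ^ 2 - 1) ^ 2 = b s ^ 2 - 1 := sq_sqrt hb2.le
  have hD' := (sqrt_pos.2 hD)
  simp only [Pi.mul_apply, Pi.sub_apply, Pi.pow_apply, Nat.cast_ofNat]
  rw [← q1, ← q2]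
  simp only [sqrt_sq hsa.le, sqrt_sq hsb.le]
  generalize √(triDisc (a s) (b s) (c s)) = d at *
  generalize √(a s ^ 2 - 1) = p at *
  generalize √(b s ^ 2 - 1) = q at *
  have e1 : b s - (a s * b s - c s) * a s / p ^ 2 = (a s * c s - b s) / p ^ 2 := by
    field_simp; linear_combination b s * q1
  have e2 : a s - (a s * b s - c s) * b s / q ^ 2 = (b s * c s - a s) / q ^ 2 := by
    field_simp; linear_combination a s * q2
  rw [← e1, ← e2]
  field_simp
  ring

theorem angle_sum_identity (c₁ c₂ c₃ C₁ C₂ C₃ x y z : ℝ) (h₁ : 1 < c₁) (h₂ : 1 < c₂) (h₃ : 1 < c₃) :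
    x * (-(y * (C₂ * c₁ - C₃) + z * (C₃ * c₁ - C₂))
        + (c₂ * c₁ - c₃) / (c₂ ^ 2 - 1) * (x * (C₁ * c₂ - C₃) + z * (C₃ * c₂ - C₁))
        + (c₃ * c₁ - c₂) / (c₃ ^ 2 - 1) * (x * (C₁ * c₃ - C₂) + y * (C₂ * c₃ - C₁)))
      + y * (-(x * (C₁ * c₂ - C₃) + z * (C₃ * c₂ - C₁))
        + (c₃ * c₂ - c₁) / (c₃ ^ 2 - 1) * (x * (C₁ * c₃ - C₂) + y * (C₂ * c₃ - C₁))
        + (c₁ * c₂ - c₃) / (c₁ ^ 2 - 1) * (y * (C₂ * c₁ - C₃) + z * (C₃ * c₁ - C₂)))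
      + z * (-(x * (C₁ * c₃ - C₂) + y * (C₂ * c₃ - C₁))
        + (c₁ * c₃ - c₂) / (c₁ ^ 2 - 1) * (y * (C₂ * c₁ - C₃) + z * (C₃ * c₁ - C₂))
        + (c₂ * c₃ - c₁) / (c₂ ^ 2 - 1) * (x * (C₁ * c₂ - C₃) + z * (C₃ * c₂ - C₁)))
    = triForm c₁ c₂ c₃ (gramCof c₁ c₂ c₃ C₁ C₂ C₃ / (c₁ ^ 2 - 1))
      (gramCof c₂ c₃ c₁ C₂ C₃ C₁ / (c₂ ^ 2 - 1)) (gramCof c₃ c₁ c₂ C₃ C₁ C₂ / (c₃ ^ 2 - 1))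
      x y z := by
  have hs1 : c₁ ^ 2 - 1 ≠ 0 := by nlinarith
  have hs2 : c₂ ^ 2 - 1 ≠ 0 := by nlinarith
  have hs3 : c₃ ^ 2 - 1 ≠ 0 := by nlinarith
  unfold triForm gramCof
  field_simp
  ring

/-! ### Angles along rays -/

/-- A continuous function which, at each point, has either negative derivative or a value in a
fixed finite set does not increase. -/
theorem le_of_finite_or_deriv_neg {h : ℝ → ℝ} {a b : ℝ} (hab : a ≤ b)
    (hc : ContinuousOn h (Set.Icc a b)) {V : Set ℝ} (hV : V.Finite)
    (hd : ∀ s ∈ Set.Icc a b, h s ∈ V ∨ ∃ d < 0, HasDerivAt h d s) : h b ≤ h a := by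
  by_contra hlt
  push Not at hlt
  obtain ⟨y, hy, hyV⟩ := (Set.Ioo_infinite hlt).exists_notMem_finite hV
  have hK : IsCompact (Set.Icc a b ∩ h ⁻¹' Set.Iic y) :=
    isCompact_Icc.of_isClosed_subset (hc.preimage_isClosed_of_isClosed isClosed_Icc isClosed_Iic)
      Set.inter_subset_left
  obtain ⟨s, ⟨hs, hsy⟩, hmax⟩ := hK.exists_isGreatest ⟨a, ⟨le_rfl, hab⟩, hy.1.le⟩
  simp only [Set.mem_preimage, Set.mem_Iic] at hsy
  obtain ⟨r, hr, hry⟩ := intermediate_value_Icc hs.2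
    (hc.mono (Set.Icc_subset_Icc_left hs.1)) ⟨hsy, hy.2.le⟩
  have hrs : r = s := le_antisymm (hmax ⟨⟨hs.1.trans hr.1, hr.2⟩, hry.le⟩) hr.1
  subst hrs
  have hrb : r < b := lt_of_le_of_ne hs.2 (fun h0 => by rw [h0] at hry; linarith [hy.2])
  rcases hd r hs with h0 | ⟨d, hd0, hder⟩
  · exact hyV (hry ▸ h0)
  · have h1 := (hasDerivAt_iff_tendsto_slope.1 hder).mono_left
      (nhdsWithin_mono r (fun t (ht : t ∈ Set.Ioi r) => (ne_of_gt ht)))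
    have h2 := h1.eventually (gt_mem_nhds hd0)
    have h3 : ∀ᶠ t in nhdsWithin r (Set.Ioi r), t ∈ Set.Ioc r b := Ioc_mem_nhdsGT hrb
    obtain ⟨t, ht1, ht2⟩ := (h2.and h3).exists
    rw [slope_def_field, div_neg_iff] at ht1
    have : h t ≤ y := by
      rcases ht1 with h4 | h4
      · linarith [ht2.1]
      · linarith
    exact absurd (hmax ⟨⟨hs.1.trans ht2.1.le, ht2.2⟩, this⟩) (not_le.2 ht2.1)

namespace TriSurface

variable {N : ℕ} {S : TriSurface N}

/-- The open convex domain of the coordinates `u`. -/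
def Dom (W : Weights S) : Set (Fin N → ℝ) := {u | ∀ i, W.eps i = 1 → u i < 0}

/-- `cosh` of the edge length as a function of `u`. -/
noncomputable def edgeCosh (W : Weights S) (u : Fin N → ℝ) (i j : Fin N) : ℝ :=
  vC (W.eps i) (u i) * vC (W.eps j) (u j) + W.eta i j * (vS (W.eps i) (u i) * vS (W.eps j) (u j))

/-- The extended angle as a function of `u`. -/
noncomputable def angU (W : Weights S) (u : Fin N → ℝ) (i j k : Fin N) : ℝ :=
  angC (edgeCosh W u i j) (edgeCosh W u i k) (edgeCosh W u j k)

variable {W : Weights S} {u v : Fin N → ℝ} {i j k : Fin N}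

theorem edgeCosh_comm (W : Weights S) (u : Fin N → ℝ) (i j : Fin N) :
    edgeCosh W u i j = edgeCosh W u j i := by
  unfold edgeCosh; rw [W.eta_symm i j]; ring

theorem angU_comm (W : Weights S) (u : Fin N → ℝ) (i j k : Fin N) :
    angU W u i j k = angU W u i k j := by
  unfold angU; rw [angC_comm, edgeCosh_comm W u j k]

theorem convex_Dom (W : Weights S) : Convex ℝ (Dom W) := by
  intro u hu v hv a b ha hb hab i hi
  have h1 := hu i hi
  have h2 := hv i hi
  simp only [Pi.add_apply, Pi.smul_apply, smul_eq_mul]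
  rcases ha.eq_or_lt with rfl | ha
  · have : b = 1 := by linarith
    subst this; linarith
  · nlinarith

/-- Three distinct vertices spanning a face. -/
structure IsFace (S : TriSurface N) (i j k : Fin N) : Prop where
  mem : ({i, j, k} : Finset (Fin N)) ∈ S.F
  ij : i ≠ j
  ik : i ≠ k
  jk : j ≠ k

theorem IsFace.rotate (h : IsFace S i j k) : IsFace S j k i where
  mem := by
    have : ({j, k, i} : Finset (Fin N)) = {i, j, k} := by ext; simp; tauto
    rw [this]; exact h.mem
  ij := h.jk
  ik := h.ij.symm
  jk := h.ik.symm

theorem IsFace.swap (h : IsFace S i j k) : IsFace S i k j where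
  mem := by
    have : ({i, k, j} : Finset (Fin N)) = {i, j, k} := by ext; simp; tauto
    rw [this]; exact h.mem
  ij := h.ik
  ik := h.ij
  jk := h.jk.symm

theorem IsFace.edge (h : IsFace S i j k) : 0 < W.eps i * W.eps j + W.eta i j := by
  refine W.structCond1 i j ?_
  unfold edges
  rw [Finset.mem_biUnion]
  refine ⟨_, h.mem, ?_⟩
  rw [Finset.mem_powersetCard]
  refine ⟨fun x hx => ?_, Finset.card_pair h.ij⟩
  simp only [Finset.mem_insert, Finset.mem_singleton] at hx ⊢
  tauto

theorem IsFace.one_lt (h : IsFace S i j k) (hu : u ∈ Dom W) : 1 < edgeCosh W u i j :=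
  one_lt_edge (W.eps01 i) (W.eps01 j) (vS_pos (W.eps01 i) (hu i)) (vS_pos (W.eps01 j) (hu j))
    (vC_pos (W.eps01 i) (hu i)) (vC_pos (W.eps01 j) (hu j)) (vC_sq (W.eps01 i) (hu i))
    (vC_sq (W.eps01 j) (hu j)) h.edge

theorem hasDerivAt_edgeCosh_line {w : Fin N → ℝ} {s : ℝ} (hs : u + s • w ∈ Dom W) :
    HasDerivAt (fun t : ℝ => edgeCosh W (u + t • w) i j)
      (w i * (vC (W.eps i) ((u + s • w) i) * edgeCosh W (u + s • w) i j - vC (W.eps j) ((u + s • w) j))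
        + w j * (vC (W.eps j) ((u + s • w) j) * edgeCosh W (u + s • w) i j
          - vC (W.eps i) ((u + s • w) i))) s := by
  have hl : ∀ i, HasDerivAt (fun t : ℝ => (u + t • w) i) (w i) s := by
    intro i
    simpa using ((hasDerivAt_id s).mul_const (w i)).const_add (u i)
  have hS : ∀ i, HasDerivAt (fun t : ℝ => vS (W.eps i) ((u + t • w) i))
      (vS (W.eps i) ((u + s • w) i) * vC (W.eps i) ((u + s • w) i) * w i) s := fun i =>
    HasDerivAt.comp (h₂ := vS (W.eps i)) (h := fun t : ℝ => (u + t • w) i) s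
      (hasDerivAt_vS (W.eps01 i) (hs i)) (hl i)
  have hC : ∀ i, HasDerivAt (fun t : ℝ => vC (W.eps i) ((u + t • w) i))
      (W.eps i * vS (W.eps i) ((u + s • w) i) ^ 2 * w i) s := fun i =>
    HasDerivAt.comp (h₂ := vC (W.eps i)) (h := fun t : ℝ => (u + t • w) i) s
      (hasDerivAt_vC (W.eps01 i) (hs i)) (hl i)
  have h := ((hC i).mul (hC j)).add (((hS i).mul (hS j)).const_mul (W.eta i j))
  refine h.congr_deriv ?_
  have e1 := vC_sq (W.eps01 i) (hs i)
  have e2 := vC_sq (W.eps01 j) (hs j)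
  simp only [edgeCosh]
  linear_combination (-(w i * vC (W.eps j) ((u + s • w) j))) * e1
    - (w j * vC (W.eps i) ((u + s • w) i)) * e2

theorem IsFace.hasDerivAt_line (h : IsFace S i j k) {w : Fin N → ℝ} {s : ℝ}
    (hs : u + s • w ∈ Dom W)
    (hD : 0 < triDisc (edgeCosh W (u + s • w) j k) (edgeCosh W (u + s • w) i k)
      (edgeCosh W (u + s • w) i j)) :
    ∃ d, HasDerivAt (fun t : ℝ => w i * angU W (u + t • w) i j k + w j * angU W (u + t • w) j i k
      + w k * angU W (u + t • w) k i j) d s ∧ (¬ (w i = 0 ∧ w j = 0 ∧ w k = 0) → d < 0) := by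
  have c1 : 1 < edgeCosh W (u + s • w) j k := h.rotate.one_lt hs
  have c2 : 1 < edgeCosh W (u + s • w) i k := h.swap.one_lt hs
  have c3 : 1 < edgeCosh W (u + s • w) i j := h.one_lt hs
  have d1 := hasDerivAt_edgeCosh_line (i := j) (j := k) hs
  have d2 := hasDerivAt_edgeCosh_line (i := i) (j := k) hs
  have d3 := hasDerivAt_edgeCosh_line (i := i) (j := j) hs
  have hD1 : triDisc (edgeCosh W (u + s • w) i k) (edgeCosh W (u + s • w) i j)
      (edgeCosh W (u + s • w) j k) = triDisc (edgeCosh W (u + s • w) j k) (edgeCosh W (u + s • w) i k)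
      (edgeCosh W (u + s • w) i j) := by unfold triDisc; ring
  have hD2 : triDisc (edgeCosh W (u + s • w) i j) (edgeCosh W (u + s • w) j k)
      (edgeCosh W (u + s • w) i k) = triDisc (edgeCosh W (u + s • w) j k) (edgeCosh W (u + s • w) i k)
      (edgeCosh W (u + s • w) i j) := by unfold triDisc; ring
  have a1 := hasDerivAt_angC (a := fun t => edgeCosh W (u + t • w) i k)
    (b := fun t => edgeCosh W (u + t • w) i j) (c := fun t => edgeCosh W (u + t • w) j k)
    c2 c3 (hD1 ▸ hD) d2 d3 d1
  have a2 := hasDerivAt_angC (a := fun t => edgeCosh W (u + t • w) i j)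
    (b := fun t => edgeCosh W (u + t • w) j k) (c := fun t => edgeCosh W (u + t • w) i k)
    c3 c1 (hD2 ▸ hD) d3 d1 d2
  have a3 := hasDerivAt_angC (a := fun t => edgeCosh W (u + t • w) j k)
    (b := fun t => edgeCosh W (u + t • w) i k) (c := fun t => edgeCosh W (u + t • w) i j)
    c1 c2 hD d1 d2 d3
  have hsum := ((a1.const_mul (w i)).add (a2.const_mul (w j))).add (a3.const_mul (w k))
  refine ⟨_, hsum.congr_of_eventuallyEq (Filter.Eventually.of_forall fun t => ?_), fun hw => ?_⟩
  · simp only [Pi.add_apply]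
    unfold angU
    rw [angC_comm (edgeCosh W (u + t • w) i j) (edgeCosh W (u + t • w) i k),
      edgeCosh_comm W _ j i, edgeCosh_comm W _ k i, edgeCosh_comm W _ k j,
      angC_comm (edgeCosh W (u + t • w) i k) (edgeCosh W (u + t • w) j k)]
  · have hpos := triForm_struct_pos (a := W.eta j k) (b := W.eta i k) (g := W.eta i j)
      (W.eps01 i) (W.eps01 j) (W.eps01 k) (vS_pos (W.eps01 i) (hs i))
      (vS_pos (W.eps01 j) (hs j)) (vS_pos (W.eps01 k) (hs k)) (vC_pos (W.eps01 i) (hs i))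
      (vC_pos (W.eps01 j) (hs j)) (vC_pos (W.eps01 k) (hs k)) (vC_sq (W.eps01 i) (hs i))
      (vC_sq (W.eps01 j) (hs j)) (vC_sq (W.eps01 k) (hs k)) h.rotate.edge h.swap.edge h.edge
      (by have := W.structCond2 i j k h.mem h.ij h.ik h.jk; linarith)
      (by have := W.structCond2 j k i h.rotate.mem h.jk h.ij.symm h.ik.symm
          rw [W.eta_symm k i, W.eta_symm j i] at this; linarith)
      (by have := W.structCond2 k i j h.rotate.rotate.mem h.ik.symm h.jk.symm h.ij
          rw [W.eta_symm k i, W.eta_symm k j] at this; linarith)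
      (c₁ := edgeCosh W (u + s • w) j k) (c₂ := edgeCosh W (u + s • w) i k)
      (c₃ := edgeCosh W (u + s • w) i j) rfl rfl rfl hD hw
    rw [← angle_sum_identity _ _ _ _ _ _ _ _ _ c1 c2 c3] at hpos
    rw [hD1, hD2]
    have hq : 0 < 1 / √(triDisc (edgeCosh W (u + s • w) j k) (edgeCosh W (u + s • w) i k)
      (edgeCosh W (u + s • w) i j)) := by have := sqrt_pos.2 hD; positivity
    have := mul_pos hq hpos
    linarith only [this]

end TriSurface

/-- Strict monotonicity at a point together with monotonicity along rays gives coercivity. -/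
theorem exists_coercive_of_ray_monotone {N : ℕ} {G : (Fin N → ℝ) → Fin N → ℝ}
    {D : Set (Fin N → ℝ)} (hconv : Convex ℝ D) {p : Fin N → ℝ} (hp : p ∈ D)
    (hmono : ∀ u ∈ D, ∀ v ∈ D, 0 ≤ ∑ i, (G v i - G u i) * (v i - u i))
    {L : (Fin N → ℝ) →L[ℝ] (Fin N → ℝ)} (hL : HasFDerivAt G L p)
    (hpos : ∀ w : Fin N → ℝ, w ≠ 0 → 0 < ∑ i, L w i * w i) :
    ∃ c > 0, ∀ u ∈ D, c * min (‖u - p‖ ^ 2) ‖u - p‖ ≤ ∑ i, (G u i - G p i) * (u i - p i) := by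
  have hQc : Continuous fun w : Fin N → ℝ => ∑ i, L w i * w i := by fun_prop
  obtain ⟨l, hl0, hl⟩ : ∃ l > 0, ∀ w : Fin N → ℝ, l * ‖w‖ ^ 2 ≤ ∑ i, L w i * w i := by
    have hk : ∃ l > 0, ∀ w ∈ Metric.sphere (0 : Fin N → ℝ) 1, l ≤ ∑ i, L w i * w i := by
      rcases (Metric.sphere (0 : Fin N → ℝ) 1).eq_empty_or_nonempty with he | hne
      · exact ⟨1, one_pos, by simp [he]⟩
      · obtain ⟨w0, hw0, hmin⟩ := (isCompact_sphere (0 : Fin N → ℝ) 1).exists_isMinOn hne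
          hQc.continuousOn
        refine ⟨_, hpos w0 ?_, fun w hw => hmin hw⟩
        rintro rfl
        simp at hw0
    obtain ⟨l, hl0, hl⟩ := hk
    refine ⟨l, hl0, fun w => ?_⟩
    by_cases hw : w = 0
    · simp [hw]
    · have hn : 0 < ‖w‖ := norm_pos_iff.2 hw
      have := hl (‖w‖⁻¹ • w) (by simp [norm_smul, hn.ne'])
      simp only [map_smul, Pi.smul_apply, smul_eq_mul] at this
      have e : ∑ i, ‖w‖⁻¹ * L w i * (‖w‖⁻¹ * w i) = (∑ i, L w i * w i) / ‖w‖ ^ 2 := by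
        rw [Finset.sum_div]
        refine Finset.sum_congr rfl fun i _ => ?_
        field_simp
      rw [e, le_div_iff₀ (by positivity)] at this
      exact this
  have hsum : ∀ a w : Fin N → ℝ, |∑ i, a i * w i| ≤ N * (‖a‖ * ‖w‖) := by
    intro a w
    refine (Finset.abs_sum_le_sum_abs _ _).trans ?_
    refine (Finset.sum_le_card_nsmul _ _ (‖a‖ * ‖w‖) fun i _ => ?_).trans (by simp)
    rw [abs_mul]
    exact mul_le_mul (norm_le_pi_norm a i) (norm_le_pi_norm w i) (abs_nonneg _) (norm_nonneg _)
  have ho := hL.isLittleO.def (c := l / (2 * (N + 1))) (by positivity)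
  obtain ⟨δ, hδ, hball⟩ := Metric.eventually_nhds_iff.1 ho
  have hnear : ∀ u, ‖u - p‖ < δ → l / 2 * ‖u - p‖ ^ 2 ≤ ∑ i, (G u i - G p i) * (u i - p i) := by
    intro u hu
    have h1 := hball (y := u) (by rwa [dist_eq_norm])
    have h2 := hsum (G u - G p - L (u - p)) (u - p)
    have h3 := hl (u - p)
    have e : ∑ i, (G u - G p - L (u - p)) i * (u - p) i
        = ∑ i, (G u i - G p i) * (u i - p i) - ∑ i, L (u - p) i * (u - p) i := by
      rw [← Finset.sum_sub_distrib]
      refine Finset.sum_congr rfl fun i _ => ?_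
      simp only [Pi.sub_apply]; ring
    rw [e] at h2
    have h4 := mul_le_mul_of_nonneg_right h1 (norm_nonneg (u - p))
    have h5 : (N : ℝ) * (l / (2 * (N + 1)) * ‖u - p‖ * ‖u - p‖) ≤ l / 2 * ‖u - p‖ ^ 2 := by
      have : (N : ℝ) * (l / (2 * (N + 1))) ≤ l / 2 := by
        rw [mul_div_assoc', div_le_div_iff₀ (by positivity) (by positivity)]
        nlinarith
      nlinarith [mul_le_mul_of_nonneg_right this (sq_nonneg ‖u - p‖)]
    have h6 := mul_le_mul_of_nonneg_left h4 (Nat.cast_nonneg (α := ℝ) N)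
    have h7 := (abs_le.1 h2).1
    linarith
  refine ⟨min (l / 2) (l * δ / 4), by positivity, fun u hu => ?_⟩
  rcases lt_or_ge ‖u - p‖ δ with h | h
  · refine le_trans ?_ (hnear u h)
    exact mul_le_mul (min_le_left _ _) (min_le_left _ _) (by positivity) (by positivity)
  · have hn : 0 < ‖u - p‖ := hδ.trans_le h
    set r := δ / (2 * ‖u - p‖) with hr
    have hr0 : 0 < r := by positivity
    have hr1 : r < 1 := by rw [hr, div_lt_one (by positivity)]; linarith
    set v := p + r • (u - p) with hv
    have hvD : v ∈ D := hconv.add_smul_sub_mem hp hu ⟨hr0.le, hr1.le⟩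
    have hvn : ‖v - p‖ = δ / 2 := by
      rw [hv, add_sub_cancel_left, norm_smul, Real.norm_of_nonneg hr0.le, hr]; field_simp
    have h1 := hnear v (by rw [hvn]; linarith)
    rw [hvn] at h1
    have h2 := hmono v hvD u hu
    have e1 : ∑ i, (G v i - G p i) * (v i - p i) = r * ∑ i, (G v i - G p i) * (u i - p i) := by
      rw [Finset.mul_sum]
      refine Finset.sum_congr rfl fun i _ => ?_
      simp only [hv, Pi.add_apply, Pi.smul_apply, Pi.sub_apply, smul_eq_mul]; ring
    have e2 : ∑ i, (G u i - G v i) * (u i - v i)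
        = (1 - r) * (∑ i, (G u i - G p i) * (u i - p i) - ∑ i, (G v i - G p i) * (u i - p i)) := by
      rw [← Finset.sum_sub_distrib, Finset.mul_sum]
      refine Finset.sum_congr rfl fun i _ => ?_
      simp only [hv, Pi.add_apply, Pi.smul_apply, Pi.sub_apply, smul_eq_mul]; ring
    rw [e2] at h2
    have h3 := nonneg_of_mul_nonneg_right h2 (by linarith)
    rw [e1] at h1
    have h4 : l * δ / 4 * ‖u - p‖ ≤ ∑ i, (G v i - G p i) * (u i - p i) := by
      have : l * δ / 4 * ‖u - p‖ * r = l / 2 * (δ / 2) ^ 2 := by rw [hr]; field_simp; ring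
      exact le_of_mul_le_mul_left (by linarith) hr0
    refine le_trans ?_ (h4.trans (by linarith))
    exact mul_le_mul (min_le_right _ _) (min_le_right _ _) (by positivity) (by positivity)

namespace TriSurface

variable {N : ℕ} {S : TriSurface N} {W : Weights S} {u v : Fin N → ℝ} {i j k : Fin N}

theorem continuousAt_angC {E : Type*} [TopologicalSpace E] {a b c : E → ℝ} {x : E}
    (ha : 1 < a x) (hb : 1 < b x) (hac : ContinuousAt a x) (hbc : ContinuousAt b x)
    (hcc : ContinuousAt c x) : ContinuousAt (fun y => angC (a y) (b y) (c y)) x := by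
  have hp : √(a x ^ 2 - 1) * √(b x ^ 2 - 1) ≠ 0 :=
    (mul_pos (sqrt_pos.2 (by nlinarith)) (sqrt_pos.2 (by nlinarith))).ne'
  refine continuous_arccos.continuousAt.comp (ContinuousAt.div ?_ ?_ hp)
  · exact (hac.mul hbc).sub hcc
  · exact (continuous_sqrt.continuousAt.comp ((hac.pow 2).sub continuousAt_const)).mul
      (continuous_sqrt.continuousAt.comp ((hbc.pow 2).sub continuousAt_const))

theorem differentiableAt_angC {E : Type*} [NormedAddCommGroup E] [NormedSpace ℝ E] {a b c : E → ℝ}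
    {x : E} (ha : 1 < a x) (hb : 1 < b x) (hD : 0 < triDisc (a x) (b x) (c x))
    (had : DifferentiableAt ℝ a x) (hbd : DifferentiableAt ℝ b x) (hcd : DifferentiableAt ℝ c x) :
    DifferentiableAt ℝ (fun y => angC (a y) (b y) (c y)) x := by
  have ha2 : a x ^ 2 - 1 ≠ 0 := by nlinarith
  have hb2 : b x ^ 2 - 1 ≠ 0 := by nlinarith
  have hp : 0 < √(a x ^ 2 - 1) * √(b x ^ 2 - 1) :=
    mul_pos (sqrt_pos.2 (by nlinarith)) (sqrt_pos.2 (by nlinarith))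
  rw [triDisc_eq_sq_sub ha hb] at hD
  have hE2 : ((a x * b x - c x) / (√(a x ^ 2 - 1) * √(b x ^ 2 - 1))) ^ 2 < 1 := by
    rw [div_pow, div_lt_one (by positivity)]; linarith
  have hda : DifferentiableAt ℝ (fun y => √(a y ^ 2 - 1)) x := ((had.pow 2).sub_const 1).sqrt ha2
  have hdb : DifferentiableAt ℝ (fun y => √(b y ^ 2 - 1)) x := ((hbd.pow 2).sub_const 1).sqrt hb2
  have hnum : DifferentiableAt ℝ (fun y => a y * b y - c y) x := (had.mul hbd).sub hcd
  have hden : DifferentiableAt ℝ (fun y => √(a y ^ 2 - 1) * √(b y ^ 2 - 1)) x := hda.mul hdb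
  have hf : DifferentiableAt ℝ
      (fun y => (a y * b y - c y) / (√(a y ^ 2 - 1) * √(b y ^ 2 - 1))) x :=
    hnum.fun_mul (hden.fun_inv hp.ne')
  refine DifferentiableAt.comp (g := arccos) x (Real.differentiableAt_arccos.2 ⟨?_, ?_⟩) hf
  · intro h; rw [h] at hE2; norm_num at hE2
  · intro h; rw [h] at hE2; norm_num at hE2

theorem differentiableAt_edgeCosh (hu : u ∈ Dom W) :
    DifferentiableAt ℝ (fun y => edgeCosh W y i j) u := by
  have hS : ∀ i, DifferentiableAt ℝ (fun y : Fin N → ℝ => vS (W.eps i) (y i)) u := fun i =>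
    DifferentiableAt.comp (g := vS (W.eps i)) u
      (hasDerivAt_vS (W.eps01 i) (hu i)).differentiableAt (differentiableAt_apply i u)
  have hC : ∀ i, DifferentiableAt ℝ (fun y : Fin N → ℝ => vC (W.eps i) (y i)) u := fun i =>
    DifferentiableAt.comp (g := vC (W.eps i)) u
      (hasDerivAt_vC (W.eps01 i) (hu i)).differentiableAt (differentiableAt_apply i u)
  exact ((hC i).mul (hC j)).add (((hS i).mul (hS j)).const_mul _)

theorem IsFace.continuousAt_angU (h : IsFace S i j k) (hu : u ∈ Dom W) :
    ContinuousAt (fun y => angU W y i j k) u :=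
  continuousAt_angC (h.one_lt hu) (h.swap.one_lt hu) (differentiableAt_edgeCosh hu).continuousAt
    (differentiableAt_edgeCosh hu).continuousAt (differentiableAt_edgeCosh hu).continuousAt

/-- The discriminant of a face. -/
noncomputable def faceDisc (W : Weights S) (u : Fin N → ℝ) (i j k : Fin N) : ℝ :=
  triDisc (edgeCosh W u j k) (edgeCosh W u i k) (edgeCosh W u i j)

theorem faceDisc_rotate (W : Weights S) (u : Fin N → ℝ) (i j k : Fin N) :
    faceDisc W u j k i = faceDisc W u i j k := by
  unfold faceDisc
  rw [edgeCosh_comm W u k i, edgeCosh_comm W u j i]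
  unfold triDisc; ring

theorem IsFace.differentiableAt_angU (h : IsFace S i j k) (hu : u ∈ Dom W)
    (hD : 0 < faceDisc W u i j k) : DifferentiableAt ℝ (fun y => angU W y i j k) u := by
  refine differentiableAt_angC (h.one_lt hu) (h.swap.one_lt hu) ?_ (differentiableAt_edgeCosh hu)
    (differentiableAt_edgeCosh hu) (differentiableAt_edgeCosh hu)
  convert hD using 1
  unfold faceDisc triDisc; ring

theorem IsFace.angU_eq_zero_or_pi (h : IsFace S i j k) (hu : u ∈ Dom W)
    (hD : faceDisc W u i j k ≤ 0) : angU W u i j k = 0 ∨ angU W u i j k = π := by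
  refine angC_eq_zero_or_pi (h.one_lt hu) (h.swap.one_lt hu) ?_
  convert hD using 1
  unfold faceDisc triDisc; ring

/-- Monotonicity along rays for one face. -/
theorem IsFace.ray_le (h : IsFace S i j k) (hu : u ∈ Dom W) (hv : v ∈ Dom W) :
    (v i - u i) * angU W v i j k + (v j - u j) * angU W v j k i + (v k - u k) * angU W v k i j ≤
    (v i - u i) * angU W u i j k + (v j - u j) * angU W u j k i + (v k - u k) * angU W u k i j := by
  set w := v - u with hw
  have hline : ∀ s ∈ Set.Icc (0 : ℝ) 1, u + s • w ∈ Dom W := fun s hs =>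
    (convex_Dom W).add_smul_sub_mem hu hv hs
  by_cases hw0 : w i = 0 ∧ w j = 0 ∧ w k = 0
  · have e1 : v i - u i = 0 := hw0.1
    have e2 : v j - u j = 0 := hw0.2.1
    have e3 : v k - u k = 0 := hw0.2.2
    simp [e1, e2, e3]
  have hcont : ContinuousOn (fun s : ℝ => w i * angU W (u + s • w) i j k
      + w j * angU W (u + s • w) j i k + w k * angU W (u + s • w) k i j) (Set.Icc 0 1) := by
    have hl : Continuous fun s : ℝ => u + s • w := by fun_prop
    intro s hs
    have key : ∀ {i j k}, IsFace S i j k → ContinuousAt (fun s : ℝ => angU W (u + s • w) i j k) s :=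
      fun {i j k} hf => ContinuousAt.comp (g := fun y => angU W y i j k)
        (hf.continuousAt_angU (hline s hs)) hl.continuousAt
    exact (((key h).const_mul _).add ((key h.rotate.swap).const_mul _)).add
      ((key h.rotate.rotate).const_mul _) |>.continuousWithinAt
  have hmain := le_of_finite_or_deriv_neg zero_le_one hcont
    (V := (fun p : ℝ × ℝ × ℝ => w i * p.1 + w j * p.2.1 + w k * p.2.2) ''
      (({0, π} : Set ℝ) ×ˢ (({0, π} : Set ℝ) ×ˢ ({0, π} : Set ℝ))))
    (((Set.toFinite _).prod ((Set.toFinite _).prod (Set.toFinite _))).image _) (fun s hs => by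
      rcases lt_or_ge 0 (faceDisc W (u + s • w) i j k) with hD | hD
      · right
        obtain ⟨d, hd, hd0⟩ := h.hasDerivAt_line (hline s hs) hD
        exact ⟨d, hd0 hw0, hd⟩
      · left
        refine ⟨(angU W (u + s • w) i j k, angU W (u + s • w) j i k, angU W (u + s • w) k i j),
          ⟨?_, ?_, ?_⟩, rfl⟩
        · simpa using h.angU_eq_zero_or_pi (hline s hs) hD
        · simpa [angU_comm W _ j i k] using
            h.rotate.angU_eq_zero_or_pi (hline s hs) (by rwa [faceDisc_rotate])
        · simpa using h.rotate.rotate.angU_eq_zero_or_pi (hline s hs)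
            (by rwa [faceDisc_rotate, faceDisc_rotate]))
  simp only [one_smul, zero_smul, add_zero] at hmain
  rw [show u + w = v by rw [hw]; abel, angU_comm W v j i k, angU_comm W u j i k] at hmain
  exact hmain

end TriSurface

namespace TriSurface

variable {N : ℕ} {S : TriSurface N} {W : Weights S} {u v : Fin N → ℝ} {i j k : Fin N}

/-! ### Curvature as a function of `u` -/

/-- The extended angle at `i` in a face `σ` as a function of `u`. -/
noncomputable def faceU (W : Weights S) (u : Fin N → ℝ) (i : Fin N) (σ : Finset (Fin N)) : ℝ :=
  (1 / 2) * ∑ j ∈ σ.erase i, ∑ k ∈ (σ.erase i).erase j, angU W u i j k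

/-- The extended curvature as a function of `u`. -/
noncomputable def KU (W : Weights S) (u : Fin N → ℝ) (i : Fin N) : ℝ :=
  2 * π - ∑ σ ∈ S.F.filter (fun σ => i ∈ σ), faceU W u i σ

theorem exists_isFace {σ : Finset (Fin N)} (hσ : σ ∈ S.F) (hi : i ∈ σ) :
    ∃ j k, IsFace S i j k ∧ σ = {i, j, k} := by
  have h3 := S.card_face σ hσ
  have h2 : (σ.erase i).card = 2 := by rw [Finset.card_erase_of_mem hi, h3]
  obtain ⟨j, k, hjk, he⟩ := Finset.card_eq_two.1 h2
  have hs : σ = {i, j, k} := by rw [← Finset.insert_erase hi, he]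
  have hj : j ∈ σ.erase i := by rw [he]; simp
  have hk : k ∈ σ.erase i := by rw [he]; simp
  exact ⟨j, k, ⟨hs ▸ hσ, (Finset.ne_of_mem_erase hj).symm, (Finset.ne_of_mem_erase hk).symm, hjk⟩, hs⟩

theorem IsFace.half_sum (h : IsFace S i j k) {g : Fin N → Fin N → ℝ} (hg : g j k = g k j) :
    (1 / 2) * ∑ a ∈ ({i, j, k} : Finset (Fin N)).erase i,
      ∑ b ∈ (({i, j, k} : Finset (Fin N)).erase i).erase a, g a b = g j k := by
  have e1 : ({i, j, k} : Finset (Fin N)).erase i = {j, k} := by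
    rw [Finset.erase_insert]; simp [h.ij, h.ik]
  have e2 : ({j, k} : Finset (Fin N)).erase j = {k} := by
    rw [Finset.erase_insert]; simp [h.jk]
  have e3 : ({j, k} : Finset (Fin N)).erase k = {j} := by
    rw [Finset.pair_comm, Finset.erase_insert]; simp [h.jk.symm]
  rw [e1, Finset.sum_pair h.jk, e2, e3, Finset.sum_singleton, Finset.sum_singleton, hg]
  ring

theorem IsFace.faceU_eq (h : IsFace S i j k) (u : Fin N → ℝ) :
    faceU W u i {i, j, k} = angU W u i j k :=
  h.half_sum (angU_comm W u i j k)

theorem IsFace.sum_faceU (h : IsFace S i j k) (u w : Fin N → ℝ) :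
    ∑ x ∈ ({i, j, k} : Finset (Fin N)), w x * faceU W u x {i, j, k} =
      w i * angU W u i j k + w j * angU W u j k i + w k * angU W u k i j := by
  have e2 : ({i, j, k} : Finset (Fin N)) = {j, k, i} := by ext; simp; tauto
  have e3 : ({i, j, k} : Finset (Fin N)) = {k, i, j} := by ext; simp; tauto
  rw [Finset.sum_insert (by simp [h.ij, h.ik]), Finset.sum_pair h.jk, h.faceU_eq, e2,
    h.rotate.faceU_eq, ← e2, e3, h.rotate.rotate.faceU_eq]
  ring

theorem sum_mul_KU (W : Weights S) (u w : Fin N → ℝ) :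
    ∑ i, w i * KU W u i =
      ∑ i, w i * (2 * π) - ∑ σ ∈ S.F, ∑ x ∈ σ, w x * faceU W u x σ := by
  have : ∑ i, ∑ σ ∈ S.F.filter (fun σ => i ∈ σ), w i * faceU W u i σ
      = ∑ σ ∈ S.F, ∑ x ∈ σ, w x * faceU W u x σ := by
    refine Finset.sum_comm' fun x y => ?_
    simp [and_comm]
  rw [← this, ← Finset.sum_sub_distrib]
  refine Finset.sum_congr rfl fun i _ => ?_
  rw [KU, mul_sub, Finset.mul_sum]

theorem exists_mem_face {σ : Finset (Fin N)} (hσ : σ ∈ S.F) :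
    ∃ i j k, IsFace S i j k ∧ σ = {i, j, k} := by
  obtain ⟨i, hi⟩ : σ.Nonempty := Finset.card_pos.1 (by rw [S.card_face σ hσ]; norm_num)
  exact ⟨i, exists_isFace hσ hi⟩

theorem KU_monotone (hu : u ∈ Dom W) (hv : v ∈ Dom W) :
    0 ≤ ∑ i, (KU W v i - KU W u i) * (v i - u i) := by
  have h1 := sum_mul_KU W u (fun i => v i - u i)
  have h2 := sum_mul_KU W v (fun i => v i - u i)
  have h3 : ∑ σ ∈ S.F, ∑ x ∈ σ, (v x - u x) * faceU W v x σ ≤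
      ∑ σ ∈ S.F, ∑ x ∈ σ, (v x - u x) * faceU W u x σ := by
    refine Finset.sum_le_sum fun σ hσ => ?_
    obtain ⟨i, j, k, h, rfl⟩ := exists_mem_face hσ
    rw [h.sum_faceU v fun i => v i - u i, h.sum_faceU u fun i => v i - u i]
    exact h.ray_le hu hv
  have : ∑ i, (KU W v i - KU W u i) * (v i - u i) =
      ∑ i, (v i - u i) * KU W v i - ∑ i, (v i - u i) * KU W u i := by
    rw [← Finset.sum_sub_distrib]
    exact Finset.sum_congr rfl fun i _ => by ring
  linarith

theorem angU_mem (W : Weights S) (u : Fin N → ℝ) (i j k : Fin N) :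
    angU W u i j k ∈ Set.Icc 0 π := ⟨arccos_nonneg _, arccos_le_pi _⟩

theorem faceU_mem {σ : Finset (Fin N)} (hσ : σ ∈ S.F) (hi : i ∈ σ) (u : Fin N → ℝ) :
    faceU W u i σ ∈ Set.Icc 0 π := by
  obtain ⟨j, k, h, rfl⟩ := exists_isFace hσ hi
  rw [h.faceU_eq]; exact angU_mem ..

theorem KU_le (W : Weights S) (u : Fin N → ℝ) (i : Fin N) : KU W u i ≤ 2 * π := by
  have : 0 ≤ ∑ σ ∈ S.F.filter (fun σ => i ∈ σ), faceU W u i σ :=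
    Finset.sum_nonneg fun σ hσ => (faceU_mem (Finset.mem_filter.1 hσ).1 (Finset.mem_filter.1 hσ).2 u).1
  unfold KU; linarith

theorem le_KU (W : Weights S) (u : Fin N → ℝ) (i : Fin N) :
    2 * π - S.F.card * π ≤ KU W u i := by
  have h1 : ∑ σ ∈ S.F.filter (fun σ => i ∈ σ), faceU W u i σ ≤
      (S.F.filter (fun σ => i ∈ σ)).card • π :=
    Finset.sum_le_card_nsmul _ _ _ fun σ hσ =>
      (faceU_mem (Finset.mem_filter.1 hσ).1 (Finset.mem_filter.1 hσ).2 u).2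
  have h2 : ((S.F.filter (fun σ => i ∈ σ)).card : ℝ) ≤ S.F.card := by
    exact_mod_cast Finset.card_filter_le _ _
  rw [nsmul_eq_mul] at h1
  have := mul_le_mul_of_nonneg_right h2 pi_pos.le
  unfold KU; linarith

theorem continuousAt_KU (hu : u ∈ Dom W) (i : Fin N) : ContinuousAt (fun y => KU W y i) u := by
  refine continuousAt_const.sub (tendsto_finsetSum _ fun σ hσ => ?_)
  obtain ⟨j, k, h, rfl⟩ := exists_isFace (Finset.mem_filter.1 hσ).1 (Finset.mem_filter.1 hσ).2
  simp only [h.faceU_eq]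
  exact h.continuousAt_angU hu

theorem differentiableAt_KU (hu : u ∈ Dom W)
    (hD : ∀ i j k, IsFace S i j k → 0 < faceDisc W u i j k) (i : Fin N) :
    DifferentiableAt ℝ (fun y => KU W y i) u := by
  refine (differentiableAt_const _).sub (DifferentiableAt.fun_sum fun σ hσ => ?_)
  obtain ⟨j, k, h, rfl⟩ := exists_isFace (Finset.mem_filter.1 hσ).1 (Finset.mem_filter.1 hσ).2
  simp only [h.faceU_eq]
  exact h.differentiableAt_angU hu (hD _ _ _ h)

theorem exists_coercive_KU (hu : u ∈ Dom W)
    (hD : ∀ i j k, IsFace S i j k → 0 < faceDisc W u i j k) :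
    ∃ c > 0, ∀ v ∈ Dom W,
      c * min (‖v - u‖ ^ 2) ‖v - u‖ ≤ ∑ i, (KU W v i - KU W u i) * (v i - u i) := by
  have hdiff : DifferentiableAt ℝ (KU W) u := differentiableAt_pi.2 (differentiableAt_KU hu hD)
  refine exists_coercive_of_ray_monotone (convex_Dom W) hu (fun u hu v hv => KU_monotone hu hv)
    hdiff.hasFDerivAt fun w hw => ?_
  have hl : HasDerivAt (fun s : ℝ => u + s • w) w 0 := by
    simpa using ((hasDerivAt_id (0 : ℝ)).smul_const w).const_add u
  have hK : HasDerivAt (fun s : ℝ => KU W (u + s • w)) (fderiv ℝ (KU W) u w) 0 :=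
    HasFDerivAt.comp_hasDerivAt (0 : ℝ) (l := KU W) (by simpa using hdiff.hasFDerivAt) hl
  have hsum : HasDerivAt (fun s : ℝ => ∑ i, w i * KU W (u + s • w) i)
      (∑ i, w i * fderiv ℝ (KU W) u w i) 0 :=
    HasDerivAt.fun_sum fun i _ => (hasDerivAt_pi.1 hK i).const_mul (w i)
  have hface : ∀ σ ∈ S.F, ∃ d, HasDerivAt
      (fun s : ℝ => ∑ x ∈ σ, w x * faceU W (u + s • w) x σ) d 0 ∧
      ((∃ x ∈ σ, w x ≠ 0) → d < 0) ∧ d ≤ 0 := by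
    intro σ hσ
    obtain ⟨i, j, k, h, rfl⟩ := exists_mem_face hσ
    obtain ⟨d, hd, hneg⟩ := h.hasDerivAt_line (W := W) (w := w) (u := u) (s := 0) (by simpa using hu)
      (by simpa [faceDisc] using hD i j k h)
    have hd' : HasDerivAt (fun s : ℝ => ∑ x ∈ ({i, j, k} : Finset (Fin N)),
        w x * faceU W (u + s • w) x {i, j, k}) d 0 := by
      refine hd.congr_of_eventuallyEq (Filter.Eventually.of_forall fun s => ?_)
      simp only [h.sum_faceU _ w]
      rw [angU_comm W _ j k i]
    refine ⟨d, hd', ?_, ?_⟩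
    · rintro ⟨x, hx, hx0⟩
      refine hneg fun h0 => ?_
      simp only [Finset.mem_insert, Finset.mem_singleton] at hx
      rcases hx with rfl | rfl | rfl <;> tauto
    · by_cases h0 : w i = 0 ∧ w j = 0 ∧ w k = 0
      · have : HasDerivAt (fun _ : ℝ => (0 : ℝ)) d 0 := by
          simpa only [h0.1, h0.2.1, h0.2.2, zero_mul, add_zero] using hd
        exact (this.unique (hasDerivAt_const _ _)).le
      · exact (hneg h0).le
  choose! d hd hdneg hdle using hface
  have hsum2 : HasDerivAt (fun s : ℝ => ∑ i, w i * KU W (u + s • w) i) (-∑ σ ∈ S.F, d σ) 0 := by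
    simp only [sum_mul_KU]
    exact (HasDerivAt.fun_sum fun σ hσ => hd σ hσ).const_sub _
  have heq := hsum.unique hsum2
  obtain ⟨x, hx⟩ := Function.ne_iff.1 hw
  obtain ⟨σ, hσ, hxσ⟩ := S.vertex_cover x
  have : ∑ σ ∈ S.F, d σ < 0 := Finset.sum_neg' hdle ⟨σ, hσ, hdneg σ hσ ⟨x, hxσ, hx⟩⟩
  simp only [mul_comm] at heq ⊢
  linarith

end TriSurface

/-! ### Comparison of the two coordinate systems -/

theorem ucoord_one_neg (x : ℝ) : TriSurface.ucoord 1 x < 0 := by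
  have h1 : 1 < √(1 + exp (2 * x)) := by
    rw [Real.lt_sqrt zero_le_one]; linarith [exp_pos (2 * x)]
  have h2 : log ((√(1 + exp (2 * x)) - 1) / (√(1 + exp (2 * x)) + 1)) < 0 :=
    Real.log_neg (div_pos (by linarith) (by linarith)) (by rw [div_lt_one] <;> linarith)
  simp only [TriSurface.ucoord, one_ne_zero, if_false]
  linarith

theorem exp_ucoord_one_sq (x : ℝ) : exp (TriSurface.ucoord 1 x) ^ 2 =
    (√(1 + exp (2 * x)) - 1) / (√(1 + exp (2 * x)) + 1) := by
  have h1 : 1 < √(1 + exp (2 * x)) := by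
    rw [Real.lt_sqrt zero_le_one]; linarith [exp_pos (2 * x)]
  rw [← Real.exp_nat_mul]
  simp only [TriSurface.ucoord, one_ne_zero, if_false]
  rw [Nat.cast_ofNat, ← mul_assoc, mul_one_div_cancel two_ne_zero, one_mul,
    exp_log (div_pos (by linarith) (by linarith))]

theorem vC_ucoord {e : ℝ} (he : e = 0 ∨ e = 1) (x : ℝ) :
    vC e (TriSurface.ucoord e x) = √(1 + e * exp (2 * x)) := by
  rcases he with rfl | rfl
  · simp [vC]
  · have h1 : 1 < √(1 + exp (2 * x)) := by
      rw [Real.lt_sqrt zero_le_one]; linarith [exp_pos (2 * x)]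
    rw [vC, one_mul, exp_ucoord_one_sq, one_mul]
    have : √(1 + exp (2 * x)) + 1 ≠ 0 := by linarith
    field_simp
    ring

theorem vS_ucoord {e : ℝ} (he : e = 0 ∨ e = 1) (x : ℝ) :
    vS e (TriSurface.ucoord e x) = exp x := by
  rcases he with rfl | rfl
  · simp [vS, TriSurface.ucoord]
  · have hn : (1 : ℝ) = 1 → TriSurface.ucoord 1 x < 0 := fun _ => ucoord_one_neg x
    have h := vC_sq (Or.inr rfl) hn
    rw [vC_ucoord (Or.inr rfl), sq_sqrt (by positivity)] at h
    have h2 : vS 1 (TriSurface.ucoord 1 x) ^ 2 = exp x ^ 2 := by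
      rw [← Real.exp_nat_mul, Nat.cast_ofNat]; linarith
    exact (sq_eq_sq₀ (vS_pos (Or.inr rfl) hn).le (exp_pos x).le).1 h2

theorem ucoord_log_vS {e u : ℝ} (he : e = 0 ∨ e = 1) (hu : e = 1 → u < 0) :
    TriSurface.ucoord e (log (vS e u)) = u := by
  have hS := vS_pos he hu
  have hC := vC_pos he hu
  have hsq := vC_sq he hu
  rcases he with rfl | rfl
  · simp [TriSurface.ucoord, vS]
  · have h1 : √(1 + exp (2 * log (vS 1 u))) = vC 1 u := by
      rw [mul_comm, Real.exp_mul, exp_log hS, Real.rpow_two, sqrt_eq_iff_mul_self_eq]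
      · linarith
      · positivity
      · exact hC.le
    have hd := vden_pos (Or.inr rfl) hu
    have h2 : (vC 1 u - 1) / (vC 1 u + 1) = exp u ^ 2 := by
      have : vC 1 u + 1 ≠ 0 := by linarith
      have hd' := hd.ne'
      rw [one_mul] at hd'
      rw [div_eq_iff this, vC, one_mul]
      field_simp
      ring
    simp only [TriSurface.ucoord, one_ne_zero, if_false]
    rw [h1, h2, Real.log_pow, log_exp]
    push_cast; ring

/-- The generalized angle opposite to `c` of a possibly degenerate hyperbolic triangle. -/
theorem arccos_eq_pi_of_le {a b c : ℝ} (ha : 0 < a) (hb : 0 < b) (h : a + b ≤ c) :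
    arccos ((cosh a * cosh b - cosh c) / (sinh a * sinh b)) = π := by
  have hp : 0 < sinh a * sinh b := mul_pos (sinh_pos_iff.2 ha) (sinh_pos_iff.2 hb)
  have h1 : cosh (a + b) ≤ cosh c := cosh_le_cosh.2 (by
    rw [abs_of_pos (by linarith), abs_of_pos (by linarith)]; exact h)
  rw [cosh_add] at h1
  rw [arccos_eq_pi, div_le_iff₀ hp]
  linarith

theorem arccos_eq_zero_of_le {a b c : ℝ} (ha : 0 < a) (hb : 0 < b) (hc : 0 < c)
    (h : c ≤ |a - b|) :
    arccos ((cosh a * cosh b - cosh c) / (sinh a * sinh b)) = 0 := by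
  have hp : 0 < sinh a * sinh b := mul_pos (sinh_pos_iff.2 ha) (sinh_pos_iff.2 hb)
  have h1 : cosh c ≤ cosh (a - b) := cosh_le_cosh.2 (by rwa [abs_of_pos hc])
  rw [cosh_sub] at h1
  rw [arccos_eq_zero, le_div_iff₀ hp]
  linarith

namespace TriSurface

variable {N : ℕ} {S : TriSurface N} {W : Weights S} {f : Fin N → ℝ} {i j k : Fin N}

theorem uOf_mem_Dom (W : Weights S) (f : Fin N → ℝ) : uOf W f ∈ Dom W := fun i hi => by
  rw [uOf, hi]; exact ucoord_one_neg _

theorem lH_eq (W : Weights S) (f : Fin N → ℝ) (i j : Fin N) :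
    lH W f i j = Real.arcosh (edgeCosh W (uOf W f) i j) := by
  have hp : 0 ≤ 1 + W.eps i * exp (2 * f i) := by
    rcases W.eps01 i with h | h <;> rw [h] <;> positivity
  rw [lH, edgeCosh, uOf, uOf, vC_ucoord (W.eps01 i), vC_ucoord (W.eps01 j),
    vS_ucoord (W.eps01 i), vS_ucoord (W.eps01 j), sqrt_mul hp, exp_add]
  rfl

theorem lH_comm (W : Weights S) (f : Fin N → ℝ) (i j : Fin N) : lH W f i j = lH W f j i := by
  rw [lH_eq, lH_eq, edgeCosh_comm]

theorem IsFace.lH_pos (h : IsFace S i j k) : 0 < lH W f i j := by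
  rw [lH_eq]; exact arcosh_pos (h.one_lt (uOf_mem_Dom W f))

theorem IsFace.cosh_lH (h : IsFace S i j k) :
    cosh (lH W f i j) = edgeCosh W (uOf W f) i j := by
  rw [lH_eq, cosh_arcosh (h.one_lt (uOf_mem_Dom W f)).le]

theorem IsFace.sinh_lH (h : IsFace S i j k) :
    sinh (lH W f i j) = √(edgeCosh W (uOf W f) i j ^ 2 - 1) := by
  rw [lH_eq, sinh_arcosh (h.one_lt (uOf_mem_Dom W f)).le]

theorem IsFace.thetaH_eq (h : IsFace S i j k) : thetaH W f i j k = angU W (uOf W f) i j k := by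
  rw [thetaH, h.cosh_lH, h.sinh_lH, h.swap.cosh_lH, h.swap.sinh_lH, h.rotate.cosh_lH]
  rfl

theorem IsFace.thetaExH_eq (h : IsFace S i j k) :
    thetaExH W f i j k = angU W (uOf W f) i j k := by
  rw [← h.thetaH_eq]
  have p1 := h.lH_pos (W := W) (f := f)
  have p2 := h.swap.lH_pos (W := W) (f := f)
  have p3 := h.rotate.lH_pos (W := W) (f := f)
  unfold thetaExH
  split_ifs with h1 h2
  · rfl
  · exact (arccos_eq_pi_of_le p1 p2 h2).symm
  · refine (arccos_eq_zero_of_le p1 p2 p3 ?_).symm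
    rw [le_abs]
    by_contra! h3
    exact h1 ⟨by linarith, by linarith [h3.2], by linarith [h3.1]⟩

theorem KExH_eq (W : Weights S) (f : Fin N → ℝ) (i : Fin N) : KExH W f i = KU W (uOf W f) i := by
  unfold KExH KU
  congr 1
  refine Finset.sum_congr rfl fun σ hσ => ?_
  obtain ⟨j, k, h, rfl⟩ := exists_isFace (Finset.mem_filter.1 hσ).1 (Finset.mem_filter.1 hσ).2
  rw [h.faceU_eq, ← h.thetaExH_eq]
  exact h.half_sum (by rw [h.thetaExH_eq, h.swap.thetaExH_eq, angU_comm])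

theorem KH_eq (W : Weights S) (f : Fin N → ℝ) (i : Fin N) : KH W f i = KU W (uOf W f) i := by
  unfold KH KU
  congr 1
  refine Finset.sum_congr rfl fun σ hσ => ?_
  obtain ⟨j, k, h, rfl⟩ := exists_isFace (Finset.mem_filter.1 hσ).1 (Finset.mem_filter.1 hσ).2
  rw [h.faceU_eq, ← h.thetaH_eq]
  exact h.half_sum (by rw [h.thetaH_eq, h.swap.thetaH_eq, angU_comm])

theorem faceDisc_pos_of_admissible (hf : admissibleH W f) (h : IsFace S i j k) :
    0 < faceDisc W (uOf W f) i j k := by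
  have t1 := hf i j k h.mem
  have t2 := hf j k i h.rotate.mem
  have t3 := hf k i j h.rotate.rotate.mem
  rw [lH_comm W f j i, lH_comm W f k i] at t2
  rw [lH_comm W f k i, lH_comm W f k j] at t3
  have p1 := h.lH_pos (W := W) (f := f)
  have p2 := h.swap.lH_pos (W := W) (f := f)
  have p3 := h.rotate.lH_pos (W := W) (f := f)
  have c1 : cosh (lH W f i j - lH W f i k) < cosh (lH W f j k) := cosh_lt_cosh.2 (by
    rw [abs_of_pos p3, abs_lt]; constructor <;> linarith)
  have c2 : cosh (lH W f j k) < cosh (lH W f i j + lH W f i k) := cosh_lt_cosh.2 (by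
    rw [abs_of_pos p3, abs_of_pos (by linarith)]; linarith)
  rw [cosh_sub] at c1
  rw [cosh_add] at c2
  rw [h.cosh_lH, h.sinh_lH, h.swap.cosh_lH, h.swap.sinh_lH, h.rotate.cosh_lH] at c1 c2
  have hu := uOf_mem_Dom W f
  have hD : faceDisc W (uOf W f) i j k = triDisc (edgeCosh W (uOf W f) i j)
      (edgeCosh W (uOf W f) i k) (edgeCosh W (uOf W f) j k) := by
    unfold faceDisc triDisc; ring
  rw [hD, triDisc_eq_sq_sub (h.one_lt hu) (h.swap.one_lt hu), sub_pos]
  exact sq_lt_sq' (by linarith) (by linarith)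

end TriSurface

/-! ### Behaviour of the curvature near the boundary of the domain -/

theorem exists_lt_vS (R : ℝ) : ∃ b < 0, ∀ u, b < u → u < 0 → R < vS 1 u := by
  have hR : 0 < |R| + 2 := by positivity
  refine ⟨-(1 / (|R| + 2)), by have : 0 < 1 / (|R| + 2) := by positivity
                               linarith, fun u hb hu => ?_⟩
  have hd := vden_pos (e := 1) (Or.inr rfl) fun _ => hu
  have h1 : -u * (|R| + 2) < 1 := by
    rw [← lt_div_iff₀ hR]; linarith
  have h2 := Real.add_one_le_exp u
  have h3 := Real.add_one_le_exp (2 * u)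
  rw [two_mul, exp_add] at h3
  rw [vS, lt_div_iff₀ hd]
  have h4 : R * (1 - 1 * exp u ^ 2) ≤ |R| * (1 - 1 * exp u ^ 2) :=
    mul_le_mul_of_nonneg_right (le_abs_self R) hd.le
  nlinarith [abs_nonneg R]

theorem le_edge_of_one {e S₁ C₁ S₂ C₂ η : ℝ} (he : e = 0 ∨ e = 1) (hS₁ : 0 < S₁) (hS₂ : 0 < S₂)
    (h1 : S₁ ≤ C₁) (hC₂ : 0 < C₂) (hsq : C₂ ^ 2 = 1 + e * S₂ ^ 2) (hη : 0 < 1 * e + η) :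
    min 1 (1 * e + η) / 2 * (S₁ * (C₂ + S₂)) ≤ C₁ * C₂ + η * (S₁ * S₂) := by
  have hm1 : min 1 (1 * e + η) ≤ 1 := min_le_left _ _
  have hm2 : min 1 (1 * e + η) ≤ 1 * e + η := min_le_right _ _
  have hm0 : 0 < min 1 (1 * e + η) := lt_min one_pos hη
  set m := min 1 (1 * e + η)
  have hSC : S₁ * C₂ ≤ C₁ * C₂ := mul_le_mul_of_nonneg_right h1 hC₂.le
  have hSS : 0 < S₁ * S₂ := mul_pos hS₁ hS₂
  have hSC0 : 0 < S₁ * C₂ := mul_pos hS₁ hC₂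
  rcases he with rfl | rfl
  · have : m * (S₁ * S₂) ≤ η * (S₁ * S₂) := mul_le_mul_of_nonneg_right (by linarith) hSS.le
    have h3 : m * (S₁ * C₂) ≤ 1 * (S₁ * C₂) := mul_le_mul_of_nonneg_right hm1 hSC0.le
    nlinarith [mul_pos hm0 hSS, mul_pos hm0 hSC0]
  · have hle : S₂ ≤ C₂ := by nlinarith
    have h4 : S₁ * S₂ ≤ S₁ * C₂ := mul_le_mul_of_nonneg_left hle hS₁.le
    have h5 : (m - 1) * (S₁ * S₂) ≤ η * (S₁ * S₂) :=
      mul_le_mul_of_nonneg_right (by linarith) hSS.le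
    nlinarith [mul_nonneg hm0.le (sub_nonneg.2 h4), mul_nonneg (sub_nonneg.2 hm1) (sub_nonneg.2 h4)]

theorem angC_le_of_le {a b c δ : ℝ} (ha : 1 < a) (hb : 1 < b) (hδ : 0 ≤ δ)
    (hδ' : δ ≤ π / 2) (h : c ≤ (1 - cos δ) * (a * b)) : angC a b c ≤ δ := by
  have ha2 : 0 < a ^ 2 - 1 := by nlinarith
  have hb2 : 0 < b ^ 2 - 1 := by nlinarith
  have hp : 0 < √(a ^ 2 - 1) * √(b ^ 2 - 1) := mul_pos (sqrt_pos.2 ha2) (sqrt_pos.2 hb2)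
  have hcos : 0 ≤ cos δ := cos_nonneg_of_neg_pi_div_two_le_of_le (by linarith [pi_pos]) hδ'
  have h1 : √(a ^ 2 - 1) ≤ a := by
    rw [Real.sqrt_le_left (by linarith)]; linarith
  have h2 : √(b ^ 2 - 1) ≤ b := by
    rw [Real.sqrt_le_left (by linarith)]; linarith
  have h3 : √(a ^ 2 - 1) * √(b ^ 2 - 1) ≤ a * b :=
    mul_le_mul h1 h2 (sqrt_nonneg _) (by linarith)
  have h4 : cos δ ≤ (a * b - c) / (√(a ^ 2 - 1) * √(b ^ 2 - 1)) := by
    rw [le_div_iff₀ hp]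
    nlinarith [mul_le_mul_of_nonneg_left h3 hcos]
  calc angC a b c ≤ arccos (cos δ) := antitone_arccos h4
    _ = δ := arccos_cos hδ (by linarith [pi_pos])

namespace TriSurface

variable {N : ℕ} {S : TriSurface N} {W : Weights S} {u v : Fin N → ℝ} {i j k : Fin N}

theorem IsFace.exists_angU_le (h : IsFace S i j k) (hi : W.eps i = 1) {δ : ℝ} (hδ : 0 < δ)
    (hδ' : δ ≤ π / 2) : ∃ b < 0, ∀ u ∈ Dom W, b < u i → angU W u i j k ≤ δ := by
  have hc : cos δ < 1 := by
    rw [← cos_zero]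
    exact cos_lt_cos_of_nonneg_of_le_pi_div_two le_rfl hδ' hδ
  have hη1 := h.edge (W := W)
  have hη2 := h.swap.edge (W := W)
  rw [hi] at hη1 hη2
  set m₁ := min 1 (1 * W.eps j + W.eta i j) / 2 with hm₁
  set m₂ := min 1 (1 * W.eps k + W.eta i k) / 2 with hm₂
  have m1pos : 0 < m₁ := half_pos (lt_min one_pos hη1)
  have m2pos : 0 < m₂ := half_pos (lt_min one_pos hη2)
  set M := (1 + |W.eta j k|) / ((1 - cos δ) * (m₁ * m₂)) with hM
  obtain ⟨b, hb, hbS⟩ := exists_lt_vS (max M 1)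
  refine ⟨b, hb, fun u hu hbu => ?_⟩
  have hS := hbS (u i) hbu (hu i hi)
  have hS1 : M < vS 1 (u i) := (le_max_left _ _).trans_lt hS
  have hS2 : 1 < vS 1 (u i) := (le_max_right _ _).trans_lt hS
  have Sj := vS_pos (W.eps01 j) (hu j)
  have Sk := vS_pos (W.eps01 k) (hu k)
  have Cj := vC_pos (W.eps01 j) (hu j)
  have Ck := vC_pos (W.eps01 k) (hu k)
  have hCi := vC_pos (W.eps01 i) (hu i)
  have hCsq := vC_sq (W.eps01 i) (hu i)
  rw [hi] at hCi hCsq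
  have hSC : vS 1 (u i) ≤ vC 1 (u i) := by nlinarith
  refine angC_le_of_le (h.one_lt hu) (h.swap.one_lt hu) hδ.le hδ' ?_
  have l1 : m₁ * (vS 1 (u i) * (vC (W.eps j) (u j) + vS (W.eps j) (u j))) ≤ edgeCosh W u i j := by
    rw [edgeCosh, hi]
    exact le_edge_of_one (W.eps01 j) (by linarith) Sj hSC Cj (vC_sq (W.eps01 j) (hu j)) hη1
  have l2 : m₂ * (vS 1 (u i) * (vC (W.eps k) (u k) + vS (W.eps k) (u k))) ≤ edgeCosh W u i k := by
    rw [edgeCosh, hi]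
    exact le_edge_of_one (W.eps01 k) (by linarith) Sk hSC Ck (vC_sq (W.eps01 k) (hu k)) hη2
  have l3 : edgeCosh W u j k ≤ (1 + |W.eta j k|) *
      ((vC (W.eps j) (u j) + vS (W.eps j) (u j)) * (vC (W.eps k) (u k) + vS (W.eps k) (u k))) := by
    rw [edgeCosh]
    have t1 : W.eta j k * (vS (W.eps j) (u j) * vS (W.eps k) (u k)) ≤
        |W.eta j k| * (vS (W.eps j) (u j) * vS (W.eps k) (u k)) :=
      mul_le_mul_of_nonneg_right (le_abs_self _) (by positivity)
    have t2 : vC (W.eps j) (u j) * vC (W.eps k) (u k) ≤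
      (vC (W.eps j) (u j) + vS (W.eps j) (u j)) * (vC (W.eps k) (u k) + vS (W.eps k) (u k)) := by
      gcongr <;> linarith
    have t3 : vS (W.eps j) (u j) * vS (W.eps k) (u k) ≤
      (vC (W.eps j) (u j) + vS (W.eps j) (u j)) * (vC (W.eps k) (u k) + vS (W.eps k) (u k)) := by
      gcongr <;> linarith
    have t4 := mul_le_mul_of_nonneg_left t3 (abs_nonneg (W.eta j k))
    linarith
  set Tj := vC (W.eps j) (u j) + vS (W.eps j) (u j)
  set Tk := vC (W.eps k) (u k) + vS (W.eps k) (u k)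
  have Tj0 : 0 < Tj := by positivity
  have Tk0 : 0 < Tk := by positivity
  have l4 := mul_le_mul l1 l2 (by positivity) (by linarith [h.one_lt hu])
  have l5 : 1 + |W.eta j k| ≤ (1 - cos δ) * (m₁ * m₂) * vS 1 (u i) ^ 2 := by
    have hpos : 0 < (1 - cos δ) * (m₁ * m₂) := mul_pos (by linarith) (by positivity)
    rw [hM, div_lt_iff₀ hpos] at hS1
    have : vS 1 (u i) ≤ vS 1 (u i) ^ 2 := by nlinarith
    nlinarith [mul_le_mul_of_nonneg_left this hpos.le]
  have l6 := mul_le_mul_of_nonneg_right l5 (mul_pos Tj0 Tk0).le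
  have l7 := mul_le_mul_of_nonneg_left l4 (sub_nonneg.2 hc.le)
  nlinarith only [l3, l6, l7]

theorem exists_le_KU (hi : W.eps i = 1) {m : ℝ} (hm : m < 2 * π) :
    ∃ b < 0, ∀ u ∈ Dom W, b < u i → m ≤ KU W u i := by
  have hF : (0 : ℝ) < S.F.card + 1 := by positivity
  set δ := min ((2 * π - m) / (S.F.card + 1)) (π / 2) with hδ
  have hδ0 : 0 < δ := lt_min (div_pos (by linarith) hF) (by linarith [pi_pos])
  have hface : ∀ σ ∈ S.F, ∃ b < 0, i ∈ σ → ∀ u ∈ Dom W, b < u i → faceU W u i σ ≤ δ := by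
    intro σ hσ
    by_cases hiσ : i ∈ σ
    · obtain ⟨j, k, h, rfl⟩ := exists_isFace hσ hiσ
      obtain ⟨b, hb, hb'⟩ := h.exists_angU_le hi hδ0 (min_le_right _ _)
      exact ⟨b, hb, fun _ u hu hbu => by rw [h.faceU_eq]; exact hb' u hu hbu⟩
    · exact ⟨-1, by norm_num, fun h => absurd h hiσ⟩
  choose! b hb hb' using hface
  refine ⟨S.F.sup' S.F_nonempty b, (Finset.sup'_lt_iff _).2 hb, fun u hu hbu => ?_⟩
  have h1 : ∑ σ ∈ S.F.filter (fun σ => i ∈ σ), faceU W u i σ ≤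
      (S.F.filter (fun σ => i ∈ σ)).card • δ :=
    Finset.sum_le_card_nsmul _ _ _ fun σ hσ =>
      hb' σ (Finset.mem_filter.1 hσ).1 (Finset.mem_filter.1 hσ).2 u hu
        ((Finset.le_sup' b (Finset.mem_filter.1 hσ).1).trans_lt hbu)
  have h2 : ((S.F.filter (fun σ => i ∈ σ)).card : ℝ) ≤ S.F.card := by
    exact_mod_cast Finset.card_filter_le _ _
  rw [nsmul_eq_mul] at h1
  have h3 := mul_le_mul_of_nonneg_right h2 hδ0.le
  have h4 : δ * (S.F.card + 1) ≤ 2 * π - m := by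
    rw [← le_div_iff₀ hF]; exact min_le_left _ _
  unfold KU; nlinarith

theorem exists_barrier (hi : W.eps i = 1) {R : ℝ} (hR : R < 2 * π) (α : ℝ) :
    ∃ b < 0, ∀ u ∈ Dom W, b < u i → 0 < KU W u i - R * exp (α * u i) := by
  obtain ⟨m, hm1, hm2⟩ := exists_between hR
  obtain ⟨b, hb, hb'⟩ := exists_le_KU (W := W) hi hm2
  have hcont : Filter.Tendsto (fun x : ℝ => R * exp (α * x)) (nhds 0) (nhds (R * exp (α * 0))) :=
    Continuous.tendsto (by fun_prop) 0
  rw [mul_zero, exp_zero, mul_one] at hcont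
  obtain ⟨r, hr, hr'⟩ := Metric.eventually_nhds_iff.1 (hcont.eventually_lt_const hm1)
  refine ⟨max b (-r), max_lt hb (by linarith), fun u hu hbu => ?_⟩
  have h1 := hb' u hu ((le_max_left _ _).trans_lt hbu)
  have h2 := (le_max_right _ _).trans_lt hbu
  have h3 := hr' (y := u i) (by
    rw [Real.dist_eq, sub_zero, abs_of_neg (hu i hi)]; linarith)
  linarith

end TriSurface

/-! ### Solutions of differential equations with a bounded, possibly discontinuous right side -/

section Euler

open Filter Topology

variable {E : Type*} [NormedAddCommGroup E] [NormedSpace ℝ E]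

/-- The Euler polygon with step `h`. -/
noncomputable def eulerSeq (F : E → E) (x₀ : E) (h : ℝ) (k : ℕ) : E :=
  (fun y => y + h • F y)^[k] x₀

theorem norm_eulerSeq_sub_le {F : E → E} {x₀ v : E} {h ε : ℝ} (hh : 0 ≤ h) {k l : ℕ} (hkl : k ≤ l)
    (hF : ∀ m, k ≤ m → m < l → ‖F (eulerSeq F x₀ h m) - v‖ ≤ ε) :
    ‖eulerSeq F x₀ h l - eulerSeq F x₀ h k - (((l : ℝ) - k) * h) • v‖ ≤ ((l : ℝ) - k) * h * ε := by
  induction l, hkl using Nat.le_induction with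
  | base => simp
  | succ l hkl ih =>
    have h1 := ih fun m hm hml => hF m hm (hml.trans (Nat.lt_succ_self l))
    have h2 := hF l hkl (Nat.lt_succ_self l)
    have e : eulerSeq F x₀ h (l + 1) = eulerSeq F x₀ h l + h • F (eulerSeq F x₀ h l) := by
      rw [eulerSeq, Function.iterate_succ_apply']; rfl
    have e2 : eulerSeq F x₀ h (l + 1) - eulerSeq F x₀ h k - ((((l + 1 : ℕ) : ℝ) - k) * h) • v =
        (eulerSeq F x₀ h l - eulerSeq F x₀ h k - (((l : ℝ) - k) * h) • v) +
          h • (F (eulerSeq F x₀ h l) - v) := by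
      rw [e]; push_cast; module
    rw [e2]
    refine (norm_add_le _ _).trans ?_
    rw [norm_smul, Real.norm_of_nonneg hh]
    have := mul_le_mul_of_nonneg_left h2 hh
    push_cast
    linarith

variable [ProperSpace E]

/-- A limit of Euler polygons of a bounded vector field is differentiable, with the expected
derivative, at every time where the vector field is continuous at the position. -/
theorem exists_limit_of_euler {F : E → E} {M : ℝ} (hF : ∀ y, ‖F y‖ ≤ M) (x₀ : E) :
    ∃ x : ℝ → E, x 0 = x₀ ∧ ContinuousOn x (Set.Ici 0) ∧
      ∀ t ≥ 0, ContinuousAt F (x t) → HasDerivWithinAt x (F (x t)) (Set.Ici 0) t := by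
  have hM : 0 ≤ M := (norm_nonneg _).trans (hF x₀)
  let h : ℕ → ℝ := fun n => 1 / ((n : ℝ) + 1)
  have hh : ∀ n, 0 < h n := fun n => by positivity
  let κ : ℕ → ℝ → ℕ := fun n t => ⌊t * ((n : ℝ) + 1)⌋₊
  let X : ℕ → ℝ → E := fun n t => eulerSeq F x₀ (h n) (κ n t)
  have hκmono : ∀ n {a b : ℝ}, a ≤ b → κ n a ≤ κ n b := fun n a b hab =>
    Nat.floor_le_floor (mul_le_mul_of_nonneg_right hab (by positivity))
  have hκ : ∀ a ≥ 0, Tendsto (fun n => (κ n a : ℝ) * h n) (hyperfilter ℕ : Filter ℕ) (𝓝 a) := by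
    intro a ha
    have h1 : Tendsto (fun n : ℕ => (n : ℝ) + 1) atTop atTop :=
      tendsto_atTop_add_const_right _ _ tendsto_natCast_atTop_atTop
    have h2 := ((tendsto_nat_floor_mul_div_atTop ha).comp h1).mono_left Nat.hyperfilter_le_atTop
    refine h2.congr fun n => ?_
    simp only [Function.comp, κ, h]
    rw [mul_one_div]
  have hlip : ∀ n k l, k ≤ l → ‖eulerSeq F x₀ (h n) l - eulerSeq F x₀ (h n) k‖ ≤
      ((l : ℝ) - k) * h n * M := by
    intro n k l hkl
    simpa using norm_eulerSeq_sub_le (F := F) (x₀ := x₀) (v := 0) (ε := M) (hh n).le hkl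
      fun m _ _ => by simpa using hF _
  have hX0 : ∀ n, X n 0 = x₀ := fun n => by simp [X, κ, eulerSeq]
  have hlim : ∀ t ≥ 0, ∃ a, Tendsto (fun n => X n t) (hyperfilter ℕ : Filter ℕ) (𝓝 a) := by
    intro t ht
    have hmem : ∀ n, X n t ∈ Metric.closedBall x₀ (t * M) := by
      intro n
      rw [mem_closedBall_iff_norm]
      have h1 := hlip n (κ n 0) (κ n t) (hκmono n ht)
      have h2 : (κ n t : ℝ) ≤ t * ((n : ℝ) + 1) := Nat.floor_le (by positivity)
      have h3 : (κ n t : ℝ) * h n ≤ t := by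
        simp only [h]; rw [mul_one_div, div_le_iff₀ (by positivity)]; exact h2
      have h4 : ((κ n 0 : ℕ) : ℝ) = 0 := by simp [κ]
      rw [h4, sub_zero] at h1
      rw [← hX0 n]
      exact h1.trans (mul_le_mul_of_nonneg_right h3 hM)
    obtain ⟨a, -, ha⟩ := (isCompact_closedBall x₀ (t * M)).ultrafilter_le_nhds
      ((hyperfilter ℕ).map fun n => X n t) (by
        rw [le_principal_iff, Ultrafilter.mem_coe, Ultrafilter.mem_map]
        exact univ_mem' hmem)
    exact ⟨a, ha⟩
  choose! x hx using hlim
  have hloc : ∀ {a b δ ε : ℝ} {c v : E}, 0 ≤ a → a ≤ b → ‖x a - c‖ + (b - a) * M < δ →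
      (∀ y ∈ Metric.ball c δ, ‖F y - v‖ ≤ ε) → ‖x b - x a - (b - a) • v‖ ≤ (b - a) * ε := by
    intro a b δ ε c v ha hab hδ hball
    have hb := ha.trans hab
    have hstep := (hκ b hb).sub (hκ a ha)
    have t1 : Tendsto (fun n => ‖X n b - X n a - ((κ n b : ℝ) * h n - (κ n a : ℝ) * h n) • v‖)
        (hyperfilter ℕ : Filter ℕ) (𝓝 ‖x b - x a - (b - a) • v‖) :=
      (((hx b hb).sub (hx a ha)).sub (hstep.smul_const v)).norm
    have t2 : Tendsto (fun n => ((κ n b : ℝ) * h n - (κ n a : ℝ) * h n) * ε)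
        (hyperfilter ℕ : Filter ℕ) (𝓝 ((b - a) * ε)) := hstep.mul_const ε
    have t3 : Tendsto (fun n => ‖X n a - c‖ + ((κ n b : ℝ) * h n - (κ n a : ℝ) * h n) * M)
        (hyperfilter ℕ : Filter ℕ) (𝓝 (‖x a - c‖ + (b - a) * M)) :=
      ((hx a ha).sub_const c).norm.add (hstep.mul_const M)
    refine le_of_tendsto_of_tendsto t1 t2 ?_
    filter_upwards [t3.eventually_lt_const hδ] with n hn
    have := norm_eulerSeq_sub_le (F := F) (x₀ := x₀) (v := v) (ε := ε) (hh n).le (hκmono n hab)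
      (fun m hkm hml => hball _ (by
        rw [mem_ball_iff_norm]
        have e1 := hlip n _ _ hkm
        have e2 : ((m : ℝ) - κ n a) * h n * M ≤ ((κ n b : ℝ) - κ n a) * h n * M := by
          have : (m : ℝ) ≤ κ n b := by exact_mod_cast hml.le
          gcongr
        have e3 := norm_sub_le_norm_sub_add_norm_sub (eulerSeq F x₀ (h n) m)
          (eulerSeq F x₀ (h n) (κ n a)) c
        simp only [X] at hn
        linarith))
    rw [sub_mul] at this
    exact this
  have hxlip : ∀ a ≥ 0, ∀ b ≥ a, ‖x b - x a‖ ≤ (b - a) * M := by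
    intro a ha b hab
    simpa using hloc (v := 0) (c := x a) ha hab (lt_add_one _) fun y _ => by simpa using hF y
  refine ⟨x, ?_, ?_, fun t ht hcont => ?_⟩
  · exact tendsto_nhds_unique (hx 0 le_rfl) (by simp only [hX0]; exact tendsto_const_nhds)
  · have : LipschitzOnWith M.toNNReal x (Set.Ici 0) := by
      refine LipschitzOnWith.of_dist_le_mul fun a ha b hb => ?_
      rw [Real.coe_toNNReal M hM]
      rcases le_total a b with hab | hab
      · rw [dist_comm, dist_eq_norm, dist_comm, Real.dist_eq, abs_of_nonneg (by linarith), mul_comm]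
        exact hxlip a ha b hab
      · rw [dist_eq_norm, Real.dist_eq, abs_of_nonneg (by linarith), mul_comm]
        exact hxlip b hb a hab
    exact this.continuousOn
  · rw [hasDerivWithinAt_iff_isLittleO, Asymptotics.isLittleO_iff]
    intro ε hε
    obtain ⟨δ, hδ, hδ'⟩ := Metric.continuousAt_iff.1 hcont ε hε
    have hball : ∀ y ∈ Metric.ball (x t) δ, ‖F y - F (x t)‖ ≤ ε := fun y hy => by
      rw [← dist_eq_norm]; exact (hδ' hy).le
    have hr : 0 < δ / (2 * M + 1) := by positivity
    have hnear : ∀ᶠ s in 𝓝[Set.Ici 0] t, |s - t| < δ / (2 * M + 1) :=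
      mem_nhdsWithin_of_mem_nhds (Metric.ball_mem_nhds t hr)
    filter_upwards [hnear, self_mem_nhdsWithin] with s hs hs0
    rw [lt_div_iff₀ (by positivity)] at hs
    rcases le_total t s with hts | hts
    · rw [abs_of_nonneg (by linarith)] at hs
      rw [Real.norm_eq_abs, abs_of_nonneg (sub_nonneg.2 hts), mul_comm]
      refine hloc ht hts ?_ hball
      rw [sub_self, norm_zero]
      nlinarith
    · rw [abs_of_nonpos (by linarith)] at hs
      have h1 := hxlip s hs0 t hts
      have h2 := hloc (c := x t) (v := F (x t)) (δ := δ) (ε := ε) hs0 hts (by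
        rw [norm_sub_rev]; nlinarith) hball
      rw [Real.norm_eq_abs, abs_of_nonpos (by linarith)]
      have e : x s - x t - (s - t) • F (x t) = -(x t - x s - (t - s) • F (x t)) := by module
      rw [e, norm_neg]
      linarith

end Euler

/-! ### The potential of a single coordinate and the change of coordinates -/

/-- The coordinate in which the flow has bounded speed. -/
noncomputable def slowCoord (α u : ℝ) : ℝ := ∫ s in (0 : ℝ)..u, (1 + exp (-(α * s)))⁻¹

theorem hasStrictDerivAt_slowCoord (α u : ℝ) :
    HasStrictDerivAt (slowCoord α) (1 + exp (-(α * u)))⁻¹ u := by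
  have hc : Continuous fun s : ℝ => (1 + exp (-(α * s)))⁻¹ :=
    Continuous.inv₀ (by fun_prop) fun s => by positivity
  exact intervalIntegral.integral_hasStrictDerivAt_right (hc.intervalIntegrable _ _)
    hc.aestronglyMeasurable.stronglyMeasurableAtFilter hc.continuousAt

theorem strictMono_slowCoord (α : ℝ) : StrictMono (slowCoord α) :=
  strictMono_of_hasDerivAt_pos (fun u => (hasStrictDerivAt_slowCoord α u).hasDerivAt)
    fun u => by positivity

/-- The weighted distance to `p` of a coordinate. -/
noncomputable def coordPot (α p x : ℝ) : ℝ := ∫ s in p..x, exp (α * s) * (s - p)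

theorem hasDerivAt_coordPot (α p x : ℝ) :
    HasDerivAt (coordPot α p) (exp (α * x) * (x - p)) x := by
  have hc : Continuous fun s : ℝ => exp (α * s) * (s - p) := by fun_prop
  exact (intervalIntegral.integral_hasStrictDerivAt_right (hc.intervalIntegrable _ _)
    hc.aestronglyMeasurable.stronglyMeasurableAtFilter hc.continuousAt).hasDerivAt

theorem coordPot_self (α p : ℝ) : coordPot α p p = 0 := by simp [coordPot]

theorem strictMonoOn_coordPot (α p : ℝ) : StrictMonoOn (coordPot α p) (Set.Ici p) := by
  refine strictMonoOn_of_deriv_pos (convex_Ici p)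
    (fun x _ => (hasDerivAt_coordPot α p x).continuousAt.continuousWithinAt) fun x hx => ?_
  rw [interior_Ici] at hx
  rw [(hasDerivAt_coordPot α p x).deriv]
  exact mul_pos (exp_pos _) (sub_pos.2 hx)

theorem strictAntiOn_coordPot (α p : ℝ) : StrictAntiOn (coordPot α p) (Set.Iic p) := by
  refine strictAntiOn_of_deriv_neg (convex_Iic p)
    (fun x _ => (hasDerivAt_coordPot α p x).continuousAt.continuousWithinAt) fun x hx => ?_
  rw [interior_Iic] at hx
  rw [(hasDerivAt_coordPot α p x).deriv]
  exact mul_neg_of_pos_of_neg (exp_pos _) (sub_neg.2 hx)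

theorem le_of_deriv_mul_sub_nonneg {h h' : ℝ → ℝ} {p x : ℝ} (hd : ∀ y, HasDerivAt h (h' y) y)
    (hs : ∀ y, |y - p| ≤ |x - p| → 0 ≤ h' y * (y - p)) : h p ≤ h x := by
  have hcont : Continuous h := continuous_iff_continuousAt.2 fun y => (hd y).continuousAt
  rcases le_total p x with hpx | hpx
  · refine monotoneOn_of_deriv_nonneg (convex_Icc p x) hcont.continuousOn
      (fun y _ => (hd y).differentiableAt.differentiableWithinAt) (fun y hy => ?_)
      (Set.left_mem_Icc.2 hpx) (Set.right_mem_Icc.2 hpx) hpx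
    rw [interior_Icc] at hy
    rw [(hd y).deriv]
    have := hs y (by rw [abs_of_nonneg, abs_of_nonneg] <;> linarith [hy.1, hy.2])
    exact nonneg_of_mul_nonneg_left this (sub_pos.2 hy.1)
  · refine antitoneOn_of_deriv_nonpos (convex_Icc x p) hcont.continuousOn
      (fun y _ => (hd y).differentiableAt.differentiableWithinAt) (fun y hy => ?_)
      (Set.left_mem_Icc.2 hpx) (Set.right_mem_Icc.2 hpx) hpx
    rw [interior_Icc] at hy
    rw [(hd y).deriv]
    have := hs y (by rw [abs_of_nonpos, abs_of_nonpos] <;> linarith [hy.1, hy.2])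
    nlinarith [hy.2]

theorem abs_mul_le_of_near {α p K y : ℝ} (hK : |α| * (|p| + 1) ≤ K) (hy : |y - p| ≤ 1) :
    |α * y| ≤ K := by
  rw [abs_mul]
  refine le_trans (mul_le_mul_of_nonneg_left ?_ (abs_nonneg α)) hK
  have := abs_add_le (y - p) p
  rw [sub_add_cancel] at this
  linarith

theorem coordPot_le {α p K x : ℝ} (hK : |α| * (|p| + 1) ≤ K) (hx : |x - p| ≤ 1) :
    coordPot α p x ≤ exp K / 2 * (x - p) ^ 2 := by
  have h := le_of_deriv_mul_sub_nonneg (p := p) (x := x)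
    (h := fun y => exp K / 2 * (y - p) ^ 2 - coordPot α p y)
    (h' := fun y => (exp K - exp (α * y)) * (y - p)) (fun y => by
      have h1 := ((((hasDerivAt_id y).sub_const p).pow 2).const_mul (exp K / 2)).sub
        (hasDerivAt_coordPot α p y)
      refine h1.congr_deriv ?_
      simp; ring) (fun y hy => by
      have h1 := abs_mul_le_of_near hK (hy.trans hx)
      have h2 : exp (α * y) ≤ exp K := exp_le_exp.2 ((le_abs_self _).trans h1)
      rw [mul_assoc]
      exact mul_nonneg (by linarith) (mul_self_nonneg _))
  simp only [coordPot_self, sub_self] at h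
  linarith

theorem le_coordPot_of_near {α p K x : ℝ} (hK : |α| * (|p| + 1) ≤ K) (hx : |x - p| ≤ 1) :
    exp (-K) / 2 * (x - p) ^ 2 ≤ coordPot α p x := by
  have h := le_of_deriv_mul_sub_nonneg (p := p) (x := x)
    (h := fun y => coordPot α p y - exp (-K) / 2 * (y - p) ^ 2)
    (h' := fun y => (exp (α * y) - exp (-K)) * (y - p)) (fun y => by
      have h1 := (hasDerivAt_coordPot α p y).sub
        ((((hasDerivAt_id y).sub_const p).pow 2).const_mul (exp (-K) / 2))
      refine h1.congr_deriv ?_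
      simp; ring) (fun y hy => by
      have h1 := abs_mul_le_of_near hK (hy.trans hx)
      have h2 : exp (-K) ≤ exp (α * y) := exp_le_exp.2 (neg_le_of_abs_le h1)
      rw [mul_assoc]
      exact mul_nonneg (by linarith) (mul_self_nonneg _))
  simp only [coordPot_self, sub_self] at h
  linarith

theorem le_coordPot {α p K : ℝ} (hK : |α| * (|p| + 1) ≤ K) (x : ℝ) :
    exp (-K) / 2 * min |x - p| 1 ^ 2 ≤ coordPot α p x := by
  rcases le_total |x - p| 1 with hx | hx
  · rw [min_eq_left hx, sq_abs]
    exact le_coordPot_of_near hK hx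
  · rw [min_eq_right hx]
    rcases le_abs'.1 hx with h | h
    · have h1 := le_coordPot_of_near (x := p - 1) hK (by simp)
      have h2 := (strictAntiOn_coordPot α p).antitoneOn (a := x) (b := p - 1)
        (by simp only [Set.mem_Iic]; linarith) (by simp) (by linarith)
      rw [sub_sub_cancel_left] at h1
      linarith
    · have h1 := le_coordPot_of_near (x := p + 1) hK (by simp)
      have h2 := (strictMonoOn_coordPot α p).monotoneOn (a := p + 1) (b := x)
        (by simp) (by simp only [Set.mem_Ici]; linarith) (by linarith)
      rw [add_sub_cancel_left] at h1
      linarith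

theorem coordPot_nonneg (α p x : ℝ) : 0 ≤ coordPot α p x :=
  le_trans (by positivity) (le_coordPot le_rfl x)

/-! ### Exponential convergence -/

section Convergence

variable {N : ℕ} {α c : ℝ} {p : Fin N → ℝ} {G : (Fin N → ℝ) → Fin N → ℝ} {u : ℝ → Fin N → ℝ}

theorem abs_mul_pi_le (α : ℝ) (p : Fin N → ℝ) (i : Fin N) :
    |α| * (|p i| + 1) ≤ |α| * (‖p‖ + 1) := by
  have := norm_le_pi_norm p i
  rw [Real.norm_eq_abs] at this
  gcongr

theorem sum_coordPot_le {v : Fin N → ℝ} (hv : ‖v - p‖ ≤ 1) :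
    ∑ i, coordPot α (p i) (v i) ≤ (N + 1) * (exp (|α| * (‖p‖ + 1)) / 2) * ‖v - p‖ ^ 2 := by
  have h1 : ∀ i ∈ Finset.univ, coordPot α (p i) (v i) ≤
      exp (|α| * (‖p‖ + 1)) / 2 * ‖v - p‖ ^ 2 := by
    intro i _
    have h2 : |v i - p i| ≤ ‖v - p‖ := norm_le_pi_norm (v - p) i
    refine (coordPot_le (abs_mul_pi_le α p i) (h2.trans hv)).trans ?_
    rw [← sq_abs (v i - p i)]
    gcongr
  have h3 := Finset.sum_le_card_nsmul _ _ _ h1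
  rw [Finset.card_univ, Fintype.card_fin, nsmul_eq_mul] at h3
  have : 0 ≤ exp (|α| * (‖p‖ + 1)) / 2 * ‖v - p‖ ^ 2 := by positivity
  linarith

theorem le_sum_coordPot (α : ℝ) (p v : Fin N → ℝ) :
    exp (-(|α| * (‖p‖ + 1))) / 2 * min ‖v - p‖ 1 ^ 2 ≤ ∑ i, coordPot α (p i) (v i) := by
  rcases isEmpty_or_nonempty (Fin N) with hN | hN
  · rw [show v - p = 0 from Subsingleton.elim _ _]; simp
  · obtain ⟨i, hi⟩ := Finite.exists_max fun i => ‖(v - p) i‖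
    have h1 : ‖v - p‖ = |v i - p i| :=
      le_antisymm ((pi_norm_le_iff_of_nonneg (norm_nonneg _)).2 hi) (norm_le_pi_norm (v - p) i)
    rw [h1]
    exact (le_coordPot (abs_mul_pi_le α p i) (v i)).trans (Finset.single_le_sum
      (f := fun i => coordPot α (p i) (v i)) (fun i _ => coordPot_nonneg _ _ _) (Finset.mem_univ i))

theorem exp_mul_exp_neg_cancel (a b x : ℝ) : exp a * b * -(exp (-a) * x) = -(x * b) := by
  have : exp a * exp (-a) = 1 := by rw [← exp_add, add_neg_cancel, exp_zero]
  linear_combination (-(b * x)) * this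

theorem hasDerivWithinAt_sum_coordPot {s : Set ℝ} {t : ℝ} (I : Finset (Fin N))
    (hu : ∀ i, HasDerivWithinAt (fun s => u s i) (-(exp (-(α * u t i)) * G (u t) i)) s t) :
    HasDerivWithinAt (fun s => ∑ i ∈ I, coordPot α (p i) (u s i))
      (-∑ i ∈ I, G (u t) i * (u t i - p i)) s t := by
  rw [← Finset.sum_neg_distrib]
  refine HasDerivWithinAt.fun_sum fun i _ => ?_
  have h := HasDerivAt.comp_hasDerivWithinAt (h₂ := coordPot α (p i)) (h := fun s => u s i) t
    (hasDerivAt_coordPot α (p i) (u t i)) (hu i)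
  refine h.congr_deriv ?_
  rw [exp_mul_exp_neg_cancel]

/-- Trajectories of a coercive flow converge exponentially fast to its rest point. -/
theorem exists_exp_bound_of_coercive (hc : 0 < c)
    (hu : ∀ t ≥ 0, ∀ i, HasDerivWithinAt (fun s => u s i)
      (-(exp (-(α * u t i)) * G (u t) i)) (Set.Ici 0) t)
    (hG : ∀ t ≥ 0, c * min (‖u t - p‖ ^ 2) ‖u t - p‖ ≤ ∑ i, G (u t) i * (u t i - p i)) :
    ∃ C > 0, ∃ β > 0, ∀ t ≥ 0, ‖u t - p‖ ≤ C * exp (-β * t) := by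
  set Φ : ℝ → ℝ := fun t => ∑ i, coordPot α (p i) (u t i) with hΦ
  have hΦd : ∀ t ≥ 0, HasDerivWithinAt Φ (-∑ i, G (u t) i * (u t i - p i)) (Set.Ici 0) t :=
    fun t ht => hasDerivWithinAt_sum_coordPot Finset.univ (hu t ht)
  have hΦc : ContinuousOn Φ (Set.Ici 0) := fun t ht => (hΦd t ht).continuousWithinAt
  have hΦ0 : ∀ t, 0 ≤ Φ t := fun t => Finset.sum_nonneg fun i _ => coordPot_nonneg _ _ _
  set A := exp (-(|α| * (‖p‖ + 1))) / 2 with hA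
  set B := (N + 1) * (exp (|α| * (‖p‖ + 1)) / 2) with hB
  have hA0 : 0 < A := by positivity
  have hB0 : 0 < B := by positivity
  have hlow : ∀ t, A * min ‖u t - p‖ 1 ^ 2 ≤ Φ t := fun t => le_sum_coordPot α p (u t)
  have hupp : ∀ t, ‖u t - p‖ ≤ 1 → Φ t ≤ B * ‖u t - p‖ ^ 2 := fun t ht => sum_coordPot_le ht
  have hGnn : ∀ t ≥ 0, 0 ≤ ∑ i, G (u t) i * (u t i - p i) := fun t ht =>
    le_trans (mul_nonneg hc.le (le_min (sq_nonneg _) (norm_nonneg _))) (hG t ht)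
  have hanti : AntitoneOn Φ (Set.Ici 0) :=
    antitoneOn_of_hasDerivWithinAt_nonpos (convex_Ici 0) hΦc
      (fun t ht => (hΦd t (interior_subset ht)).mono interior_subset)
      fun t ht => neg_nonpos.2 (hGnn t (interior_subset ht))
  set ρ := min 1 (A / (2 * B)) with hρ
  have hρ0 : 0 < ρ := lt_min one_pos (by positivity)
  have hρ1 : ρ ≤ 1 := min_le_left _ _
  have hρA : B * ρ ^ 2 < A := by
    have h1 : ρ * (2 * B) ≤ A := by
      rw [← le_div_iff₀ (by positivity)]; exact min_le_right _ _
    nlinarith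
  obtain ⟨t₁, ht₁, hnear⟩ : ∃ t₁ ≥ 0, ‖u t₁ - p‖ < ρ := by
    by_contra! hfar
    have hanti2 : AntitoneOn (fun t => Φ t + c * ρ ^ 2 * t) (Set.Ici 0) := by
      refine antitoneOn_of_hasDerivWithinAt_nonpos (convex_Ici 0)
        (f' := fun t => -(∑ i, G (u t) i * (u t i - p i)) + c * ρ ^ 2 * 1)
        (hΦc.add (by fun_prop)) (fun t ht => ?_) fun t ht => ?_
      · exact ((hΦd t (interior_subset ht)).mono interior_subset).add
          ((hasDerivWithinAt_id _ _).const_mul _)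
      · have ht' : 0 ≤ t := interior_subset ht
        have h1 := hfar t ht'
        have h2 : ρ ^ 2 ≤ min (‖u t - p‖ ^ 2) ‖u t - p‖ :=
          le_min (by gcongr) (by nlinarith)
        have h3 := mul_le_mul_of_nonneg_left h2 hc.le
        linarith [hG t ht']
    have hq : 0 < c * ρ ^ 2 := by positivity
    have ht2 : 0 ≤ (Φ 0 + 1) / (c * ρ ^ 2) := div_nonneg (by linarith [hΦ0 0]) hq.le
    have h1 := hanti2 (Set.mem_Ici.2 le_rfl) (Set.mem_Ici.2 ht2) ht2
    simp only [mul_zero, add_zero] at h1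
    rw [mul_div_cancel₀ _ hq.ne'] at h1
    linarith [hΦ0 ((Φ 0 + 1) / (c * ρ ^ 2))]
  have hin : ∀ t ≥ t₁, ‖u t - p‖ < 1 := by
    intro t ht
    have h1 := hanti (Set.mem_Ici.2 ht₁) (Set.mem_Ici.2 (ht₁.le.trans ht)) ht
    have h2 := hupp t₁ (hnear.le.trans hρ1)
    have h3 : B * ‖u t₁ - p‖ ^ 2 ≤ B * ρ ^ 2 := by gcongr
    by_contra! h4
    have h5 := hlow t
    rw [min_eq_right h4] at h5
    linarith
  set κ := c / B with hκ
  have hκ0 : 0 < κ := div_pos hc hB0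
  have hdecay : AntitoneOn (fun t => Φ t * exp (κ * t)) (Set.Ici t₁) := by
    have hsub : Set.Ici t₁ ⊆ Set.Ici (0 : ℝ) := Set.Ici_subset_Ici.2 ht₁
    refine antitoneOn_of_hasDerivWithinAt_nonpos (convex_Ici t₁)
      (f' := fun t => (-∑ i, G (u t) i * (u t i - p i)) * exp (κ * t) +
        Φ t * (exp (κ * t) * (κ * 1))) ((hΦc.mono hsub).mul (by fun_prop))
      (fun t ht => ?_) fun t ht => ?_
    · have ht' : t ∈ Set.Ici t₁ := interior_subset ht
      exact ((hΦd t (hsub ht')).mono (interior_subset.trans hsub)).mul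
        (((hasDerivWithinAt_id _ _).const_mul κ).exp)
    · have ht' : t ∈ Set.Ici t₁ := interior_subset ht
      have h1 := hin t ht'
      have h2 := hG t (hsub ht')
      rw [min_eq_left (by nlinarith [norm_nonneg (u t - p)])] at h2
      have h3 := mul_le_mul_of_nonneg_left (hupp t h1.le) hκ0.le
      have h4 : κ * (B * ‖u t - p‖ ^ 2) = c * ‖u t - p‖ ^ 2 := by
        rw [hκ]; field_simp
      have h5 : (κ * Φ t - ∑ i, G (u t) i * (u t i - p i)) * exp (κ * t) ≤ 0 :=
        mul_nonpos_of_nonpos_of_nonneg (by linarith) (exp_pos _).le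
      linarith
  have hlate : ∀ t ≥ t₁, ‖u t - p‖ ≤ √(Φ t₁ * exp (κ * t₁) / A) * exp (-(κ / 2) * t) := by
    intro t ht
    have h1 := hdecay (Set.mem_Ici.2 le_rfl) (Set.mem_Ici.2 ht) ht
    have h2 := hlow t
    rw [min_eq_left (hin t ht).le] at h2
    have h3 : ‖u t - p‖ ^ 2 ≤ Φ t₁ * exp (κ * t₁) / A * exp (-(κ / 2) * t) ^ 2 := by
      rw [← Real.exp_nat_mul]
      have e1 : ((2 : ℕ) : ℝ) * (-(κ / 2) * t) = -(κ * t) := by push_cast; ring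
      rw [e1, exp_neg, div_mul_eq_mul_div, le_div_iff₀ hA0, ← div_eq_mul_inv,
        le_div_iff₀ (exp_pos _)]
      refine le_trans ?_ h1
      have := mul_le_mul_of_nonneg_right h2 (exp_pos (κ * t)).le
      linarith
    calc ‖u t - p‖ = √(‖u t - p‖ ^ 2) := (sqrt_sq (norm_nonneg _)).symm
      _ ≤ √(Φ t₁ * exp (κ * t₁) / A * exp (-(κ / 2) * t) ^ 2) := sqrt_le_sqrt h3
      _ = _ := by rw [sqrt_mul' _ (sq_nonneg _), sqrt_sq (exp_pos _).le]
  have hcont : ContinuousOn (fun t => ‖u t - p‖) (Set.Icc 0 t₁) := by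
    have : ContinuousOn u (Set.Icc 0 t₁) := continuousOn_pi.2 fun i t ht =>
      (hu t ht.1 i).continuousWithinAt.mono Set.Icc_subset_Ici_self
    exact (this.sub continuousOn_const).norm
  obtain ⟨Q, hQ⟩ := isCompact_Icc.bddAbove_image hcont
  have hQ' : ∀ t, 0 ≤ t → t ≤ t₁ → ‖u t - p‖ ≤ Q := fun t h0 h1 => hQ ⟨t, ⟨h0, h1⟩, rfl⟩
  have hQ0 : 0 ≤ Q := (norm_nonneg _).trans (hQ' 0 le_rfl ht₁)
  refine ⟨√(Φ t₁ * exp (κ * t₁) / A) + Q * exp (κ / 2 * t₁) + 1, by positivity, κ / 2,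
    by positivity, fun t ht => ?_⟩
  have hexp := (exp_pos (-(κ / 2) * t)).le
  rcases le_total t₁ t with h | h
  · refine (hlate t h).trans (mul_le_mul_of_nonneg_right ?_ hexp)
    have : 0 ≤ Q * exp (κ / 2 * t₁) := by positivity
    linarith
  · have h1 : Q ≤ Q * exp (κ / 2 * t₁) * exp (-(κ / 2) * t) := by
      rw [mul_assoc, ← exp_add]
      refine le_mul_of_one_le_right hQ0 (one_le_exp ?_)
      nlinarith
    refine (hQ' t ht h).trans (h1.trans (mul_le_mul_of_nonneg_right ?_ hexp))
    have := sqrt_nonneg (Φ t₁ * exp (κ * t₁) / A)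
    linarith

end Convergence

/-! ### Existence of global solutions -/

section Existence

open Set Filter Topology

/-- The inverse of `slowCoord`. -/
noncomputable def slowInv (α : ℝ) : ℝ → ℝ := Function.invFun (slowCoord α)

theorem slowInv_slowCoord (α u : ℝ) : slowInv α (slowCoord α u) = u :=
  Function.leftInverse_invFun (strictMono_slowCoord α).injective u

theorem hasDerivAt_slowInv (α u : ℝ) :
    HasDerivAt (slowInv α) (1 + exp (-(α * u))) (slowCoord α u) := by
  have h := (hasStrictDerivAt_slowCoord α u).to_local_left_inverse (by positivity)
    (Eventually.of_forall (slowInv_slowCoord α))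
  simpa using h.hasDerivAt

theorem tendsto_of_slowCoord_notMem_range {α y : ℝ} {ι : Type*} {l : Filter ι} {u : ι → ℝ}
    (hu : Tendsto (fun s => slowCoord α (u s)) l (𝓝 y)) (hy : y ∉ range (slowCoord α)) :
    Tendsto u l atTop ∨ Tendsto u l atBot := by
  have hcont : Continuous (slowCoord α) :=
    continuous_iff_continuousAt.2 fun v => (hasStrictDerivAt_slowCoord α v).hasDerivAt.continuousAt
  by_cases h : ∀ a, slowCoord α a < y
  · refine Or.inl (tendsto_atTop.2 fun R => ?_)
    filter_upwards [hu.eventually_const_lt (h R)] with s hs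
    exact ((strictMono_slowCoord α).lt_iff_lt.1 hs).le
  · push Not at h
    obtain ⟨a, ha⟩ := h
    refine Or.inr (tendsto_atBot.2 fun R => ?_)
    have hR : y < slowCoord α R := by
      by_contra! hR
      exact hy ((isPreconnected_range hcont).ordConnected.out ⟨R, rfl⟩ ⟨a, rfl⟩ ⟨hR, ha⟩)
    filter_upwards [hu.eventually_lt_const hR] with s hs
    exact ((strictMono_slowCoord α).lt_iff_lt.1 hs).le

theorem tendsto_of_tendsto_slowCoord {α v : ℝ} {ι : Type*} {l : Filter ι} {u : ι → ℝ}
    (hu : Tendsto (fun s => slowCoord α (u s)) l (𝓝 (slowCoord α v))) : Tendsto u l (𝓝 v) := by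
  have h := (hasDerivAt_slowInv α v).continuousAt.tendsto.comp hu
  simpa only [Function.comp_def, slowInv_slowCoord] using h

variable {N : ℕ} {α c M : ℝ} {p : Fin N → ℝ} {G : (Fin N → ℝ) → Fin N → ℝ} {u : ℝ → Fin N → ℝ}

theorem exists_tendsto_of_coercive {T : ℝ} (hT : 0 < T) (hc : 0 < c)
    (hu : ∀ t ∈ Ico 0 T, ∀ i,
      HasDerivWithinAt (fun s => u s i) (-(exp (-(α * u t i)) * G (u t) i)) (Ici 0) t)
    (hM : ∀ t ∈ Ico 0 T, ∀ i, |G (u t) i| ≤ M * (1 + exp (α * u t i)))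
    (hG : ∀ t ∈ Ico 0 T, c * min (‖u t - p‖ ^ 2) ‖u t - p‖ ≤ ∑ i, G (u t) i * (u t i - p i))
    (hlim : ∀ i, (∃ v, Tendsto (fun s => u s i) (𝓝[<] T) (𝓝 v)) ∨
      Tendsto (fun s => u s i) (𝓝[<] T) atTop ∨ Tendsto (fun s => u s i) (𝓝[<] T) atBot)
    (i : Fin N) : ∃ v, Tendsto (fun s => u s i) (𝓝[<] T) (𝓝 v) := by
  classical
  by_contra hi
  set I : Finset (Fin N) :=
    Finset.univ.filter fun i => ¬ ∃ v, Tendsto (fun s => u s i) (𝓝[<] T) (𝓝 v) with hI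
  have hiI : i ∈ I := by simpa [hI] using hi
  have hmem : ∀ᶠ s in 𝓝[<] T, s ∈ Ico 0 T := by
    filter_upwards [Ioo_mem_nhdsLT hT] with s hs using ⟨hs.1.le, hs.2⟩
  have hbd : ∀ j ∈ Iᶜ, ∃ B, ∀ᶠ s in 𝓝[<] T, G (u s) j * (u s j - p j) ≤ B := by
    intro j hj
    have hj' : ∃ v, Tendsto (fun s => u s j) (𝓝[<] T) (𝓝 v) := by
      simpa [hI] using hj
    obtain ⟨v, hv⟩ := hj'
    have hcv : Continuous fun x : ℝ => M * (1 + exp (α * x)) * |x - p j| := by fun_prop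
    have h := (hcv.tendsto v).comp hv
    refine ⟨M * (1 + exp (α * v)) * |v - p j| + 1, ?_⟩
    filter_upwards [hmem, h.eventually_lt_const (lt_add_one _)] with s hs hs'
    have h1 : G (u s) j * (u s j - p j) ≤ |G (u s) j| * |u s j - p j| := by
      rw [← abs_mul]; exact le_abs_self _
    have h2 := mul_le_mul_of_nonneg_right (hM s hs j) (abs_nonneg (u s j - p j))
    simp only [Function.comp_apply] at hs'
    linarith
  choose! B hB using hbd
  have hB' : ∀ᶠ s in 𝓝[<] T, ∀ j ∈ Iᶜ, G (u s) j * (u s j - p j) ≤ B j :=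
    (Filter.eventually_all_finset _).2 hB
  have hfar : ∀ R, ∀ᶠ s in 𝓝[<] T, R ≤ |u s i - p i| := by
    intro R
    rcases (hlim i).resolve_left hi with h | h
    · filter_upwards [h.eventually_ge_atTop (R + p i)] with s hs
      linarith [le_abs_self (u s i - p i)]
    · filter_upwards [h.eventually_le_atBot (p i - R)] with s hs
      linarith [neg_abs_le (u s i - p i)]
  have hnonneg : ∀ᶠ s in 𝓝[<] T, 0 ≤ ∑ j ∈ I, G (u s) j * (u s j - p j) := by
    filter_upwards [hmem, hB', hfar 1, hfar ((∑ j ∈ Iᶜ, B j) / c)] with s hs h1 h2 h3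
    have hn : |u s i - p i| ≤ ‖u s - p‖ := by
      simpa using norm_le_pi_norm (u s - p) i
    have hmin : min (‖u s - p‖ ^ 2) ‖u s - p‖ = ‖u s - p‖ := by
      refine min_eq_right ?_
      nlinarith
    have h4 := hG s hs
    rw [hmin, ← Finset.sum_add_sum_compl I] at h4
    have h5 := Finset.sum_le_sum h1
    have h6 : ∑ j ∈ Iᶜ, B j ≤ c * ‖u s - p‖ := by
      rw [div_le_iff₀' hc] at h3
      exact h3.trans (mul_le_mul_of_nonneg_left hn hc.le)
    linarith
  have hside : ∀ j ∈ I, ∀ᶠ s in 𝓝[<] T, ∀ᶠ r in 𝓝[<] T,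
      coordPot α (p j) (u s j) < coordPot α (p j) (u r j) := by
    intro j hj
    have hj' : ¬ ∃ v, Tendsto (fun s => u s j) (𝓝[<] T) (𝓝 v) := (Finset.mem_filter.1 hj).2
    rcases (hlim j).resolve_left hj' with h | h
    · filter_upwards [h.eventually_ge_atTop (p j)] with s hs
      filter_upwards [h.eventually_gt_atTop (u s j)] with r hr
      exact strictMonoOn_coordPot α (p j) hs (hs.trans hr.le) hr
    · filter_upwards [h.eventually_le_atBot (p j)] with s hs
      filter_upwards [h.eventually_lt_atBot (u s j)] with r hr
      exact strictAntiOn_coordPot α (p j) (hr.le.trans hs) hs hr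
  have hside' := (Filter.eventually_all_finset I).2 hside
  obtain ⟨a, haT, ha⟩ := (mem_nhdsLT_iff_exists_Ioo_subset).1 (hmem.and (hnonneg.and hside'))
  obtain ⟨s, hs⟩ := nonempty_Ioo.2 (show a < T from haT)
  have hr := (Filter.eventually_all_finset I).2 (ha hs).2.2
  obtain ⟨r, hr1, hr2, hr3⟩ := (hr.and (Ioo_mem_nhdsLT hs.2)).exists
  have hsub : Icc s r ⊆ Ioo a T := fun x hx => ⟨hs.1.trans_le hx.1, hx.2.trans_lt hr3⟩
  have hder : ∀ x ∈ Icc s r, HasDerivWithinAt (fun s => ∑ j ∈ I, coordPot α (p j) (u s j))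
      (-∑ j ∈ I, G (u x) j * (u x j - p j)) (Icc s r) x := fun x hx =>
    (hasDerivWithinAt_sum_coordPot I (hu x (ha (hsub hx)).1)).mono
      fun y hy => (ha (hsub hy)).1.1
  have hanti := antitoneOn_of_hasDerivWithinAt_nonpos (convex_Icc s r)
    (fun x hx => (hder x hx).continuousWithinAt)
    (fun x hx => (hder x (interior_subset hx)).mono interior_subset)
    (fun x hx => neg_nonpos.2 (ha (hsub (interior_subset hx))).2.1)
  have h1 := hanti (left_mem_Icc.2 hr2.le) (right_mem_Icc.2 hr2.le) hr2.le
  have h2 := Finset.sum_lt_sum_of_nonempty ⟨i, hiI⟩ hr1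
  exact absurd h1 (not_le.2 h2)

/-- Solutions stay below a barrier. -/
theorem le_of_barrier {P : Fin N → Prop} {T b : ℝ} {i : Fin N}
    (hu : ∀ t ∈ Ico 0 T,
      HasDerivWithinAt (fun s => u s i) (-(exp (-(α * u t i)) * G (u t) i)) (Ici 0) t)
    (hD : ∀ t ∈ Ico 0 T, ∀ i, P i → u t i < 0)
    (hb : ∀ v : Fin N → ℝ, (∀ i, P i → v i < 0) → b < v i → 0 < G v i) (hb0 : b < 0)
    {t : ℝ} (ht : t ∈ Ico 0 T) : u t i ≤ max (b / 2) (u 0 i) := by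
  have hsub : Icc 0 t ⊆ Ico 0 T := fun x hx => ⟨hx.1, hx.2.trans_lt ht.2⟩
  refine image_le_of_deriv_right_lt_deriv_boundary (f := fun s => u s i)
    (f' := fun t => -(exp (-(α * u t i)) * G (u t) i)) (B := fun _ => max (b / 2) (u 0 i))
    (B' := fun _ => 0) (a := 0) (b := t)
    (fun x hx => (hu x (hsub hx)).continuousWithinAt.mono fun y hy => hy.1)
    (fun x hx => (hu x (hsub ⟨hx.1, hx.2.le⟩)).mono fun y hy => hx.1.trans hy)
    (le_max_right _ _) (fun x => hasDerivAt_const x _) (fun x hx hxe => ?_) ⟨ht.1, le_rfl⟩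
  have hlt : b < u x i := by
    rw [hxe]
    exact lt_of_lt_of_le (by linarith) (le_max_left _ _)
  exact neg_neg_of_pos (mul_pos (exp_pos _) (hb _ (hD x (hsub ⟨hx.1, hx.2.le⟩)) hlt))

theorem exists_global_solution {P : Fin N → Prop} (hc : 0 < c)
    (hcont : ∀ v : Fin N → ℝ, (∀ i, P i → v i < 0) → ∀ i, ContinuousAt (fun w => G w i) v)
    (hM : ∀ v : Fin N → ℝ, (∀ i, P i → v i < 0) → ∀ i, |G v i| ≤ M * (1 + exp (α * v i)))
    (hbar : ∀ i, P i → ∃ b < 0, ∀ v : Fin N → ℝ, (∀ i, P i → v i < 0) → b < v i → 0 < G v i)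
    (hG : ∀ v : Fin N → ℝ, (∀ i, P i → v i < 0) →
      c * min (‖v - p‖ ^ 2) ‖v - p‖ ≤ ∑ i, G v i * (v i - p i))
    {u₀ : Fin N → ℝ} (hu₀ : ∀ i, P i → u₀ i < 0) :
    ∃ u : ℝ → Fin N → ℝ, u 0 = u₀ ∧ ∀ t ≥ 0, (∀ i, P i → u t i < 0) ∧
      ∀ i, HasDerivWithinAt (fun s => u s i) (-(exp (-(α * u t i)) * G (u t) i)) (Ici 0) t := by
  classical
  let γ := slowCoord α
  let g := slowInv α
  let gg : (Fin N → ℝ) → Fin N → ℝ := fun y i => g (y i)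
  have hgγ : ∀ v, g (γ v) = v := slowInv_slowCoord α
  let V : Fin N → Set ℝ := fun i => γ '' {v | P i → v < 0}
  have hV : ∀ i, IsOpen (V i) := fun i => by
    refine isOpenMap_of_hasStrictDerivAt (hasStrictDerivAt_slowCoord α)
      (fun u => by positivity) _ ?_
    by_cases hi : P i
    · simpa [hi, Iio] using isOpen_Iio (a := (0 : ℝ))
    · simp [hi]
  let U : Set (Fin N → ℝ) := {y | ∀ i, y i ∈ V i}
  have hU : IsOpen U := by
    have : U = Set.pi univ V := by ext; simp [U, Set.mem_pi]
    rw [this]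
    exact isOpen_set_pi finite_univ fun i _ => hV i
  have hUD : ∀ y ∈ U, ∀ i, P i → gg y i < 0 := by
    intro y hy i hi
    obtain ⟨v, hv, hvy⟩ := hy i
    simp only [gg, ← hvy, hgγ]
    exact hv hi
  have hUγ : ∀ y ∈ U, ∀ i, γ (gg y i) = y i := by
    intro y hy i
    obtain ⟨v, hv, hvy⟩ := hy i
    simp only [gg, ← hvy, hgγ]
  let F : (Fin N → ℝ) → Fin N → ℝ := fun y i =>
    if y ∈ U then -(G (gg y) i * (1 + exp (α * gg y i))⁻¹) else 0
  have hF : ∀ y, ‖F y‖ ≤ |M| := by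
    intro y
    refine (pi_norm_le_iff_of_nonneg (abs_nonneg M)).2 fun i => ?_
    by_cases hy : y ∈ U
    · simp only [F, if_pos hy, norm_neg, norm_mul, norm_inv, Real.norm_eq_abs]
      have hpos : 0 < 1 + exp (α * gg y i) := by positivity
      rw [abs_of_pos hpos, ← div_eq_mul_inv, div_le_iff₀ hpos]
      exact (hM _ (hUD y hy) i).trans (mul_le_mul_of_nonneg_right (le_abs_self M) hpos.le)
    · simp [F, if_neg hy]
  have hgg : ∀ y ∈ U, ContinuousAt gg y := fun y hy => continuousAt_pi.2 fun i => by
    have h := (hasDerivAt_slowInv α (gg y i)).continuousAt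
    have h' : ContinuousAt g (y i) := by rw [← hUγ y hy i]; exact h
    exact ContinuousAt.comp (f := fun y : Fin N → ℝ => y i) h' (continuous_apply i).continuousAt
  have hFc : ∀ y ∈ U, ContinuousAt F y := by
    intro y hy
    refine continuousAt_pi.2 fun i => ?_
    have h1 : ContinuousAt (fun y => -(G (gg y) i * (1 + exp (α * gg y i))⁻¹)) y := by
      have h2 : ContinuousAt (fun y => G (gg y) i) y :=
        ContinuousAt.comp (g := fun w => G w i) (hcont _ (hUD y hy) i) (hgg y hy)
      have h3 : ContinuousAt (fun y => gg y i) y := continuousAt_pi.1 (hgg y hy) i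
      refine (h2.mul (ContinuousAt.inv₀ ?_ (by positivity))).neg
      fun_prop
    refine h1.congr ?_
    filter_upwards [hU.mem_nhds hy] with z hz
    simp only [F, if_pos hz]
  obtain ⟨x, hx0, hxc, hxd⟩ := exists_limit_of_euler hF fun i => γ (u₀ i)
  have hgx0 : gg (x 0) = u₀ := by
    funext i
    simp only [gg, hx0, hgγ]
  have hder : ∀ t ≥ 0, x t ∈ U → ∀ i, HasDerivWithinAt (fun s => gg (x s) i)
      (-(exp (-(α * gg (x t) i)) * G (gg (x t)) i)) (Ici 0) t := by
    intro t ht htU i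
    have h1 := hasDerivWithinAt_pi.1 (hxd t ht (hFc _ htU)) i
    have h2 : HasDerivAt g (1 + exp (-(α * gg (x t) i))) (x t i) := by
      have := hasDerivAt_slowInv α (gg (x t) i)
      rwa [show slowCoord α (gg (x t) i) = x t i from hUγ _ htU i] at this
    refine (HasDerivAt.comp_hasDerivWithinAt (h₂ := g) (h := fun s => x s i) t h2 h1).congr_deriv ?_
    simp only [F, if_pos htU, exp_neg]
    have := exp_pos (α * gg (x t) i)
    field_simp
    ring
  have hall : ∀ t ≥ 0, x t ∈ U := by
    by_contra! hex
    let Z : Set ℝ := Ici 0 ∩ x ⁻¹' Uᶜ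
    have hZc : IsClosed Z := hxc.preimage_isClosed_of_isClosed isClosed_Ici hU.isClosed_compl
    have hZn : Z.Nonempty := by
      obtain ⟨t, ht, htU⟩ := hex
      exact ⟨t, ht, htU⟩
    have hZb : BddBelow Z := ⟨0, fun t ht => ht.1⟩
    have hTZ : sInf Z ∈ Z := hZc.csInf_mem hZn hZb
    set T := sInf Z with hTdef
    have hTU : x T ∉ U := hTZ.2
    have hbefore : ∀ t ∈ Ico 0 T, x t ∈ U := fun t ht => by
      by_contra htU
      exact not_le.2 ht.2 (csInf_le hZb ⟨ht.1, htU⟩)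
    have hx0U : x 0 ∈ U := fun i => by
      rw [hx0]
      exact ⟨u₀ i, hu₀ i, rfl⟩
    have hT : 0 < T := lt_of_le_of_ne hTZ.1 fun h => hTU (h ▸ hx0U)
    have hmem : ∀ᶠ s in 𝓝[<] T, s ∈ Ico 0 T := by
      filter_upwards [Ioo_mem_nhdsLT hT] with s hs using ⟨hs.1.le, hs.2⟩
    have hxT : ∀ i, Tendsto (fun s => γ (gg (x s) i)) (𝓝[<] T) (𝓝 (x T i)) := by
      intro i
      have h1 : Tendsto x (𝓝[<] T) (𝓝 (x T)) :=
        (hxc T hTZ.1).tendsto.mono_left (nhdsWithin_le_of_mem (hmem.mono fun s hs => hs.1))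
      refine (tendsto_pi_nhds.1 h1 i).congr' ?_
      filter_upwards [hmem] with s hs
      exact (hUγ _ (hbefore s hs) i).symm
    have hlim := exists_tendsto_of_coercive (u := fun s => gg (x s)) hT hc
      (fun t ht i => hder t ht.1 (hbefore t ht) i) (fun t ht i => hM _ (hUD _ (hbefore t ht)) i)
      (fun t ht => hG _ (hUD _ (hbefore t ht))) fun i => by
        by_cases hi : x T i ∈ range (slowCoord α)
        · obtain ⟨v, hv⟩ := hi
          exact Or.inl ⟨v, tendsto_of_tendsto_slowCoord (hv ▸ hxT i)⟩
        · exact Or.inr (tendsto_of_slowCoord_notMem_range (hxT i) hi)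
    refine hTU fun i => ?_
    obtain ⟨v, hv⟩ := hlim i
    have h1 : Tendsto (fun s => γ (gg (x s) i)) (𝓝[<] T) (𝓝 (γ v)) :=
      (hasStrictDerivAt_slowCoord α v).hasDerivAt.continuousAt.tendsto.comp hv
    refine ⟨v, fun hi => ?_, tendsto_nhds_unique h1 (hxT i)⟩
    obtain ⟨b, hb0, hb⟩ := hbar i hi
    have h2 : v ≤ max (b / 2) (gg (x 0) i) := by
      refine le_of_tendsto hv ?_
      filter_upwards [hmem] with s hs
      exact le_of_barrier (u := fun s => gg (x s)) (P := P)
        (fun t ht => hder t ht.1 (hbefore t ht) i) (fun t ht => hUD _ (hbefore t ht)) hb hb0 hs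
    refine h2.trans_lt (max_lt (by linarith) ?_)
    rw [hgx0]
    exact hu₀ i hi
  exact ⟨fun s => gg (x s), hgx0, fun t ht => ⟨hUD _ (hall t ht), hder t ht (hall t ht)⟩⟩

end Existence

/-! ### The modified flow -/

namespace TriSurface

variable {N : ℕ} {S : TriSurface N} {W : Weights S} {α : ℝ} {Rbar fbar f : Fin N → ℝ}

theorem exists_coercive_modified (hbar : admissibleH W fbar)
    (hR : ∀ i, RH W α fbar i = Rbar i) (hsign : ∀ i, α * Rbar i ≤ 0) :
    ∃ c > 0, ∀ v ∈ Dom W, c * min (‖v - uOf W fbar‖ ^ 2) ‖v - uOf W fbar‖ ≤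
      ∑ i, (KU W v i - Rbar i * exp (α * v i)) * (v i - uOf W fbar i) := by
  obtain ⟨c, hc, h⟩ := exists_coercive_KU (uOf_mem_Dom W fbar)
    fun i j k hf => faceDisc_pos_of_admissible hbar hf
  refine ⟨c, hc, fun v hv => (h v hv).trans (Finset.sum_le_sum fun i _ => ?_)⟩
  have hK : KU W (uOf W fbar) i = Rbar i * exp (α * uOf W fbar i) := by
    rw [← hR i, RH, KH_eq, mul_assoc, ← exp_add, neg_add_cancel, exp_zero, mul_one]
  rw [hK]
  have hmono : Rbar i * (exp (α * v i) - exp (α * uOf W fbar i)) * (v i - uOf W fbar i) ≤ 0 := by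
    set x := v i
    set y := uOf W fbar i
    rcases lt_trichotomy α 0 with hα | hα | hα
    · have hRi : 0 ≤ Rbar i := by nlinarith [hsign i]
      rw [mul_assoc]
      refine mul_nonpos_of_nonneg_of_nonpos hRi ?_
      rcases le_total x y with hxy | hxy
      · have : exp (α * y) ≤ exp (α * x) := exp_le_exp.2 (mul_le_mul_of_nonpos_left hxy hα.le)
        nlinarith
      · have : exp (α * x) ≤ exp (α * y) := exp_le_exp.2 (mul_le_mul_of_nonpos_left hxy hα.le)
        nlinarith
    · simp [hα]
    · have hRi : Rbar i ≤ 0 := by nlinarith [hsign i]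
      rw [mul_assoc]
      refine mul_nonpos_of_nonpos_of_nonneg hRi ?_
      rcases le_total x y with hxy | hxy
      · have : exp (α * x) ≤ exp (α * y) := exp_le_exp.2 (mul_le_mul_of_nonneg_left hxy hα.le)
        nlinarith
      · have : exp (α * y) ≤ exp (α * x) := exp_le_exp.2 (mul_le_mul_of_nonneg_left hxy hα.le)
        nlinarith
  linarith

theorem exists_abs_modified_le (W : Weights S) (α : ℝ) (Rbar : Fin N → ℝ) :
    ∃ M, ∀ v : Fin N → ℝ, ∀ i,
      |KU W v i - Rbar i * exp (α * v i)| ≤ M * (1 + exp (α * v i)) := by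
  refine ⟨2 * π + S.F.card * π + ‖Rbar‖, fun v i => ?_⟩
  have h1 := KU_le W v i
  have h2 := le_KU W v i
  have h3 : |Rbar i| ≤ ‖Rbar‖ := norm_le_pi_norm Rbar i
  have h4 := exp_pos (α * v i)
  have h5 : 0 ≤ S.F.card * π := by positivity
  have h6 := pi_pos
  have h7 : |KU W v i| ≤ 2 * π + S.F.card * π := abs_le.2 ⟨by linarith, by linarith⟩
  calc |KU W v i - Rbar i * exp (α * v i)| ≤ |KU W v i| + |Rbar i * exp (α * v i)| := abs_sub _ _
    _ ≤ (2 * π + S.F.card * π) + ‖Rbar‖ * exp (α * v i) := by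
      rw [abs_mul, abs_of_pos h4]
      exact add_le_add h7 (mul_le_mul_of_nonneg_right h3 h4.le)
    _ ≤ _ := by
      have : 0 ≤ (2 * π + S.F.card * π) * exp (α * v i) := by positivity
      nlinarith [norm_nonneg Rbar]

theorem flow_speed_eq (W : Weights S) (α : ℝ) (Rbar f : Fin N → ℝ) (i : Fin N) :
    -(exp (-(α * uOf W f i)) * (KU W (uOf W f) i - Rbar i * exp (α * uOf W f i))) =
      Rbar i - RExH W α f i := by
  have : exp (-(α * uOf W f i)) * exp (α * uOf W f i) = 1 := by
    rw [← exp_add, neg_add_cancel, exp_zero]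
  rw [RExH, KExH_eq]
  linear_combination Rbar i * this

theorem enorm_le (v : Fin N → ℝ) : TriSurface.enorm v ≤ √N * ‖v‖ := by
  rw [TriSurface.enorm]
  refine (Real.sqrt_le_sqrt (Finset.sum_le_card_nsmul Finset.univ _ (‖v‖ ^ 2) fun i _ => ?_)).trans
    (le_of_eq ?_)
  · rw [← sq_abs]
    exact pow_le_pow_left₀ (abs_nonneg _) (norm_le_pi_norm v i) 2
  · rw [Finset.card_univ, Fintype.card_fin, nsmul_eq_mul, Real.sqrt_mul (Nat.cast_nonneg N),
      Real.sqrt_sq (norm_nonneg v)]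

theorem expConvergesToH_of_isExtModRicciSolH (hbar : admissibleH W fbar)
    (hR : ∀ i, RH W α fbar i = Rbar i) (hsign : ∀ i, α * Rbar i ≤ 0) {f : ℝ → Fin N → ℝ}
    (hf : IsExtModRicciSolH W α Rbar f) : ExpConvergesToH W f fbar := by
  obtain ⟨c, hc, hG⟩ := exists_coercive_modified hbar hR hsign
  obtain ⟨C, hC, β, hβ, h⟩ := exists_exp_bound_of_coercive (α := α) (p := uOf W fbar)
    (G := fun v i => KU W v i - Rbar i * exp (α * v i)) (u := fun t => uOf W (f t)) hc
    (fun t ht i => (hf t ht i).congr_deriv (flow_speed_eq W α Rbar (f t) i).symm)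
    (fun t _ => hG _ (uOf_mem_Dom W (f t)))
  refine ⟨(√N + 1) * C, by positivity, β, hβ, fun t ht => (enorm_le _).trans ?_⟩
  rw [mul_assoc]
  exact mul_le_mul (by linarith) (h t ht) (norm_nonneg _) (by positivity)

theorem exists_isExtModRicciSolH (hbar : admissibleH W fbar)
    (hR : ∀ i, RH W α fbar i = Rbar i) (hsign : ∀ i, α * Rbar i ≤ 0)
    (hlt : ∀ i, Rbar i < 2 * π) (f₀ : Fin N → ℝ) :
    ∃ f : ℝ → Fin N → ℝ, f 0 = f₀ ∧ IsExtModRicciSolH W α Rbar f := by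
  obtain ⟨c, hc, hG⟩ := exists_coercive_modified hbar hR hsign
  obtain ⟨M, hM⟩ := exists_abs_modified_le W α Rbar
  obtain ⟨u, hu0, hu⟩ := exists_global_solution (α := α) (p := uOf W fbar)
    (P := fun i => W.eps i = 1) (G := fun v i => KU W v i - Rbar i * exp (α * v i)) hc
    (fun v hv i => (continuousAt_KU hv i).sub
      (Continuous.continuousAt (f := fun w : Fin N → ℝ => Rbar i * exp (α * w i)) (by fun_prop))) (fun v _ => hM v)
    (fun i hi => exists_barrier hi (hlt i) α) hG (uOf_mem_Dom W f₀)
  let f : ℝ → Fin N → ℝ := fun t i => log (vS (W.eps i) (u t i))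
  have huf : ∀ t ≥ 0, uOf W (f t) = u t := fun t ht =>
    funext fun i => ucoord_log_vS (W.eps01 i) ((hu t ht).1 i)
  refine ⟨f, funext fun i => ?_, fun t ht i => ?_⟩
  · simp only [f, hu0, uOf, vS_ucoord (W.eps01 i), log_exp]
  · have h := (hu t ht).2 i
    rw [← huf t ht] at h
    refine (h.congr_deriv (flow_speed_eq W α Rbar (f t) i)).congr_of_mem (fun s hs => ?_) ht
    rw [huf s hs]

end TriSurface

/-- global convergence of the extended modified combinatorial `α`-Ricci
flow, hyperbolic background.  Suppose `ū ∈ U^H` has combinatorial `α`-curvature `R̄` and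
one of: (1) `α > 0` and `R̄ ≤ 0`; (2) `α < 0` and `R̄_i ∈ [0,2π)`; (3) `α = 0`,
`R̄_i < 2π` and `Σ R̄_i > 2πχ`.  Then for every initial value (given by an arbitrary
conformal factor `f0 : ℝᴺ`, i.e. an arbitrary `u(0) ∈ ℝ^{N₀} × (−∞,0)^{N₁}`) the extended
flow admits a global solution starting there, and every such global solution converges
exponentially fast to `ū`. -/
theorem extended_modified_ricci_flow_global_convergence_hyperbolic {N : ℕ}
    (S : TriSurface N) (W : TriSurface.Weights S) (α : ℝ) (Rbar : Fin N → ℝ)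
    (fbar : Fin N → ℝ) (hbar : admissibleH W fbar)
    (hR : ∀ i, RH W α fbar i = Rbar i)
    (hcond : (α > 0 ∧ ∀ i, Rbar i ≤ 0) ∨
      (α < 0 ∧ ∀ i, 0 ≤ Rbar i ∧ Rbar i < 2 * π) ∨
      (α = 0 ∧ (∀ i, Rbar i < 2 * π) ∧ ∑ i, Rbar i > 2 * π * (S.chi : ℝ)))
    (f0 : Fin N → ℝ) :
    (∃ f : ℝ → Fin N → ℝ, f 0 = f0 ∧ IsExtModRicciSolH W α Rbar f ∧
      ExpConvergesToH W f fbar) ∧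
    (∀ f : ℝ → Fin N → ℝ, f 0 = f0 → IsExtModRicciSolH W α Rbar f →
      ExpConvergesToH W f fbar) := by
  have hsign : ∀ i, α * Rbar i ≤ 0 := by
    intro i
    rcases hcond with ⟨hα, h⟩ | ⟨hα, h⟩ | ⟨hα, -, -⟩
    · exact mul_nonpos_of_nonneg_of_nonpos hα.le (h i)
    · exact mul_nonpos_of_nonpos_of_nonneg hα.le (h i).1
    · simp [hα]
  have hlt : ∀ i, Rbar i < 2 * π := by
    intro i
    rcases hcond with ⟨-, h⟩ | ⟨-, h⟩ | ⟨-, h, -⟩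
    · exact (h i).trans_lt two_pi_pos
    · exact (h i).2
    · exact h i
  obtain ⟨f, hf0, hf⟩ := exists_isExtModRicciSolH hbar hR hsign hlt f0
  exact ⟨⟨f, hf0, hf, expConvergesToH_of_isExtModRicciSolH hbar hR hsign hf⟩,
    fun f _ hf => expConvergesToH_of_isExtModRicciSolH hbar hR hsign hf⟩
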